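/- (Hilbert–Schmidt norm of a hyperbolic pseudodifferential operator on the disc.) Let a : 𝔻 × S¹ × ℝ → ℂ be smooth and compactly supported, and assume the Weyl symmetry: for all z, w ∈ 𝔻 and r ∈ ℝ, ∫_{S¹} a(z,b,r) P(z,b)^{1/2+ir} P(w,b)^{1/2−ir} db = ∫_{S¹} a(z,b,−r) P(z,b)^{1/2−ir} P(w,b)^{1/2+ir} db. Define the Schwartz kernel K_a(z,w) = ∫_{S¹} ∫_0^∞ a(z,b,r) P(z,b)^{1/2+ir} P(w,b)^{1/2−ir} (2π)^{−1} r·tanh(πr) dr db. Then ∫_𝔻 ∫_𝔻 |K_a(z,w)|² Vol(dz) Vol(dw) = (1/2) ∫_𝔻 ∫_{S¹} ∫_ℝ |a(z,b,r)|² P(z,b) (2π)^{−1} r·tanh(πr) Vol(dz) db dr; i.e., the quantization a ↦ Op(a) is unitary from L²_W(G × ℝ, dg × dp) onto the Hilbert–Schmidt operators on 𝔻. -/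

import Mathlib

open Complex MeasureTheory Real

noncomputable section

/-- Poisson kernel on 𝔻 × S¹. -/
def Pk (z b : ℂ) : ℝ := (1 - ‖z‖ ^ 2) / ‖z - b‖ ^ 2

/-- Normalized arclength (probability) measure on the unit circle S¹ ⊆ ℂ. -/
def circleMeasure : Measure ℂ :=
  (ENNReal.ofReal (2 * Real.pi))⁻¹ •
    (volume.restrict (Set.Ioc (0 : ℝ) (2 * Real.pi))).map
      (fun θ : ℝ => Complex.exp ((θ : ℂ) * Complex.I))

/-- Hyperbolic area measure on the unit disc 𝔻. -/
def hypVol : Measure ℂ :=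
  (volume.restrict (Metric.ball (0 : ℂ) 1)).withDensity
    (fun z => ENNReal.ofReal (4 / (1 - ‖z‖ ^ 2) ^ 2))

open scoped ComplexConjugate

instance : IsProbabilityMeasure circleMeasure := by
  constructor
  have hm : Measurable (fun θ : ℝ => Complex.exp ((θ : ℂ) * Complex.I)) := by fun_prop
  rw [circleMeasure, Measure.smul_apply, Measure.map_apply hm MeasurableSet.univ]
  simp only [Set.preimage_univ, Measure.restrict_apply_univ, Real.volume_Ioc, sub_zero, smul_eq_mul]
  rw [ENNReal.inv_mul_cancel]
  · simp [Real.pi_pos]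
  · exact ENNReal.ofReal_ne_top

theorem ae_norm_eq_one : ∀ᵐ b ∂circleMeasure, ‖b‖ = 1 := by
  have hm : Measurable (fun θ : ℝ => Complex.exp ((θ : ℂ) * Complex.I)) := by fun_prop
  refine Measure.ae_smul_measure ?_ _
  rw [ae_map_iff hm.aemeasurable (measurableSet_eq_fun (by fun_prop) (by fun_prop))]
  exact Filter.Eventually.of_forall fun θ => Complex.norm_exp_ofReal_mul_I θ

theorem integral_circleMeasure {E : Type*} [NormedAddCommGroup E] [NormedSpace ℝ E] {h : ℂ → E}
    (hh : AEStronglyMeasurable h circleMeasure) :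
    ∫ b, h b ∂circleMeasure =
      (2 * π)⁻¹ • ∫ θ in (0 : ℝ)..(2 * π), h (Complex.exp (θ * Complex.I)) := by
  have hm : Measurable (fun θ : ℝ => Complex.exp ((θ : ℂ) * Complex.I)) := by fun_prop
  have hc : (ENNReal.ofReal (2 * π))⁻¹ ≠ 0 := ENNReal.inv_ne_zero.2 ENNReal.ofReal_ne_top
  have hh' : AEStronglyMeasurable h ((volume.restrict (Set.Ioc (0 : ℝ) (2 * Real.pi))).map
      (fun θ : ℝ => Complex.exp ((θ : ℂ) * Complex.I))) := by
    refine hh.mono_ac ?_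
    exact Measure.absolutelyContinuous_smul hc
  rw [circleMeasure, integral_smul_measure, integral_map hm.aemeasurable hh',
    intervalIntegral.integral_of_le (by positivity)]
  congr 1
  rw [ENNReal.toReal_inv, ENNReal.toReal_ofReal (by positivity)]

theorem ContinuousOn.aestronglyMeasurable_circleMeasure {E : Type*} [NormedAddCommGroup E]
    {h : ℂ → E} (hh : ContinuousOn h (Metric.sphere 0 1)) :
    AEStronglyMeasurable h circleMeasure := by
  have := hh.aestronglyMeasurable_of_isCompact (μ := circleMeasure) (isCompact_sphere 0 1)
    Metric.isClosed_sphere.measurableSet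
  rwa [Measure.restrict_eq_self_of_ae_mem] at this
  filter_upwards [ae_norm_eq_one] with b hb
  simpa using hb

/-- The Möbius transformation of the disc sending `z` to `0`. -/
def mob (z v : ℂ) : ℂ := (v - z) / (1 - conj z * v)

theorem norm_one_sub_conj_mul {z b : ℂ} (hb : ‖b‖ = 1) : ‖1 - conj z * b‖ = ‖z - b‖ := by
  have h1 : conj b * b = 1 := by rw [← normSq_eq_conj_mul_self, normSq_eq_norm_sq, hb]; simp
  have : 1 - conj z * b = -(conj (z - b) * b) := by rw [map_sub, sub_mul, h1]; ring
  rw [this, norm_neg, norm_mul, hb, mul_one, RCLike.norm_conj]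

theorem one_sub_conj_mul_ne_zero {z v : ℂ} (hz : ‖z‖ < 1) (hv : ‖v‖ ≤ 1) : 1 - conj z * v ≠ 0 := by
  intro h
  have : ‖conj z * v‖ = 1 := by rw [← sub_eq_zero.1 h]; simp
  rw [norm_mul, RCLike.norm_conj] at this
  nlinarith [norm_nonneg z, norm_nonneg v]

theorem one_sub_norm_mob_sq {z v : ℂ} (hz : ‖z‖ < 1) (hv : ‖v‖ ≤ 1) :
    1 - ‖mob z v‖ ^ 2 = (1 - ‖z‖ ^ 2) * (1 - ‖v‖ ^ 2) / ‖1 - conj z * v‖ ^ 2 := by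
  have h0 : ‖1 - conj z * v‖ ^ 2 ≠ 0 := by
    simpa using one_sub_conj_mul_ne_zero hz hv
  rw [mob, norm_div, div_pow, eq_div_iff h0, sub_mul, div_mul_cancel₀ _ h0]
  simp only [← normSq_eq_norm_sq, normSq_apply]
  simp
  ring

theorem norm_mob_lt_one {z v : ℂ} (hz : ‖z‖ < 1) (hv : ‖v‖ < 1) : ‖mob z v‖ < 1 := by
  have h := one_sub_norm_mob_sq hz hv.le
  have h0 : 0 < ‖1 - conj z * v‖ := norm_pos_iff.2 (one_sub_conj_mul_ne_zero hz hv.le)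
  have : 0 < 1 - ‖mob z v‖ ^ 2 := by
    rw [h]
    have h1 : 0 < 1 - ‖z‖ ^ 2 := by nlinarith [norm_nonneg z]
    have h2 : 0 < 1 - ‖v‖ ^ 2 := by nlinarith [norm_nonneg v]
    positivity
  nlinarith [norm_nonneg (mob z v)]

theorem norm_mob_eq_one {z b : ℂ} (hz : ‖z‖ < 1) (hb : ‖b‖ = 1) : ‖mob z b‖ = 1 := by
  have h := one_sub_norm_mob_sq hz hb.le
  rw [hb] at h
  have : ‖mob z b‖ ^ 2 = 1 := by
    norm_num at h
    linarith
  nlinarith [norm_nonneg (mob z b)]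

theorem mob_neg_mob {z v : ℂ} (hz : ‖z‖ < 1) (hv : ‖v‖ < 1) : mob (-z) (mob z v) = v := by
  have h1 := one_sub_conj_mul_ne_zero hz hv.le
  have h2 := one_sub_conj_mul_ne_zero (z := -z) (by simpa using hz) (norm_mob_lt_one hz hv).le
  have h1' : 1 - v * conj z ≠ 0 := by rwa [mul_comm] at h1
  rw [mob, div_eq_iff h2, mob]
  field_simp
  simp
  ring

theorem norm_mob_comm (z v : ℂ) : ‖mob z v‖ = ‖mob v z‖ := by
  rw [mob, mob, norm_div, norm_div, norm_sub_rev, ← RCLike.norm_conj (1 - conj z * v)]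
  simp [mul_comm]

theorem Pk_pos {z b : ℂ} (hz : ‖z‖ < 1) (hb : ‖b‖ = 1) : 0 < Pk z b := by
  have : z - b ≠ 0 := by
    intro h; rw [sub_eq_zero] at h; rw [h] at hz; exact hz.ne hb
  have h1 : 0 < 1 - ‖z‖ ^ 2 := by nlinarith [norm_nonneg z]
  have := norm_pos_iff.2 this
  unfold Pk
  positivity

theorem Pk_eq_mul_Pk_mob {z v b : ℂ} (hz : ‖z‖ < 1) (hv : ‖v‖ < 1) (hb : ‖b‖ = 1) :
    Pk v b = Pk z b * Pk (mob z v) (mob z b) := by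
  have h1 := one_sub_conj_mul_ne_zero hz hv.le
  have h2 := one_sub_conj_mul_ne_zero hz hb.le
  have h3 : (1 : ℂ) - conj z * z ≠ 0 := one_sub_conj_mul_ne_zero hz hz.le
  have hzb : 0 < ‖z - b‖ := by rw [← norm_one_sub_conj_mul hb]; exact norm_pos_iff.2 h2
  have h4 : mob z v - mob z b = (v - b) * (1 - conj z * z) / ((1 - conj z * v) * (1 - conj z * b)) := by
    have h1' : 1 - v * conj z ≠ 0 := by rwa [mul_comm] at h1
    have h2' : 1 - b * conj z ≠ 0 := by rwa [mul_comm] at h2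
    unfold mob
    field_simp
    ring
  have h5 : ‖(1 : ℂ) - conj z * z‖ = 1 - ‖z‖ ^ 2 := by
    rw [← normSq_eq_conj_mul_self, normSq_eq_norm_sq]
    norm_cast
    rw [Real.norm_of_nonneg]
    nlinarith [norm_nonneg z]
  have h6 : 0 < 1 - ‖z‖ ^ 2 := by nlinarith [norm_nonneg z]
  have hvb : 0 < ‖v - b‖ := by
    rw [norm_pos_iff, sub_ne_zero]; rintro rfl; exact hv.ne hb
  rw [Pk, Pk, Pk, one_sub_norm_mob_sq hz hv.le, h4, norm_div, norm_mul, norm_mul, h5,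
    norm_one_sub_conj_mul hb]
  have := norm_pos_iff.2 h1
  generalize ‖1 - conj z * v‖ = d at *
  field_simp

theorem continuousOn_mob {z : ℂ} (hz : ‖z‖ < 1) : ContinuousOn (mob z) (Metric.closedBall 0 1) := by
  unfold mob
  refine ContinuousOn.div (by fun_prop) (by fun_prop) fun v hv => ?_
  exact one_sub_conj_mul_ne_zero hz (by simpa using hv)

theorem continuousOn_Pk {z : ℂ} (hz : ‖z‖ < 1) : ContinuousOn (Pk z) (Metric.sphere 0 1) := by
  unfold Pk
  refine ContinuousOn.div (by fun_prop) (by fun_prop) fun b hb => ?_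
  have : 0 < Pk z b := Pk_pos hz (by simpa using hb)
  intro h
  rw [Pk, h] at this
  simp at this

theorem continuous_Pk_exp {z : ℂ} (hz : ‖z‖ < 1) :
    Continuous fun θ : ℝ => Pk z (Complex.exp (θ * I)) :=
  (continuousOn_Pk hz).comp_continuous (by fun_prop) fun θ => by simp

theorem integral_Pk_exp {z : ℂ} (hz : ‖z‖ < 1) :
    ∫ θ in (0 : ℝ)..(2 * π), Pk z (Complex.exp (θ * I)) = 2 * π := by
  have h := DiffContOnCl.circleAverage_poissonKernel_smul (f := fun _ => (1 : ℂ)) (R := 1) (w := z)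
    (c := 0) diffContOnCl_const (by simpa using hz)
  rw [circleAverage_def] at h
  have h2 : ∀ θ : ℝ, (poissonKernel 0 z • fun _ => (1 : ℂ)) (circleMap 0 1 θ) =
      ((Pk z (Complex.exp (θ * I)) : ℝ) : ℂ) := by
    intro θ
    simp [poissonKernel_def, circleMap, Pk, norm_sub_rev]
  simp only [h2] at h
  rw [intervalIntegral.integral_ofReal] at h
  rw [Complex.real_smul, ← Complex.ofReal_mul] at h
  have h3 := Complex.ofReal_eq_one.1 h
  have := Real.pi_pos
  field_simp at h3
  linarith

theorem hasDerivAt_mob_exp {z : ℂ} (hz : ‖z‖ < 1) (θ : ℝ) :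
    HasDerivAt (fun θ : ℝ => mob z (Complex.exp (θ * I)))
      (I * Pk z (Complex.exp (θ * I)) * mob z (Complex.exp (θ * I))) θ := by
  set e := Complex.exp (θ * I) with he
  have hn : ‖e‖ = 1 := Complex.norm_exp_ofReal_mul_I θ
  have h0 := one_sub_conj_mul_ne_zero hz hn.le
  have h1 : HasDerivAt (fun θ : ℝ => Complex.exp (θ * I)) (e * I) θ := by
    simpa using ((Complex.ofRealCLM.hasDerivAt (x := θ)).mul_const I).cexp
  have h2 := (h1.sub_const z).div ((h1.const_mul (conj z)).const_sub 1) h0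
  refine h2.congr_deriv ?_
  have hP : (Pk z e : ℂ) = (1 - conj z * z) * e / ((1 - conj z * e) * (e - z)) := by
    have hc : conj e * e = 1 := by rw [← normSq_eq_conj_mul_self, normSq_eq_norm_sq, hn]; simp
    have h3 : (‖z - e‖ ^ 2 : ℂ) * e = (1 - conj z * e) * (e - z) := by
      have : (‖z - e‖ ^ 2 : ℂ) = conj (z - e) * (z - e) := by
        rw [← normSq_eq_conj_mul_self, normSq_eq_norm_sq]; simp
      rw [this, map_sub]
      linear_combination (e - z) * hc
    have he0 : e ≠ 0 := Complex.exp_ne_zero _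
    rw [← h3, Pk]
    push_cast
    rw [mul_div_mul_right _ _ he0, ← normSq_eq_conj_mul_self, normSq_eq_norm_sq]
    simp
  have h4 : e - z ≠ 0 := by
    rw [sub_ne_zero]; rintro rfl; exact hz.ne hn
  rw [hP, ← he, mob]
  field_simp
  ring

/-- Möbius change of variables on the circle. -/
theorem integral_comp_mob {h : ℂ → ℂ} (hh : ContinuousOn h (Metric.sphere 0 1)) {z : ℂ}
    (hz : ‖z‖ < 1) :
    ∫ b, (Pk z b : ℂ) * h (mob z b) ∂circleMeasure = ∫ b, h b ∂circleMeasure := by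
  have hmaps : Set.MapsTo (mob z) (Metric.sphere 0 1) (Metric.sphere 0 1) := fun b hb => by
    simpa using norm_mob_eq_one hz (by simpa using hb)
  have hc : ContinuousOn (fun b => (Pk z b : ℂ) * h (mob z b)) (Metric.sphere 0 1) :=
    (Complex.continuous_ofReal.comp_continuousOn (continuousOn_Pk hz)).mul
      (hh.comp ((continuousOn_mob hz).mono Metric.sphere_subset_closedBall) hmaps)
  rw [integral_circleMeasure hh.aestronglyMeasurable_circleMeasure,
    integral_circleMeasure hc.aestronglyMeasurable_circleMeasure]
  congr 1
  have hPc := continuous_Pk_exp hz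
  set β : ℝ → ℝ := fun θ => arg (mob z 1) + ∫ τ in (0 : ℝ)..θ, Pk z (Complex.exp (τ * I)) with hβ
  have hβd : ∀ θ : ℝ, HasDerivAt β (Pk z (Complex.exp (θ * I))) θ := fun θ =>
    (intervalIntegral.integral_hasDerivAt_right (hPc.intervalIntegrable _ _)
      (hPc.stronglyMeasurableAtFilter _ _) hPc.continuousAt).const_add _
  have hD : ∀ θ : ℝ, HasDerivAt (fun θ : ℝ => Complex.exp (-(β θ * I)) * mob z (Complex.exp (θ * I)))
      0 θ := by
    intro θ
    have := (((hβd θ).ofReal_comp).mul_const I).neg.cexp.mul (hasDerivAt_mob_exp hz θ)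
    refine this.congr_deriv ?_
    ring
  have hconst : ∀ θ : ℝ, Complex.exp (β θ * I) = mob z (Complex.exp (θ * I)) := by
    intro θ
    have := is_const_of_deriv_eq_zero (fun x => (hD x).differentiableAt) (fun x => (hD x).deriv) θ 0
    have hone : Complex.exp (β 0 * I) = mob z 1 := by
      have := norm_mul_exp_arg_mul_I (mob z 1)
      rw [norm_mob_eq_one hz (by simp)] at this
      simpa [hβ] using this
    simp only [Complex.exp_neg, hone] at this
    have h1 : mob z 1 ≠ 0 := by
      rw [← norm_pos_iff, norm_mob_eq_one hz (by simp)]; exact one_pos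
    have h2 : mob z 1 * Complex.exp (β θ * I) = mob z 1 * mob z (Complex.exp (θ * I)) := by
      have h3 : Complex.exp (β θ * I) ≠ 0 := Complex.exp_ne_zero _
      simp [h1] at this
      rw [inv_mul_eq_iff_eq_mul₀ h3] at this
      rw [this, mul_one]
    exact mul_left_cancel₀ h1 h2
  have hper : Function.Periodic (fun θ : ℝ => h (Complex.exp (θ * I))) (2 * π) := by
    intro θ
    simp [add_mul, Complex.exp_add]
  have hβ2 : β (2 * π) = β 0 + 2 * π := by
    simp [hβ, integral_Pk_exp hz]
  have hhc : Continuous fun θ : ℝ => h (Complex.exp (θ * I)) :=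
    hh.comp_continuous (by fun_prop) fun θ => by simp
  have := intervalIntegral.integral_deriv_smul_comp (a := 0) (b := 2 * π) (f := β)
    (f' := fun θ => Pk z (Complex.exp (θ * I))) (g := fun θ : ℝ => h (Complex.exp (θ * I)))
    (fun x _ => hβd x) hPc.continuousOn hhc
  rw [hβ2, hper.intervalIntegral_add_eq (β 0) 0, zero_add] at this
  rw [← this]
  refine intervalIntegral.integral_congr fun θ _ => ?_
  simp [hconst]

theorem integral_circleMeasure_rotate {h : ℂ → ℂ} (hh : ContinuousOn h (Metric.sphere 0 1)) {c : ℂ}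
    (hc : ‖c‖ = 1) :
    ∫ b, h (c * b) ∂circleMeasure = ∫ b, h b ∂circleMeasure := by
  have hmaps : Set.MapsTo (fun b => c * b) (Metric.sphere 0 1) (Metric.sphere 0 1) := fun b hb => by
    simpa [hc] using hb
  have hcc : ContinuousOn (fun b => h (c * b)) (Metric.sphere 0 1) :=
    hh.comp (by fun_prop) hmaps
  rw [integral_circleMeasure hh.aestronglyMeasurable_circleMeasure,
    integral_circleMeasure hcc.aestronglyMeasurable_circleMeasure]
  congr 1
  have hper : Function.Periodic (fun θ : ℝ => h (Complex.exp (θ * I))) (2 * π) := by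
    intro θ
    simp [add_mul, Complex.exp_add]
  have h1 : ∀ θ : ℝ, h (c * Complex.exp (θ * I)) = (fun θ : ℝ => h (Complex.exp (θ * I))) (arg c + θ) := by
    intro θ
    have := norm_mul_exp_arg_mul_I c
    rw [hc] at this
    conv_lhs => rw [← this]
    simp [add_mul, Complex.exp_add]
  rw [intervalIntegral.integral_congr fun θ _ => h1 θ,
    intervalIntegral.integral_comp_add_left (fun θ : ℝ => h (Complex.exp (θ * I))), add_zero, hper.intervalIntegral_add_eq (arg c) 0,
    zero_add]

theorem measurePreserving_toCircle :
    have : Fact (0 < 2 * π) := ⟨by positivity⟩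
    MeasurePreserving (fun x : AddCircle (2 * π) => (AddCircle.toCircle x : ℂ))
      AddCircle.haarAddCircle circleMeasure := by
  have : Fact (0 < 2 * π) := ⟨by positivity⟩
  have hm : Measurable (fun x : AddCircle (2 * π) => (AddCircle.toCircle x : ℂ)) :=
    (continuous_subtype_val.comp AddCircle.continuous_toCircle).measurable
  refine ⟨hm, ?_⟩
  have h1 := AddCircle.measurePreserving_mk (2 * π) 0
  have h2 : (AddCircle.haarAddCircle : Measure (AddCircle (2 * π))) =
      (ENNReal.ofReal (2 * π))⁻¹ • volume := by
    rw [AddCircle.volume_eq_smul_haarAddCircle, smul_smul, ENNReal.inv_mul_cancel, one_smul]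
    · simp [Real.pi_pos]
    · exact ENNReal.ofReal_ne_top
  rw [h2, Measure.map_smul, ← h1.map_eq, Measure.map_map hm h1.measurable, circleMeasure, zero_add]
  congr 2
  ext θ
  simp [AddCircle.toCircle_apply_mk, Circle.coe_exp]

/-- An `L²` function on the circle with vanishing Fourier coefficients is zero. -/
theorem ae_eq_zero_of_forall_integral_zpow_mul {h : ℂ → ℂ} (hh : MemLp h 2 circleMeasure)
    (h0 : ∀ n : ℤ, ∫ b, b ^ n * h b ∂circleMeasure = 0) : h =ᵐ[circleMeasure] 0 := by
  have : Fact (0 < 2 * π) := ⟨by positivity⟩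
  have hmp := measurePreserving_toCircle
  have hemb : MeasurableEmbedding (fun x : AddCircle (2 * π) => (AddCircle.toCircle x : ℂ)) := by
    refine Topology.IsClosedEmbedding.measurableEmbedding ?_
    refine Continuous.isClosedEmbedding (continuous_subtype_val.comp AddCircle.continuous_toCircle) ?_
    exact Subtype.val_injective.comp (AddCircle.injective_toCircle (by positivity))
  have hL := hh.comp_measurePreserving hmp
  have hz : hL.toLp = 0 := by
    apply fourierBasis.repr.injective
    rw [map_zero]
    ext n
    rw [fourierBasis_repr, fourierCoeff,
      integral_congr_ae (hL.coeFn_toLp.mono fun x hx => by simp only [hx]; rfl)]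
    have := h0 (-n)
    rw [← hmp.map_eq, hemb.integral_map] at this
    simp only [fourier_apply, smul_eq_mul, Function.comp]
    simp only [lp.coeFn_zero, Pi.zero_apply]
    rw [← this]
    congr 1
    ext x
    rw [AddCircle.toCircle_zsmul, Circle.coe_zpow]
  have h3 := (MemLp.coeFn_toLp hL).symm
  rw [hz] at h3
  have h4 := h3.trans (Lp.coeFn_zero _ _ _)
  rw [← hmp.map_eq]
  exact hemb.ae_map_iff.2 h4

theorem measurable_mob (z : ℂ) : Measurable (mob z) := by
  unfold mob; fun_prop

theorem lintegral_hypVol {h : ℂ → ENNReal} (hh : Measurable h) :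
    ∫⁻ w, h w ∂hypVol = ∫⁻ w in Metric.ball 0 1, ENNReal.ofReal (4 / (1 - ‖w‖ ^ 2) ^ 2) * h w := by
  rw [hypVol, lintegral_withDensity_eq_lintegral_mul _ (by fun_prop) hh]
  rfl

theorem ae_hypVol_norm_lt_one : ∀ᵐ z ∂hypVol, ‖z‖ < 1 := by
  refine (withDensity_absolutelyContinuous _ _).ae_le ?_
  filter_upwards [ae_restrict_mem Metric.isOpen_ball.measurableSet] with z hz
  simpa using hz

theorem measurePreserving_mob {z : ℂ} (hz : ‖z‖ < 1) : MeasurePreserving (mob z) hypVol hypVol := by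
  refine ⟨measurable_mob z, Measure.ext_of_lintegral _ fun h hh => ?_⟩
  rw [lintegral_map hh (measurable_mob z), lintegral_hypVol hh,
    lintegral_hypVol (h := fun w => h (mob z w)) (hh.comp (measurable_mob z))]
  have hz' : ‖-z‖ < 1 := by simpa using hz
  have himg : mob z '' Metric.ball 0 1 = Metric.ball 0 1 := by
    ext v
    simp only [Set.mem_image, Metric.mem_ball, dist_zero_right]
    constructor
    · rintro ⟨u, hu, rfl⟩
      exact norm_mob_lt_one hz hu
    · intro hv
      refine ⟨mob (-z) v, norm_mob_lt_one hz' hv, ?_⟩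
      simpa using mob_neg_mob hz' hv
  have hinj : Set.InjOn (mob z) (Metric.ball 0 1) := by
    intro u hu v hv huv
    rw [← mob_neg_mob hz (v := u) (by simpa using hu), huv, mob_neg_mob hz (by simpa using hv)]
  have hd : ∀ v ∈ Metric.ball (0 : ℂ) 1, HasDerivAt (mob z)
      ((1 - conj z * z) / (1 - conj z * v) ^ 2) v := by
    intro v hv
    have h0 := one_sub_conj_mul_ne_zero hz (v := v) (by simpa using (mem_ball_zero_iff.1 hv).le)
    have := ((hasDerivAt_id v).sub_const z).div (((hasDerivAt_id v).const_mul (conj z)).const_sub 1) h0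
    refine this.congr_deriv ?_
    simp only [id]
    ring
  have := lintegral_image_eq_lintegral_abs_det_fderiv_mul volume Metric.isOpen_ball.measurableSet
    (fun v hv => (hd v hv).complexToReal_fderiv.hasFDerivWithinAt) hinj
    (fun w => ENNReal.ofReal (4 / (1 - ‖w‖ ^ 2) ^ 2) * h w)
  rw [himg] at this
  rw [this]
  refine setLIntegral_congr_fun Metric.isOpen_ball.measurableSet fun v hv => ?_
  have hv : ‖v‖ < 1 := by simpa using hv
  rw [← mul_assoc, ← ENNReal.ofReal_mul (abs_nonneg _)]
  congr 2
  have hdet : ∀ c : ℂ, (c • (1 : ℂ →L[ℝ] ℂ)).det = ‖c‖ ^ 2 := by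
    intro c
    have : (c • (1 : ℂ →L[ℝ] ℂ)).det =
        LinearMap.det ((c • (LinearMap.id : ℂ →ₗ[ℂ] ℂ)).restrictScalars ℝ) := rfl
    rw [this, LinearMap.det_restrictScalars, LinearMap.det_smul]
    simp [Algebra.norm_complex_apply, Complex.normSq_eq_norm_sq]
  have h0 := norm_pos_iff.2 (one_sub_conj_mul_ne_zero hz hv.le)
  have h1 : 0 < 1 - ‖z‖ ^ 2 := by nlinarith [norm_nonneg z]
  have h2 : 0 < 1 - ‖v‖ ^ 2 := by nlinarith [norm_nonneg v]
  have h5 : ‖(1 : ℂ) - conj z * z‖ = 1 - ‖z‖ ^ 2 := by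
    rw [← normSq_eq_conj_mul_self, normSq_eq_norm_sq]
    norm_cast
    rw [Real.norm_of_nonneg h1.le]
  rw [hdet, abs_of_nonneg (by positivity), one_sub_norm_mob_sq hz hv.le, norm_div, norm_pow, h5]
  generalize ‖1 - conj z * v‖ = d at *
  field_simp

theorem lintegral_circleMeasure {h : ℂ → ENNReal} (hh : Measurable h) :
    ∫⁻ b, h b ∂circleMeasure =
      (ENNReal.ofReal (2 * π))⁻¹ * ∫⁻ θ in Set.Ioo (-π) π, h (Complex.exp (θ * I)) := by
  have : Fact (0 < 2 * π) := ⟨by positivity⟩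
  have hm : Measurable (fun x : AddCircle (2 * π) => (AddCircle.toCircle x : ℂ)) :=
    (continuous_subtype_val.comp AddCircle.continuous_toCircle).measurable
  rw [← measurePreserving_toCircle.map_eq, lintegral_map hh hm]
  have h2 : (AddCircle.haarAddCircle : Measure (AddCircle (2 * π))) =
      (ENNReal.ofReal (2 * π))⁻¹ • volume := by
    rw [AddCircle.volume_eq_smul_haarAddCircle, smul_smul, ENNReal.inv_mul_cancel, one_smul]
    · simp [Real.pi_pos]
    · exact ENNReal.ofReal_ne_top
  rw [h2, lintegral_smul_measure, ← (AddCircle.measurePreserving_mk (2 * π) (-π)).map_eq,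
    smul_eq_mul]
  congr 1
  refine (lintegral_map (hh.comp hm) (AddCircle.measurePreserving_mk (2 * π) (-π)).measurable).trans ?_
  rw [show -π + 2 * π = π by ring, restrict_Ioo_eq_restrict_Ioc]
  refine lintegral_congr fun θ => ?_
  simp [AddCircle.toCircle_apply_mk, Circle.coe_exp]

/-- The hyperbolic area in the geodesic radius. -/
def radialVol : Measure ℝ :=
  (volume.restrict (Set.Ioi 0)).withDensity fun t => ENNReal.ofReal (2 * π * Real.sinh t)

instance : SFinite radialVol := by unfold radialVol; infer_instance

theorem hasDerivAt_tanh_half (t : ℝ) :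
    HasDerivAt (fun t => Real.tanh (t / 2)) ((1 - Real.tanh (t / 2) ^ 2) / 2) t := by
  have hc := (Real.cosh_pos (t / 2)).ne'
  have hx := (hasDerivAt_id t).div_const 2
  have := hx.sinh.div hx.cosh hc
  have h2 : (fun t => Real.tanh (t / 2)) = (fun t : ℝ => Real.sinh (t / 2) / Real.cosh (t / 2)) := by
    ext t; rw [Real.tanh_eq_sinh_div_cosh]
  rw [h2]
  refine this.congr_deriv ?_
  rw [Real.tanh_eq_sinh_div_cosh]
  simp only [id]
  field_simp

theorem tanh_half_image : (fun t => Real.tanh (t / 2)) '' Set.Ioi 0 = Set.Ioo 0 1 := by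
  ext x
  simp only [Set.mem_image, Set.mem_Ioi, Set.mem_Ioo]
  constructor
  · rintro ⟨t, ht, rfl⟩
    refine ⟨?_, Real.tanh_lt_one _⟩
    rw [Real.tanh_eq_sinh_div_cosh]
    exact div_pos (Real.sinh_pos_iff.2 (by linarith)) (Real.cosh_pos _)
  · rintro ⟨h0, h1⟩
    refine ⟨2 * Real.artanh x, ?_, ?_⟩
    · have := Real.tanh_artanh (x := x) ⟨by linarith, h1⟩
      by_contra! hneg
      have h3 : Real.sinh (Real.artanh x) ≤ 0 := Real.sinh_nonpos_iff.2 (by linarith)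
      rw [Real.tanh_eq_sinh_div_cosh] at this
      have := div_nonpos_of_nonpos_of_nonneg h3 (Real.cosh_pos (Real.artanh x)).le
      linarith
    · rw [mul_div_cancel_left₀ _ (by norm_num)]
      exact Real.tanh_artanh ⟨by linarith, h1⟩

theorem measurable_tanh : Measurable Real.tanh := by
  have : Real.tanh = fun t => Real.sinh t / Real.cosh t := by ext t; rw [Real.tanh_eq_sinh_div_cosh]
  rw [this]; fun_prop

/-- Geodesic polar coordinates on the disc. -/
theorem measurePreserving_polar : MeasurePreserving
    (fun p : ℝ × ℂ => (Real.tanh (p.1 / 2) : ℂ) * p.2) (radialVol.prod circleMeasure) hypVol := by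
  have hm : Measurable (fun p : ℝ × ℂ => (Real.tanh (p.1 / 2) : ℂ) * p.2) :=
    (Complex.measurable_ofReal.comp (measurable_tanh.comp (by fun_prop))).mul measurable_snd
  refine ⟨hm, Measure.ext_of_lintegral _ fun h hh => ?_⟩
  rw [lintegral_map hh hm, lintegral_prod (fun p : ℝ × ℂ => h ((Real.tanh (p.1 / 2) : ℂ) * p.2))
    (hh.comp hm).aemeasurable]
  set G : ℝ → ENNReal := fun ρ => ∫⁻ θ in Set.Ioo (-π) π, h (ρ * Complex.exp (θ * I)) with hG
  have hGm : Measurable G := by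
    refine Measurable.lintegral_prod_right' (ν := volume.restrict (Set.Ioo (-π) π)) (f := fun p : ℝ × ℝ => h (↑(p.1) * Complex.exp (↑(p.2) * I))) ?_
    exact hh.comp (by fun_prop)
  have h1 : ∀ t : ℝ, ∫⁻ b, h ((Real.tanh (t / 2) : ℂ) * b) ∂circleMeasure =
      (ENNReal.ofReal (2 * π))⁻¹ * G (Real.tanh (t / 2)) := fun t =>
    lintegral_circleMeasure (h := fun b => h ((Real.tanh (t / 2) : ℂ) * b))
      (hh.comp (measurable_const.mul measurable_id))
  simp_rw [h1]
  have hth : Measurable fun t : ℝ => Real.tanh (t / 2) := measurable_tanh.comp (by fun_prop)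
  rw [radialVol, lintegral_withDensity_eq_lintegral_mul (g := fun t =>
      (ENNReal.ofReal (2 * π))⁻¹ * G (Real.tanh (t / 2))) _ (by fun_prop)
    (measurable_const.mul (hGm.comp hth)), lintegral_hypVol hh]
  rw [← lintegral_indicator Metric.isOpen_ball.measurableSet,
    ← Complex.lintegral_comp_polarCoord_symm, polarCoord_target, Measure.volume_eq_prod,
    ← Measure.prod_restrict]
  have hmi : Measurable ((Metric.ball (0 : ℂ) 1).indicator
      (fun w => ENNReal.ofReal (4 / (1 - ‖w‖ ^ 2) ^ 2) * h w)) :=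
    Measurable.indicator (by fun_prop) Metric.isOpen_ball.measurableSet
  have hpm : Measurable fun p : ℝ × ℝ => Complex.polarCoord.symm p := by
    simp only [Complex.polarCoord_symm_apply]
    fun_prop
  rw [lintegral_prod]
  swap
  · refine Measurable.aemeasurable ?_
    exact Measurable.smul (f := fun p : ℝ × ℝ => ENNReal.ofReal p.1) (by fun_prop) (hmi.comp hpm)
  have hgm : ∀ ρ : ℝ, Measurable fun θ : ℝ => h (ρ * Complex.exp (θ * I)) := fun ρ =>
    hh.comp (by fun_prop)
  have h2 : ∀ ρ ∈ Set.Ioi (0 : ℝ), ∫⁻ θ in Set.Ioo (-π) π, ENNReal.ofReal ρ •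
      (Metric.ball (0 : ℂ) 1).indicator (fun w => ENNReal.ofReal (4 / (1 - ‖w‖ ^ 2) ^ 2) * h w)
        (Complex.polarCoord.symm (ρ, θ)) =
      (Set.Ioo (0 : ℝ) 1).indicator
        (fun ρ => ENNReal.ofReal (ρ * (4 / (1 - ρ ^ 2) ^ 2)) * G ρ) ρ := by
    intro ρ hρ
    have hρ : 0 < ρ := hρ
    have hn : ∀ θ : ℝ, ‖Complex.polarCoord.symm (ρ, θ)‖ = ρ := fun θ => by
      rw [Complex.norm_polarCoord_symm, abs_of_pos hρ]
    have he : ∀ θ : ℝ, Complex.polarCoord.symm (ρ, θ) = ρ * Complex.exp (θ * I) := fun θ => by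
      rw [Complex.polarCoord_symm_apply, Complex.exp_mul_I]; simp
    by_cases hρ1 : ρ < 1
    · have hi : ρ ∈ Set.Ioo (0 : ℝ) 1 := ⟨hρ, hρ1⟩
      rw [Set.indicator_of_mem hi, ENNReal.ofReal_mul hρ.le, hG, mul_assoc]
      dsimp only
      rw [← lintegral_const_mul _ (hgm ρ), ← lintegral_const_mul]
      · refine lintegral_congr fun θ => ?_
        rw [Set.indicator_of_mem (by simpa [hn, -Complex.polarCoord_symm_apply] using hρ1), hn, he,
          smul_eq_mul]
      · exact Measurable.mul measurable_const (hgm ρ)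
    · rw [Set.indicator_of_notMem (fun h => hρ1 h.2)]
      refine (lintegral_congr fun θ => ?_).trans lintegral_zero
      rw [Set.indicator_of_notMem]
      · simp
      · simpa [hn, -Complex.polarCoord_symm_apply] using hρ1
  rw [setLIntegral_congr_fun measurableSet_Ioi h2, setLIntegral_indicator measurableSet_Ioo]
  have h3 : Set.Ioo (0 : ℝ) 1 ∩ Set.Ioi 0 = Set.Ioo 0 1 := by
    ext; simp; tauto
  rw [h3, ← tanh_half_image, lintegral_image_eq_lintegral_abs_deriv_mul measurableSet_Ioi
    (fun t _ => (hasDerivAt_tanh_half t).hasDerivWithinAt)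
    (fun s _ t _ hst => by linarith [Real.tanh_injective hst])]
  refine setLIntegral_congr_fun measurableSet_Ioi fun t ht => ?_
  have ht : 0 < t := ht
  have hpi := Real.pi_pos
  simp only [Pi.mul_apply]
  rw [← mul_assoc, ← mul_assoc, ← ENNReal.ofReal_mul (abs_nonneg _),
    ← ENNReal.ofReal_inv_of_pos (by positivity), ← ENNReal.ofReal_mul
      (mul_nonneg (by positivity) (Real.sinh_nonneg_iff.2 ht.le))]
  congr 2
  have hc := Real.cosh_pos (t / 2)
  have h4 : 1 - Real.tanh (t / 2) ^ 2 = 1 / Real.cosh (t / 2) ^ 2 := by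
    rw [Real.tanh_eq_sinh_div_cosh]
    field_simp
    rw [Real.cosh_sq]; ring
  rw [h4, abs_of_nonneg (by positivity), Real.tanh_eq_sinh_div_cosh]
  have h5 : Real.sinh t = 2 * Real.sinh (t / 2) * Real.cosh (t / 2) := by
    rw [← Real.sinh_two_mul]; congr 1; ring
  rw [h5]
  field_simp
  norm_num

/-- The plane wave `P(z,b)^{1/2+ir}`. -/
def pwave (r : ℝ) (z b : ℂ) : ℂ := (Pk z b : ℂ) ^ ((1 : ℂ) / 2 + I * r)

/-- The spherical function of spectral parameter `r`. -/
def sph (r : ℝ) (v : ℂ) : ℂ := ∫ b, pwave r v b ∂circleMeasure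

theorem pwave_neg (r : ℝ) (z b : ℂ) : pwave (-r) z b = (Pk z b : ℂ) ^ ((1 : ℂ) / 2 - I * r) := by
  rw [pwave]; push_cast; rw [mul_neg, sub_eq_add_neg]

theorem norm_pwave (r : ℝ) {z b : ℂ} (hz : ‖z‖ < 1) (hb : ‖b‖ = 1) :
    ‖pwave r z b‖ = √(Pk z b) := by
  rw [pwave, Complex.norm_cpow_eq_rpow_re_of_pos (Pk_pos hz hb), Real.sqrt_eq_rpow]
  simp

theorem conj_pwave (r : ℝ) {z b : ℂ} (hz : ‖z‖ < 1) (hb : ‖b‖ = 1) :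
    conj (pwave r z b) = pwave (-r) z b := by
  rw [pwave_neg, pwave]
  have h := Complex.conj_cpow (Pk z b : ℂ) ((1 : ℂ) / 2 - I * r) ?_
  · rw [Complex.conj_ofReal] at h
    rw [h]
    simp [map_ofNat]
  · rw [Complex.arg_ofReal_of_nonneg (Pk_pos hz hb).le]; exact Real.pi_pos.ne

theorem continuousOn_pwave_rzb : ContinuousOn (fun p : ℝ × ℂ × ℂ => pwave p.1 p.2.1 p.2.2)
    (Set.univ ×ˢ Metric.ball 0 1 ×ˢ Metric.sphere 0 1) := by
  unfold pwave
  refine ContinuousOn.cpow (Complex.continuous_ofReal.comp_continuousOn ?_) (by fun_prop) ?_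
  · unfold Pk
    refine ContinuousOn.div (by fun_prop) (by fun_prop) ?_
    rintro ⟨r, z, b⟩ ⟨-, hz, hb⟩
    simp only [mem_ball_zero_iff, mem_sphere_zero_iff_norm] at hz hb
    have : z - b ≠ 0 := fun h => by rw [sub_eq_zero.1 h] at hz; linarith
    positivity
  · rintro ⟨r, z, b⟩ ⟨-, hz, hb⟩
    simp only [mem_ball_zero_iff, mem_sphere_zero_iff_norm] at hz hb
    exact Complex.ofReal_mem_slitPlane.2 (Pk_pos hz hb)

theorem continuousOn_pwave (r : ℝ) {z : ℂ} (hz : ‖z‖ < 1) :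
    ContinuousOn (pwave r z) (Metric.sphere 0 1) := by
  refine continuousOn_pwave_rzb.comp (f := fun b => (r, z, b)) (by fun_prop) fun b hb => ?_
  exact ⟨trivial, by simpa using hz, hb⟩

theorem pwave_mul_pwave (r : ℝ) {z w b : ℂ} (hz : ‖z‖ < 1) (hw : ‖w‖ < 1) (hb : ‖b‖ = 1) :
    pwave r z b * pwave (-r) w b = Pk w b * pwave r (mob w z) (mob w b) := by
  have h1 := Pk_pos hw hb
  have h2 := Pk_pos (norm_mob_lt_one hw hz) (norm_mob_eq_one hw hb)
  rw [pwave_neg, pwave, pwave, Pk_eq_mul_Pk_mob hw hz hb, Complex.ofReal_mul,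
    Complex.mul_cpow_ofReal_nonneg h1.le h2.le, mul_right_comm,
    ← Complex.cpow_add _ _ (by exact_mod_cast h1.ne')]
  ring_nf
  simp [mul_comm]

theorem pwave_eq_mul (r : ℝ) {z w b : ℂ} (hz : ‖z‖ < 1) (hw : ‖w‖ < 1) (hb : ‖b‖ = 1) :
    pwave r w b = pwave r z b * pwave r (mob z w) (mob z b) := by
  have h1 := Pk_pos hz hb
  have h2 := Pk_pos (norm_mob_lt_one hz hw) (norm_mob_eq_one hz hb)
  rw [pwave, pwave, pwave, Pk_eq_mul_Pk_mob hz hw hb, Complex.ofReal_mul,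
    Complex.mul_cpow_ofReal_nonneg h1.le h2.le]

theorem pwave_mul_right (r : ℝ) {z b c : ℂ} (hc : ‖c‖ = 1) :
    pwave r (c * z) (c * b) = pwave r z b := by
  simp only [pwave, Pk, ← mul_sub, norm_mul, hc, one_mul]

theorem pwave_conj (r : ℝ) {z b : ℂ} :
    pwave r (conj z) (conj b) = pwave r z b := by
  simp only [pwave, Pk, ← map_sub, Complex.norm_conj]

theorem integral_pwave_mul_pwave (r : ℝ) {z w : ℂ} (hz : ‖z‖ < 1) (hw : ‖w‖ < 1) :
    ∫ b, pwave r z b * pwave (-r) w b ∂circleMeasure = sph r (mob w z) := by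
  rw [sph, ← integral_comp_mob (continuousOn_pwave r (norm_mob_lt_one hw hz)) hw]
  refine integral_congr_ae ?_
  filter_upwards [ae_norm_eq_one] with b hb
  exact pwave_mul_pwave r hz hw hb

theorem sph_mul (r : ℝ) {v c : ℂ} (hv : ‖v‖ < 1) (hc : ‖c‖ = 1) : sph r (c * v) = sph r v := by
  have h : ‖c * v‖ < 1 := by rw [norm_mul, hc, one_mul]; exact hv
  rw [sph, ← integral_circleMeasure_rotate (continuousOn_pwave r h) hc]
  simp_rw [pwave_mul_right r hc]
  rfl

theorem sph_norm (r : ℝ) {v : ℂ} (hv : ‖v‖ < 1) : sph r ‖v‖ = sph r v := by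
  have h : v = Complex.exp (v.arg * I) * (‖v‖ : ℂ) := by
    rw [mul_comm, Complex.norm_mul_exp_arg_mul_I]
  conv_rhs => rw [h]
  rw [sph_mul r (by simpa using hv) (Complex.norm_exp_ofReal_mul_I _)]

theorem sph_neg (r : ℝ) {v : ℂ} (hv : ‖v‖ < 1) : sph (-r) v = sph r v := by
  have h0 : ‖(0 : ℂ)‖ < 1 := by simp
  have h1 : mob 0 v = v := by simp [mob]
  have h2 : mob v 0 = -v := by simp [mob]
  rw [← h1, ← integral_pwave_mul_pwave (-r) hv h0, neg_neg]
  simp_rw [mul_comm (pwave (-r) v _)]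
  rw [integral_pwave_mul_pwave r h0 hv, h2, h1, ← neg_one_mul, sph_mul r hv (by simp)]

theorem conj_sph (r : ℝ) {v : ℂ} (hv : ‖v‖ < 1) : conj (sph r v) = sph r v := by
  have h : conj (sph r v) = sph (-r) v := by
    rw [sph, ← integral_conj]
    refine integral_congr_ae ?_
    filter_upwards [ae_norm_eq_one] with b hb
    exact conj_pwave _ hv hb
  rw [h, sph_neg r hv]

theorem norm_tanh_half_lt_one (t : ℝ) : ‖(Real.tanh (t / 2) : ℂ)‖ < 1 := by
  rw [Complex.norm_real, Real.norm_eq_abs, abs_lt]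
  exact ⟨Real.neg_one_lt_tanh _, Real.tanh_lt_one _⟩

theorem cosh_sub_sinh_mul_cos_pos (t θ : ℝ) : 0 < Real.cosh t - Real.sinh t * Real.cos θ := by
  have h1 := Real.neg_one_le_cos θ
  have h2 := Real.cos_le_one θ
  have h3 := Real.cosh_sq t
  have h4 := Real.cosh_pos t
  have : |Real.sinh t * Real.cos θ| < Real.cosh t := by
    apply abs_lt_of_sq_lt_sq _ h4.le
    nlinarith [sq_nonneg (Real.sinh t), Real.cos_sq_le_one θ, sq_nonneg (Real.cos θ)]
  linarith [le_abs_self (Real.sinh t * Real.cos θ)]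

theorem Pk_tanh_exp (t θ : ℝ) :
    Pk (Real.tanh (t / 2)) (Complex.exp (θ * I)) = (Real.cosh t - Real.sinh t * Real.cos θ)⁻¹ := by
  have hc := Real.cosh_pos (t / 2)
  have h1 : ‖(Real.tanh (t / 2) : ℂ) - Complex.exp (θ * I)‖ ^ 2 =
      1 - 2 * Real.tanh (t / 2) * Real.cos θ + Real.tanh (t / 2) ^ 2 := by
    rw [← Complex.normSq_eq_norm_sq, Complex.normSq_apply, Complex.exp_mul_I]
    simp only [Complex.sub_re, Complex.sub_im, Complex.add_re, Complex.add_im, Complex.ofReal_re,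
      Complex.ofReal_im, ← Complex.ofReal_cos, ← Complex.ofReal_sin, Complex.mul_re, Complex.mul_im,
      Complex.I_re, Complex.I_im]
    nlinarith [Real.sin_sq_add_cos_sq θ]
  have h2 : Real.cosh t = Real.cosh (t / 2) ^ 2 + Real.sinh (t / 2) ^ 2 := by
    rw [← Real.cosh_two_mul]; congr 1; ring
  have h3 : Real.sinh t = 2 * Real.sinh (t / 2) * Real.cosh (t / 2) := by
    rw [← Real.sinh_two_mul]; congr 1; ring
  have h4 : Real.cosh (t / 2) ^ 2 - Real.sinh (t / 2) ^ 2 = 1 := Real.cosh_sq_sub_sinh_sq _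
  have h5 := cosh_sub_sinh_mul_cos_pos t θ
  have h6 : 1 - 2 * Real.tanh (t / 2) * Real.cos θ + Real.tanh (t / 2) ^ 2 =
      (Real.cosh t - Real.sinh t * Real.cos θ) / Real.cosh (t / 2) ^ 2 := by
    rw [h2, h3, Real.tanh_eq_sinh_div_cosh]; field_simp; ring
  have h7 : 1 - Real.tanh (t / 2) ^ 2 = 1 / Real.cosh (t / 2) ^ 2 := by
    rw [Real.tanh_eq_sinh_div_cosh]; field_simp; linarith
  rw [Pk, h1, h6, Complex.norm_real, Real.norm_eq_abs, sq_abs, h7]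
  field_simp

/-- The singular kernel of the Abel transform. -/
def abelKer (t u : ℝ) : ℝ := (√|Real.cosh t - Real.cosh u|)⁻¹

theorem measurable_abelKer : Measurable fun p : ℝ × ℝ => abelKer p.1 p.2 := by
  unfold abelKer; fun_prop

theorem abelKer_nonneg (t u : ℝ) : 0 ≤ abelKer t u := by unfold abelKer; positivity

theorem abelKer_comm (t u : ℝ) : abelKer t u = abelKer u t := by
  rw [abelKer, abelKer, abs_sub_comm]

theorem abelKer_abs_right (t u : ℝ) : abelKer t |u| = abelKer t u := by
  rw [abelKer, abelKer, Real.cosh_abs]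

theorem pwave_tanh_exp (r t θ : ℝ) : pwave r (Real.tanh (t / 2)) (Complex.exp (θ * I)) =
    Complex.exp (-(Real.log (Real.cosh t - Real.sinh t * Real.cos θ) : ℂ) * (1 / 2 + I * r)) := by
  have h5 := cosh_sub_sinh_mul_cos_pos t θ
  rw [pwave, Pk_tanh_exp, Complex.cpow_def_of_ne_zero (by exact_mod_cast (inv_pos.2 h5).ne'),
    ← Complex.ofReal_log (inv_pos.2 h5).le, Real.log_inv]
  push_cast
  rfl

theorem sph_tanh_eq_integral (r t : ℝ) : sph r (Real.tanh (t / 2)) =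
    (π⁻¹ : ℝ) • ∫ θ in Set.Ioo 0 π, pwave r (Real.tanh (t / 2)) (Complex.exp (θ * I)) := by
  have hρ := norm_tanh_half_lt_one t
  have hcont : Continuous fun θ : ℝ => pwave r (Real.tanh (t / 2)) (Complex.exp (θ * I)) :=
    (continuousOn_pwave r hρ).comp_continuous (by fun_prop) fun θ => by simp
  rw [sph, integral_circleMeasure (continuousOn_pwave r hρ).aestronglyMeasurable_circleMeasure]
  have h1 : ∫ θ in π..(2 * π), pwave r (Real.tanh (t / 2)) (Complex.exp (θ * I)) =
      ∫ θ in (0 : ℝ)..π, pwave r (Real.tanh (t / 2)) (Complex.exp (θ * I)) := by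
    have := intervalIntegral.integral_comp_sub_left (a := 0) (b := π)
      (fun θ : ℝ => pwave r (Real.tanh (t / 2)) (Complex.exp (θ * I))) (2 * π)
    rw [sub_zero, show 2 * π - π = π by ring] at this
    rw [← this]
    refine intervalIntegral.integral_congr fun θ _ => ?_
    simp only [pwave_tanh_exp, Real.cos_two_pi_sub]
  rw [← intervalIntegral.integral_add_adjacent_intervals (hcont.intervalIntegrable 0 π)
    (hcont.intervalIntegrable π (2 * π)), h1, ← two_smul ℝ (∫ θ in (0 : ℝ)..π, _), smul_smul,
    intervalIntegral.integral_of_le Real.pi_pos.le, integral_Ioc_eq_integral_Ioo]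
  congr 1
  have := Real.pi_pos
  field_simp

theorem log_image {t : ℝ} (ht : 0 < t) :
    (fun θ => Real.log (Real.cosh t - Real.sinh t * Real.cos θ)) '' Set.Ioo 0 π = Set.Ioo (-t) t := by
  have hs := Real.sinh_pos_iff.2 ht
  ext u
  constructor
  · rintro ⟨θ, ⟨h0, h1⟩, rfl⟩
    have hc1 : Real.cos θ < 1 := by
      rw [← Real.cos_zero]; exact Real.cos_lt_cos_of_nonneg_of_le_pi le_rfl h1.le h0
    have hc2 : -1 < Real.cos θ := by
      rw [← Real.cos_pi]; exact Real.cos_lt_cos_of_nonneg_of_le_pi h0.le le_rfl h1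
    have h5 := cosh_sub_sinh_mul_cos_pos t θ
    have e1 := Real.cosh_sub_sinh t
    have e2 := Real.cosh_add_sinh t
    constructor
    · rw [Real.lt_log_iff_exp_lt h5, ← e1]; nlinarith
    · rw [Real.log_lt_iff_lt_exp h5, ← e2]; nlinarith
  · rintro ⟨h0, h1⟩
    have e1 := Real.cosh_sub_sinh t
    have e2 := Real.cosh_add_sinh t
    have h2 : Real.exp (-t) < Real.exp u := Real.exp_lt_exp.2 h0
    have h3 : Real.exp u < Real.exp t := Real.exp_lt_exp.2 h1
    have h4 : (Real.cosh t - Real.exp u) / Real.sinh t ∈ Set.Ioo (-1) 1 := by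
      constructor
      · rw [lt_div_iff₀ hs]; linarith
      · rw [div_lt_iff₀ hs]; linarith
    refine ⟨Real.arccos ((Real.cosh t - Real.exp u) / Real.sinh t), ⟨Real.arccos_pos.2 h4.2, ?_⟩, ?_⟩
    · rw [← Real.arccos_neg_one]
      exact Real.strictAntiOn_arccos (by norm_num) ⟨h4.1.le, h4.2.le⟩ h4.1
    · simp only
      rw [Real.cos_arccos h4.1.le h4.2.le, mul_div_cancel₀ _ hs.ne', sub_sub_cancel, Real.log_exp]

theorem sph_tanh_eq_integral_exp (r : ℝ) {t : ℝ} (ht : 0 < t) : sph r (Real.tanh (t / 2)) =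
    ((π * √2)⁻¹ : ℝ) • ∫ u in Set.Ioo (-t) t,
      (abelKer t u : ℂ) * Complex.exp (-(I * r * u)) := by
  have hs := Real.sinh_pos_iff.2 ht
  have hd : ∀ θ : ℝ, HasDerivAt (fun θ => Real.log (Real.cosh t - Real.sinh t * Real.cos θ))
      (Real.sinh t * Real.sin θ / (Real.cosh t - Real.sinh t * Real.cos θ)) θ := by
    intro θ
    have := (((Real.hasDerivAt_cos θ).const_mul (Real.sinh t)).const_sub (Real.cosh t)).log
      (cosh_sub_sinh_mul_cos_pos t θ).ne'
    exact this.congr_deriv (by ring)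
  have hinj : Set.InjOn (fun θ => Real.log (Real.cosh t - Real.sinh t * Real.cos θ))
      (Set.Ioo 0 π) := by
    intro x hx y hy hxy
    have := Real.log_injOn_pos (cosh_sub_sinh_mul_cos_pos t x) (cosh_sub_sinh_mul_cos_pos t y) hxy
    refine Real.injOn_cos ⟨hx.1.le, hx.2.le⟩ ⟨hy.1.le, hy.2.le⟩ ?_
    have h2 : Real.sinh t * Real.cos x = Real.sinh t * Real.cos y := by linarith
    exact mul_left_cancel₀ hs.ne' h2
  rw [sph_tanh_eq_integral, ← log_image ht, integral_image_eq_integral_abs_deriv_smul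
    measurableSet_Ioo (fun θ _ => (hd θ).hasDerivWithinAt) hinj, mul_inv, mul_smul,
    ← integral_smul ((√2)⁻¹ : ℝ)]
  congr 1
  refine setIntegral_congr_fun (s := Set.Ioo (0 : ℝ) π) measurableSet_Ioo fun θ hθ => ?_
  have hsin := Real.sin_pos_of_pos_of_lt_pi hθ.1 hθ.2
  have h5 := cosh_sub_sinh_mul_cos_pos t θ
  simp only [pwave_tanh_exp]
  set D := Real.cosh t - Real.sinh t * Real.cos θ with hD
  have hkey : Real.cosh t - Real.cosh (Real.log D) = (Real.sinh t * Real.sin θ) ^ 2 / (2 * D) := by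
    rw [Real.cosh_log h5]
    field_simp
    have e1 := Real.sin_sq_add_cos_sq θ
    have e2 := Real.cosh_sq t
    rw [hD]
    linear_combination (-(Real.sinh t) ^ 2) * e1 + e2
  have h6 : abelKer t (Real.log D) = √2 * √D / (Real.sinh t * Real.sin θ) := by
    rw [abelKer, hkey, abs_of_nonneg (by positivity), Real.sqrt_div (by positivity),
      Real.sqrt_sq (by positivity), inv_div, Real.sqrt_mul (by norm_num)]
  rw [h6, abs_of_pos (by positivity)]
  have h7 : Complex.exp (-(Real.log D : ℂ) * (1 / 2 + I * r)) =
      ((√D)⁻¹ : ℝ) * Complex.exp (-(I * r * (Real.log D : ℝ))) := by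
    have : (√D)⁻¹ = Real.exp (-Real.log D / 2) := by
      rw [Real.sqrt_eq_rpow, Real.rpow_def_of_pos h5, ← Real.exp_neg]; congr 1; ring
    rw [this, Complex.ofReal_exp, ← Complex.exp_add]
    congr 1
    push_cast
    ring
  rw [h7, Complex.real_smul, Complex.real_smul, ← mul_assoc, ← mul_assoc, ← Complex.ofReal_mul,
    ← Complex.ofReal_mul]
  congr 2
  have : √D * √D = D := Real.mul_self_sqrt h5.le
  have := Real.sqrt_pos.2 h5
  field_simp
  nlinarith

theorem cosh_sub_cosh_eq (u t : ℝ) :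
    Real.cosh u - Real.cosh t = 2 * Real.sinh ((u + t) / 2) * Real.sinh ((u - t) / 2) := by
  have h1 : u = (u + t) / 2 + (u - t) / 2 := by ring
  have h2 : t = (u + t) / 2 - (u - t) / 2 := by ring
  conv_lhs => rw [h1]; right; rw [h2]
  rw [Real.cosh_add, Real.cosh_sub]; ring

theorem le_cosh_sub_cosh {t u : ℝ} (ht : 0 ≤ t) (htu : t ≤ u) :
    Real.sinh t * (u - t) * Real.exp ((u - t) / 2) ≤ Real.cosh u - Real.cosh t := by
  have hd : 0 ≤ (u - t) / 2 := by linarith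
  have h1 : (u - t) / 2 ≤ Real.sinh ((u - t) / 2) := Real.self_le_sinh_iff.2 hd
  have hs : 0 ≤ Real.sinh t := Real.sinh_nonneg_iff.2 ht
  have h2 : Real.sinh t * Real.exp ((u - t) / 2) ≤ Real.sinh ((u + t) / 2) := by
    rw [show (u + t) / 2 = t + (u - t) / 2 by ring, Real.sinh_add, ← Real.cosh_add_sinh]
    have := Real.sinh_lt_cosh t
    nlinarith [Real.sinh_nonneg_iff.2 hd]
  rw [cosh_sub_cosh_eq]
  have h3 : 0 ≤ Real.sinh t * Real.exp ((u - t) / 2) := by positivity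
  nlinarith [mul_le_mul h2 h1 hd (h3.trans h2)]

theorem abelKer_le_of_lt {t u : ℝ} (ht : 0 < t) (htu : t < u) :
    abelKer t u ≤ (√(Real.sinh t))⁻¹ * ((u - t) ^ (-(1 / 2) : ℝ) * Real.exp (-(1 / 4) * (u - t) ^ (1 : ℝ))) := by
  have hs := Real.sinh_pos_iff.2 ht
  have hd : 0 < u - t := by linarith
  have h := le_cosh_sub_cosh ht.le htu.le
  have h2 : (√(Real.sinh t))⁻¹ * ((u - t) ^ (-(1 / 2) : ℝ) * Real.exp (-(1 / 4) * (u - t) ^ (1 : ℝ))) =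
      (√(Real.sinh t * (u - t) * Real.exp ((u - t) / 2)))⁻¹ := by
    rw [Real.sqrt_mul (by positivity), Real.sqrt_mul hs.le, mul_inv, mul_inv, mul_assoc,
      ← Real.exp_half, ← Real.exp_neg, Real.rpow_neg hd.le, Real.sqrt_eq_rpow (u - t), Real.rpow_one]
    congr 3; ring
  rw [h2, abelKer_comm, abelKer]
  have h3 : 0 < Real.sinh t * (u - t) * Real.exp ((u - t) / 2) := by positivity
  rw [abs_of_pos (h3.trans_le h)]
  gcongr

theorem integrableOn_abelKer_Ioi {t : ℝ} (ht : 0 < t) : IntegrableOn (abelKer t) (Set.Ioi t) := by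
  have h := integrableOn_rpow_mul_exp_neg_mul_rpow (p := 1) (s := -(1 / 2)) (b := 1 / 4)
    (by norm_num) (by norm_num) (by norm_num)
  have h2 := (integrable_indicator_iff measurableSet_Ioi).2 h
  have h3 := (h2.comp_sub_right t).const_mul ((√(Real.sinh t))⁻¹)
  refine Integrable.mono' h3.integrableOn
    (measurable_abelKer.comp measurable_prodMk_left).aestronglyMeasurable ?_
  filter_upwards [ae_restrict_mem measurableSet_Ioi] with u hu
  have hu : t < u := hu
  rw [Set.indicator_of_mem (by simpa using hu), Real.norm_of_nonneg (abelKer_nonneg t u)]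
  exact abelKer_le_of_lt ht hu

theorem abelKer_le_of_gt {t u : ℝ} (hu : 0 ≤ u) (hut : u < t) :
    abelKer t u ≤ (√(Real.sinh (t / 2)))⁻¹ * (t - u) ^ (-(1 / 2) : ℝ) := by
  have ht : 0 < t := hu.trans_lt hut
  have hs := Real.sinh_pos_iff.2 (half_pos ht)
  have hd : 0 < t - u := by linarith
  have h : Real.sinh (t / 2) * (t - u) ≤ Real.cosh t - Real.cosh u := by
    rw [cosh_sub_cosh_eq]
    have h1 : Real.sinh (t / 2) ≤ Real.sinh ((t + u) / 2) := Real.sinh_le_sinh.2 (by linarith)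
    have h2 : (t - u) / 2 ≤ Real.sinh ((t - u) / 2) := Real.self_le_sinh_iff.2 (by linarith)
    nlinarith [mul_le_mul h1 h2 (by linarith) (hs.le.trans h1)]
  have h2 : (√(Real.sinh (t / 2)))⁻¹ * (t - u) ^ (-(1 / 2) : ℝ) =
      (√(Real.sinh (t / 2) * (t - u)))⁻¹ := by
    rw [Real.sqrt_mul hs.le, mul_inv, Real.rpow_neg hd.le, Real.sqrt_eq_rpow (t - u)]
  rw [h2, abelKer]
  have h3 : 0 < Real.sinh (t / 2) * (t - u) := by positivity
  rw [abs_of_pos (h3.trans_le h)]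
  gcongr

theorem integrableOn_abelKer_Ioo {t : ℝ} (ht : 0 < t) : IntegrableOn (abelKer t) (Set.Ioo 0 t) := by
  have h : IntervalIntegrable (fun u : ℝ => (t - u) ^ (-(1 / 2) : ℝ)) volume (t - 0) (t - t) :=
    (intervalIntegral.intervalIntegrable_rpow' (a := 0) (b := t)
      (r := -(1 / 2)) (by norm_num)).comp_sub_left t
  have h2 := (h.symm.const_mul (√(Real.sinh (t / 2)))⁻¹)
  simp only [sub_zero, sub_self] at h2
  rw [intervalIntegrable_iff_integrableOn_Ioo_of_le ht.le] at h2
  refine Integrable.mono' h2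
    (measurable_abelKer.comp measurable_prodMk_left).aestronglyMeasurable ?_
  filter_upwards [ae_restrict_mem measurableSet_Ioo] with u hu
  rw [Real.norm_of_nonneg (abelKer_nonneg t u)]
  exact abelKer_le_of_gt hu.1.le hu.2

theorem integrable_of_integrableOn_Ioi_of_even {f : ℝ → ℝ} (hf : IntegrableOn f (Set.Ioi 0))
    (he : ∀ x, f (-x) = f x) : Integrable f := by
  rw [← integrableOn_univ, ← Set.Iic_union_Ioi (a := (0 : ℝ))]
  refine IntegrableOn.union ?_ hf
  rw [← Measure.map_neg_eq_self (volume : Measure ℝ)]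
  have m : MeasurableEmbedding fun x : ℝ => -x := (Homeomorph.neg ℝ).measurableEmbedding
  refine (m.integrableOn_map_iff).2 ?_
  simp_rw [Function.comp_def, he, Set.neg_preimage, Set.neg_Iic, neg_zero]
  exact Iff.mpr integrableOn_Ici_iff_integrableOn_Ioi hf

theorem integrable_abelKer {t : ℝ} (ht : 0 < t) : Integrable (abelKer t) := by
  refine integrable_of_integrableOn_Ioi_of_even ?_ fun x => by
    rw [abelKer, abelKer, Real.cosh_neg]
  rw [← Set.Ioo_union_Ici_eq_Ioi ht]
  exact (integrableOn_abelKer_Ioo ht).union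
    (Iff.mpr integrableOn_Ici_iff_integrableOn_Ioi (integrableOn_abelKer_Ioi ht))

theorem abs_cosh_sub_cosh_le_norm (t x y : ℝ) :
    |Real.cosh t - Real.cosh x| ≤ ‖(Real.cosh t : ℂ) - Complex.cosh (x + y * I)‖ := by
  have hre : Complex.cosh (x + y * I) = (Real.cosh x * Real.cos y : ℝ) + (Real.sinh x * Real.sin y : ℝ) * I := by
    rw [Complex.cosh_add, Complex.cosh_mul_I, Complex.sinh_mul_I]
    push_cast
    ring
  apply abs_le_of_sq_le_sq _ (norm_nonneg _)
  rw [← Complex.normSq_eq_norm_sq, Complex.normSq_apply, hre]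
  simp only [Complex.sub_re, Complex.sub_im, Complex.add_re, Complex.add_im, Complex.ofReal_re,
      Complex.ofReal_im, Complex.mul_re, Complex.mul_im, Complex.I_re, Complex.I_im]
  have h1 := Real.cosh_sq x
  have h2 := Real.sin_sq_add_cos_sq y
  have h3 := Real.one_le_cosh t
  have h4 := Real.one_le_cosh x
  have h5 := Real.cos_le_one y
  have h6 : 1 + Real.cos y ≤ 2 * (Real.cosh t * Real.cosh x) := by nlinarith
  have h7 := mul_nonneg (sub_nonneg.2 h5) (sub_nonneg.2 h6)
  have h8 : Real.sinh x ^ 2 * Real.sin y ^ 2 = (Real.cosh x ^ 2 - 1) * (1 - Real.cos y ^ 2) := by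
    rw [h1, ← h2]; ring
  nlinarith

/-- The integrand of the contour integral relating the two Mehler formulas. -/
def mehlerFun (r t : ℝ) (z : ℂ) : ℂ :=
  Complex.exp (I * r * z) * ((Real.cosh t : ℂ) - Complex.cosh z) ^ ((-(1 / 2) : ℝ) : ℂ)

/-- The boundary values of `mehlerFun` on the real line. -/
def mehlerBdry (r t x : ℝ) : ℂ :=
  Complex.exp (I * r * x) * ((if |x| < t then 1 else if 0 < x then I else -I) * abelKer t x)

theorem cosh_add_mul_I_eq (x y : ℝ) : Complex.cosh (x + y * I) =
    (Real.cosh x * Real.cos y : ℝ) + (Real.sinh x * Real.sin y : ℝ) * I := by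
  rw [Complex.cosh_add, Complex.cosh_mul_I, Complex.sinh_mul_I]
  push_cast
  ring

theorem cosh_sub_cosh_re (t x y : ℝ) : ((Real.cosh t : ℂ) - Complex.cosh (x + y * I)).re =
    Real.cosh t - Real.cosh x * Real.cos y := by
  rw [cosh_add_mul_I_eq, Complex.sub_re, Complex.add_re, Complex.re_ofReal_mul]; simp [Complex.cos_ofReal_re]

theorem cosh_sub_cosh_im (t x y : ℝ) : ((Real.cosh t : ℂ) - Complex.cosh (x + y * I)).im =
    -(Real.sinh x * Real.sin y) := by
  rw [cosh_add_mul_I_eq, Complex.sub_im, Complex.add_im, Complex.im_ofReal_mul]; simp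

theorem cosh_sub_cosh_mem_slitPlane {t : ℝ} (ht : 0 < t) (x : ℝ) {y : ℝ} (hy : 0 < y) (hy' : y ≤ π) :
    (Real.cosh t : ℂ) - Complex.cosh (x + y * I) ∈ Complex.slitPlane := by
  rw [Complex.mem_slitPlane_iff, cosh_sub_cosh_re, cosh_sub_cosh_im]
  have h1 : 1 < Real.cosh t := Real.one_lt_cosh.2 ht.ne'
  rcases hy'.lt_or_eq with h | h
  · have hs := Real.sin_pos_of_pos_of_lt_pi hy h
    by_cases hx : x = 0
    · left; subst hx; simp; linarith [Real.cos_le_one y]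
    · right; rw [neg_ne_zero]; exact mul_ne_zero (by rwa [Ne, Real.sinh_eq_zero]) hs.ne'
  · left; subst h; simp; linarith [Real.cosh_pos x]

theorem measurable_mehlerFun (r t : ℝ) : Measurable (mehlerFun r t) := by
  unfold mehlerFun
  have : Measurable Complex.cosh := Complex.continuous_cosh.measurable
  fun_prop

theorem norm_mehlerFun_le (r : ℝ) {t x y : ℝ} (hx : |x| ≠ |t|) (hy : 0 ≤ y) (hy' : y ≤ π) :
    ‖mehlerFun r t (x + y * I)‖ ≤ Real.exp (|r| * π) * abelKer t x := by
  have h := abs_cosh_sub_cosh_le_norm t x y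
  have h0 : 0 < |Real.cosh t - Real.cosh x| := by
    rw [abs_pos, sub_ne_zero]
    exact fun h => hx (le_antisymm (Real.cosh_le_cosh.1 h.ge) (Real.cosh_le_cosh.1 h.le))
  rw [mehlerFun, norm_mul, Complex.norm_cpow_real, Complex.norm_exp]
  gcongr
  · have : (I * r * (x + y * I)).re = -r * y := by simp
    rw [this]
    calc -r * y ≤ |r| * y := by gcongr; exact neg_le_abs r
      _ ≤ |r| * π := by gcongr
  · rw [abelKer, Real.sqrt_eq_rpow, Real.rpow_neg (norm_nonneg _)]
    gcongr

theorem differentiableAt_mehlerFun (r : ℝ) {t : ℝ} (ht : 0 < t) {z : ℂ} (h0 : 0 < z.im)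
    (h1 : z.im ≤ π) : DifferentiableAt ℂ (mehlerFun r t) z := by
  have := cosh_sub_cosh_mem_slitPlane ht z.re h0 h1
  rw [Complex.re_add_im] at this
  unfold mehlerFun
  refine DifferentiableAt.mul (by fun_prop) (DifferentiableAt.cpow ?_ (by fun_prop) this)
  exact (differentiableAt_const _).sub Complex.differentiable_cosh.differentiableAt

theorem norm_integral_mehlerFun_sub_le (r : ℝ) {t X ε : ℝ} (ht : 0 < t) (hX : t < X) (h0 : 0 < ε)
    (h1 : ε < π) : ‖(∫ x in (-X)..X, mehlerFun r t (x + ε * I)) -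
      ∫ x in (-X)..X, mehlerFun r t (x + π * I)‖ ≤ 2 * (Real.exp (|r| * π) * abelKer t X * π) := by
  have h := Complex.integral_boundary_rect_eq_zero_of_differentiableOn (mehlerFun r t)
    (((-X : ℝ) : ℂ) + ε * I) ((X : ℂ) + π * I) ?_
  swap
  · intro z hz
    have := hz.2
    simp [Set.uIcc_of_le h1.le] at this
    exact (differentiableAt_mehlerFun r ht (h0.trans_le this.1) this.2).differentiableWithinAt
  simp only [add_re, add_im, ofReal_re, ofReal_im, mul_re, mul_im, I_re, I_im, mul_zero, mul_one,
    sub_self, zero_add, add_zero] at h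
  have hb : ∀ s : ℝ, |s| = X → ‖∫ y in ε..π, mehlerFun r t (s + y * I)‖ ≤
      Real.exp (|r| * π) * abelKer t X * π := by
    intro s hs
    refine (intervalIntegral.norm_integral_le_of_norm_le_const (C := Real.exp (|r| * π) * abelKer t X)
      fun y hy => ?_).trans ?_
    · rw [Set.uIoc_of_le h1.le] at hy
      rw [← hs, abelKer_abs_right]
      refine norm_mehlerFun_le r ?_ (h0.trans hy.1).le hy.2
      rw [hs, abs_of_pos ht]; exact hX.ne'
    · rw [abs_of_pos (sub_pos.2 h1)]
      have := abelKer_nonneg t X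
      gcongr
      linarith
  have hX0 : 0 < X := ht.trans hX
  have hb1 := hb X (abs_of_pos hX0)
  have hb2 := hb (-X) (by rw [abs_neg, abs_of_pos hX0])
  have h2 : (∫ x in (-X)..X, mehlerFun r t (x + ε * I)) -
      ∫ x in (-X)..X, mehlerFun r t (x + π * I) =
      I • (∫ y in ε..π, mehlerFun r t ((-X : ℝ) + y * I)) - I • ∫ y in ε..π, mehlerFun r t (X + y * I) := by
    linear_combination h
  rw [h2]
  refine (norm_sub_le _ _).trans ?_
  rw [norm_smul, norm_smul, Complex.norm_I]
  linarith

theorem tendsto_mehlerFun (r : ℝ) {t x : ℝ} (ht : 0 < t) (hx : |x| ≠ t) :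
    Filter.Tendsto (fun ε : ℝ => mehlerFun r t (x + ε * I)) (nhdsWithin 0 (Set.Ioi 0))
      (nhds (mehlerBdry r t x)) := by
  have hsin : ∀ᶠ ε : ℝ in nhdsWithin 0 (Set.Ioi 0), 0 < Real.sin ε := by
    filter_upwards [Ioo_mem_nhdsGT Real.pi_pos] with ε hε
    exact Real.sin_pos_of_pos_of_lt_pi hε.1 hε.2
  have hcont : Filter.Tendsto (fun ε : ℝ => (Real.cosh t : ℂ) - Complex.cosh (x + ε * I))
      (nhdsWithin 0 (Set.Ioi 0)) (nhds ((Real.cosh t - Real.cosh x : ℝ) : ℂ)) := by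
    have hc : Continuous (fun ε : ℝ => (Real.cosh t : ℂ) - Complex.cosh (x + ε * I)) :=
      continuous_const.sub (Complex.continuous_cosh.comp (by fun_prop))
    have := (hc.tendsto 0).mono_left (nhdsWithin_le_nhds (s := Set.Ioi 0))
    simpa using this
  refine Filter.Tendsto.mul ?_ ?_
  · have hc : Continuous (fun ε : ℝ => Complex.exp (I * r * (x + ε * I))) := by fun_prop
    have := (hc.tendsto 0).mono_left (nhdsWithin_le_nhds (s := Set.Ioi 0))
    simpa using this
  have hcpow : ∀ (c : ℂ), Real.cosh t - Real.cosh x ≠ 0 →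
      Filter.Tendsto (fun ε : ℝ => Complex.log ((Real.cosh t : ℂ) - Complex.cosh (x + ε * I)))
        (nhdsWithin 0 (Set.Ioi 0)) (nhds (Real.log |Real.cosh t - Real.cosh x| + c)) →
      Filter.Tendsto (fun ε : ℝ => ((Real.cosh t : ℂ) - Complex.cosh (x + ε * I)) ^
        ((-(1 / 2) : ℝ) : ℂ)) (nhdsWithin 0 (Set.Ioi 0))
        (nhds (Complex.exp (-c / 2) * abelKer t x)) := by
    intro c hne h
    have h1 := ((h.mul_const (-(1 / 2) : ℂ))).cexp
    have h2 : Complex.exp ((Real.log |Real.cosh t - Real.cosh x| + c) * (-(1 / 2))) =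
        Complex.exp (-c / 2) * abelKer t x := by
      rw [add_mul, Complex.exp_add, mul_comm, abelKer]
      congr 1
      · congr 1; ring
      · rw [Real.sqrt_eq_rpow, Real.rpow_def_of_pos (abs_pos.2 hne), ← Real.exp_neg]
        push_cast
        congr 1; ring
    rw [h2] at h1
    refine h1.congr' ?_
    filter_upwards [Ioo_mem_nhdsGT Real.pi_pos] with ε hε
    have := Complex.slitPlane_ne_zero (cosh_sub_cosh_mem_slitPlane ht x hε.1 hε.2.le)
    rw [Complex.cpow_def_of_ne_zero this]
    push_cast
    rfl
  have hI : Complex.exp (-(-(π * I)) / 2) = I := by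
    rw [neg_neg, mul_div_right_comm, Complex.exp_pi_div_two_mul_I]
  have hI' : Complex.exp (-(π * I) / 2) = -I := by
    rw [neg_div, mul_div_right_comm, Complex.exp_neg, Complex.exp_pi_div_two_mul_I, Complex.inv_I]
  by_cases hxt : |x| < t
  · have hlt : Real.cosh x < Real.cosh t := Real.cosh_lt_cosh.2 (by rwa [abs_of_pos ht])
    have hm : ((Real.cosh t - Real.cosh x : ℝ) : ℂ) ∈ Complex.slitPlane :=
      Complex.ofReal_mem_slitPlane.2 (by linarith)
    have := hcpow 0 (by linarith) ?_
    · simpa [hxt] using this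
    · have h := hcont.clog hm
      rw [← Complex.ofReal_log (by linarith)] at h
      rw [add_zero, abs_of_pos (by linarith)]
      exact h
  have hxt' : t < |x| := lt_of_le_of_ne (not_lt.1 hxt) hx.symm
  have hlt : Real.cosh t < Real.cosh x := Real.cosh_lt_cosh.2 (by rwa [abs_of_pos ht])
  have hre : ((Real.cosh t - Real.cosh x : ℝ) : ℂ).re < 0 := by
    rw [Complex.ofReal_re]; linarith
  by_cases hx0 : 0 < x
  · have := hcpow (-(π * I)) (by linarith) ?_
    · rw [hI] at this
      simpa [hxt, hx0] using this
    · have h := (Complex.tendsto_log_nhdsWithin_im_neg_of_re_neg_of_im_zero hre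
        (Complex.ofReal_im _)).comp (tendsto_nhdsWithin_iff.2 ⟨hcont, ?_⟩)
      · rw [Complex.norm_real, Real.norm_eq_abs] at h
        exact h
      · filter_upwards [hsin] with ε hε
        have := Real.sinh_pos_iff.2 hx0
        change _ < _
        rw [cosh_sub_cosh_im]
        have : 0 < Real.sinh x * Real.sin ε := by positivity
        linarith
  · have := hcpow (π * I) (by linarith) ?_
    · rw [hI'] at this
      simpa [hxt, hx0] using this
    · have h := (Complex.tendsto_log_nhdsWithin_im_nonneg_of_re_neg_of_im_zero hre
        (Complex.ofReal_im _)).comp (tendsto_nhdsWithin_iff.2 ⟨hcont, ?_⟩)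
      · rw [Complex.norm_real, Real.norm_eq_abs] at h
        exact h
      · filter_upwards [hsin] with ε hε
        have := Real.sinh_nonpos_iff.2 (not_lt.1 hx0)
        change _ ≤ _
        rw [cosh_sub_cosh_im]
        nlinarith

theorem measurable_abelKer_right (t : ℝ) : Measurable (abelKer t) := by
  change Measurable fun u => (√|Real.cosh t - Real.cosh u|)⁻¹
  fun_prop

theorem ae_abs_ne (t : ℝ) : ∀ᵐ x : ℝ, |x| ≠ t := by
  have h : (({t, -t} : Set ℝ)ᶜ) ∈ ae (volume : Measure ℝ) :=
    compl_mem_ae_iff.2 ((Set.toFinite _).measure_zero _)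
  filter_upwards [h] with x hx h
  rcases abs_choice x with h' | h' <;> rw [h'] at h
  · exact hx (by simp [h])
  · exact hx (by simp [← h])

theorem norm_mehlerBdry (r t x : ℝ) : ‖mehlerBdry r t x‖ = abelKer t x := by
  have h1 : (I * r * x : ℂ) = (r * x : ℝ) * I := by push_cast; ring
  rw [mehlerBdry, norm_mul, norm_mul, h1, Complex.norm_exp_ofReal_mul_I, Complex.norm_real,
    Real.norm_of_nonneg (abelKer_nonneg t x)]
  split_ifs <;> simp

theorem measurable_mehlerBdry (r t : ℝ) : Measurable (mehlerBdry r t) := by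
  unfold mehlerBdry
  have := measurable_abelKer.comp (measurable_prodMk_left (x := t))
  refine Measurable.mul (by fun_prop) (Measurable.mul ?_ (Complex.measurable_ofReal.comp this))
  refine Measurable.ite (measurableSet_lt (by fun_prop) (by fun_prop)) measurable_const ?_
  exact Measurable.ite (measurableSet_lt (by fun_prop) (by fun_prop)) measurable_const
    measurable_const

theorem tendsto_abelKer_atTop (t : ℝ) : Filter.Tendsto (abelKer t) Filter.atTop (nhds 0) := by
  unfold abelKer
  refine Filter.Tendsto.inv_tendsto_atTop (Real.tendsto_sqrt_atTop.comp ?_)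
  have h : Filter.Tendsto (fun u => Real.cosh u - Real.cosh t) Filter.atTop Filter.atTop :=
    Filter.tendsto_atTop_add_const_right _ _ <|
      Filter.tendsto_atTop_mono (fun u => by
        have := Real.cosh_add_sinh u
        have h2 := Real.sinh_lt_cosh u
        show Real.exp u / 2 ≤ Real.cosh u
        linarith) (Real.tendsto_exp_atTop.atTop_div_const (by norm_num))
  refine Filter.tendsto_atTop_mono (fun u => ?_) h
  rw [abs_sub_comm]
  exact le_abs_self _

theorem integral_mehlerBdry (r : ℝ) {t : ℝ} (ht : 0 < t) :
    ∫ x, mehlerBdry r t x = ∫ x : ℝ, mehlerFun r t (x + π * I) := by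
  have hk := integrable_abelKer ht
  have hk' := hk.const_mul (Real.exp (|r| * π))
  have hbound : ∀ y : ℝ, 0 ≤ y → y ≤ π → ∀ᵐ x : ℝ, ‖mehlerFun r t (x + y * I)‖ ≤
      Real.exp (|r| * π) * abelKer t x := by
    intro y h0 h1
    filter_upwards [ae_abs_ne t] with x hx
    exact norm_mehlerFun_le r (by rwa [abs_of_pos ht]) h0 h1
  have hmeas : ∀ y : ℝ, Measurable fun x : ℝ => mehlerFun r t (x + y * I) := fun y =>
    (measurable_mehlerFun r t).comp (by fun_prop)
  have hint1 : Integrable (mehlerBdry r t) :=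
    hk.mono' (measurable_mehlerBdry r t).aestronglyMeasurable
      (Filter.Eventually.of_forall fun x => (norm_mehlerBdry r t x).le)
  have hint2 : Integrable fun x : ℝ => mehlerFun r t (x + π * I) :=
    hk'.mono' (hmeas π).aestronglyMeasurable (hbound π Real.pi_pos.le le_rfl)
  have hX : ∀ X, t < X → ‖(∫ x in (-X)..X, mehlerBdry r t x) -
      ∫ x in (-X)..X, mehlerFun r t (x + π * I)‖ ≤ 2 * (Real.exp (|r| * π) * abelKer t X * π) := by
    intro X hX
    have hl : Filter.Tendsto (fun ε : ℝ => ∫ x in (-X)..X, mehlerFun r t (x + ε * I))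
        (nhdsWithin 0 (Set.Ioi 0)) (nhds (∫ x in (-X)..X, mehlerBdry r t x)) := by
      refine intervalIntegral.tendsto_integral_filter_of_dominated_convergence
        (fun x => Real.exp (|r| * π) * abelKer t x) ?_ ?_ hk'.intervalIntegrable ?_
      · exact Filter.Eventually.of_forall fun ε => (hmeas ε).aestronglyMeasurable
      · filter_upwards [Ioo_mem_nhdsGT Real.pi_pos] with ε hε
        filter_upwards [hbound ε hε.1.le hε.2.le] with x hx _
        exact hx
      · filter_upwards [ae_abs_ne t] with x hx _
        exact tendsto_mehlerFun r ht hx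
    refine le_of_tendsto (hl.sub_const _).norm ?_
    filter_upwards [Ioo_mem_nhdsGT Real.pi_pos] with ε hε
    exact norm_integral_mehlerFun_sub_le r ht hX hε.1 hε.2
  have hl1 := intervalIntegral_tendsto_integral hint1 Filter.tendsto_neg_atTop_atBot Filter.tendsto_id
  have hl2 := intervalIntegral_tendsto_integral hint2 Filter.tendsto_neg_atTop_atBot Filter.tendsto_id
  have hl3 := (((tendsto_abelKer_atTop t).const_mul (Real.exp (|r| * π))).mul_const π).const_mul 2
  simp only [mul_zero, zero_mul] at hl3
  have := le_of_tendsto_of_tendsto (hl1.sub hl2).norm hl3 <| by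
    filter_upwards [Filter.eventually_gt_atTop t] with X h
    exact hX X h
  exact sub_eq_zero.1 (norm_le_zero_iff.1 this)

theorem re_mehlerBdry (r t x : ℝ) : (mehlerBdry r t x).re = abelKer t |x| *
    (if |x| < t then Real.cos (r * |x|) else - Real.sin (r * |x|)) := by
  have h1 : (I * r * x : ℂ) = (r * x : ℝ) * I := by push_cast; ring
  rw [mehlerBdry, abelKer_abs_right, h1, Complex.exp_mul_I, ← Complex.ofReal_cos,
    ← Complex.ofReal_sin]
  have hc : Real.cos (r * |x|) = Real.cos (r * x) := by
    rcases abs_choice x with h | h <;> rw [h]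
    rw [mul_neg, Real.cos_neg]
  rw [hc]
  by_cases hx : |x| < t
  · rw [if_pos hx, if_pos hx]
    generalize Real.cos (r * x) = c
    generalize Real.sin (r * x) = d
    simp
    ring
  · rw [if_neg hx, if_neg hx]
    by_cases h0 : 0 < x
    · rw [if_pos h0, show |x| = x from abs_of_pos h0]
      generalize Real.cos (r * x) = c
      generalize Real.sin (r * x) = d
      simp
      ring
    · rw [if_neg h0, show |x| = -x from abs_of_nonpos (not_lt.1 h0), mul_neg (a := r), Real.sin_neg]
      generalize Real.cos (r * x) = c
      generalize Real.sin (r * x) = d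
      simp
      ring

theorem re_mehlerFun_pi (r t x : ℝ) : (mehlerFun r t (x + π * I)).re =
    Real.exp (-(π * r)) * (Real.cos (r * x) * (Real.cosh t + Real.cosh x) ^ (-(1 / 2) : ℝ)) := by
  have h1 : (Real.cosh t : ℂ) - Complex.cosh (x + π * I) = (Real.cosh t + Real.cosh x : ℝ) := by
    rw [cosh_add_mul_I_eq]; simp
  have h2 : (I * r * (x + π * I) : ℂ) = (-(π * r) : ℝ) + (r * x : ℝ) * I := by
    push_cast
    linear_combination (r * π : ℂ) * Complex.I_sq
  have h3 : 0 ≤ Real.cosh t + Real.cosh x := by linarith [Real.cosh_pos t, Real.cosh_pos x]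
  rw [mehlerFun, h1, h2, ← Complex.ofReal_cpow h3, Complex.exp_add, ← Complex.ofReal_exp,
    Complex.exp_mul_I, ← Complex.ofReal_cos, ← Complex.ofReal_sin]
  generalize Real.cos (r * x) = c
  generalize Real.sin (r * x) = d
  generalize Real.exp (-(π * r)) = e
  generalize (Real.cosh t + Real.cosh x) ^ (-(1 / 2) : ℝ) = f
  simp
  ring

theorem integrable_mul_abelKer {t : ℝ} (ht : 0 < t) {g : ℝ → ℝ} (hg : Measurable g)
    (hg' : ∀ u, |g u| ≤ 1) : Integrable fun u => g u * abelKer t u := by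
  have hmk : Measurable (abelKer t) := measurable_abelKer_right t
  refine (integrable_abelKer ht).mono' (hg.mul hmk).aestronglyMeasurable
    (Filter.Eventually.of_forall fun u => ?_)
  rw [norm_mul, Real.norm_of_nonneg (abelKer_nonneg t u)]
  exact mul_le_of_le_one_left (abelKer_nonneg t u) (hg' u)

theorem integrable_cos_mul_abelKer (r : ℝ) {t : ℝ} (ht : 0 < t) :
    Integrable fun u => Real.cos (r * u) * abelKer t u :=
  integrable_mul_abelKer ht (by fun_prop) fun _ => Real.abs_cos_le_one _

theorem integrable_sin_mul_abelKer (r : ℝ) {t : ℝ} (ht : 0 < t) :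
    Integrable fun u => Real.sin (r * u) * abelKer t u :=
  integrable_mul_abelKer ht (by fun_prop) fun _ => Real.abs_sin_le_one _

theorem integral_cos_sub_integral_sin_abelKer (r : ℝ) {t : ℝ} (ht : 0 < t) :
    2 * ((∫ u in Set.Ioo 0 t, Real.cos (r * u) * abelKer t u) -
      ∫ u in Set.Ioi t, Real.sin (r * u) * abelKer t u) =
    Real.exp (-(π * r)) *
      ∫ x, Real.cos (r * x) * (Real.cosh t + Real.cosh x) ^ (-(1 / 2) : ℝ) := by
  have hk := integrable_abelKer ht
  have hint1 : Integrable (mehlerBdry r t) :=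
    hk.mono' (measurable_mehlerBdry r t).aestronglyMeasurable
      (Filter.Eventually.of_forall fun x => (norm_mehlerBdry r t x).le)
  have hint2 : Integrable fun x : ℝ => mehlerFun r t (x + π * I) := by
    have hm : Measurable fun x : ℝ => mehlerFun r t (x + π * I) :=
      (measurable_mehlerFun r t).comp (by fun_prop)
    refine (hk.const_mul (Real.exp (|r| * π))).mono' hm.aestronglyMeasurable ?_
    filter_upwards [ae_abs_ne t] with x hx
    exact norm_mehlerFun_le r (by rwa [abs_of_pos ht]) Real.pi_pos.le le_rfl
  have h := congrArg Complex.re (integral_mehlerBdry r ht)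
  have e1 := integral_re hint1
  have e2 := integral_re hint2
  simp only [RCLike.re_eq_complex_re] at e1 e2
  rw [← e1, ← e2] at h
  simp only [re_mehlerBdry, re_mehlerFun_pi] at h
  rw [integral_comp_abs (f := fun u => abelKer t u *
    (if u < t then Real.cos (r * u) else - Real.sin (r * u))), integral_const_mul] at h
  rw [← h]
  congr 1
  rw [← Set.Ioo_union_Ici_eq_Ioi ht, setIntegral_union]
  · rw [integral_Ici_eq_integral_Ioi, sub_eq_add_neg, ← integral_neg]
    congr 1
    · refine setIntegral_congr_fun measurableSet_Ioo fun u hu => ?_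
      simp only [hu.2, if_true]; ring
    · refine setIntegral_congr_fun measurableSet_Ioi fun u hu => ?_
      have : ¬ u < t := not_lt.2 (le_of_lt hu)
      simp only [this, if_false]; ring
  · exact Set.disjoint_left.2 fun u hu hu' => (not_le.2 hu.2) hu'
  · exact measurableSet_Ici
  · refine (integrable_cos_mul_abelKer r ht).integrableOn.congr_fun (fun u hu => ?_) measurableSet_Ioo
    simp only [hu.2, if_true]; ring
  · refine Iff.mpr integrableOn_Ici_iff_integrableOn_Ioi ?_
    refine (integrable_sin_mul_abelKer r ht).neg.integrableOn.congr_fun (fun u hu => ?_)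
      measurableSet_Ioi
    have : ¬ u < t := not_lt.2 (le_of_lt hu)
    simp only [this, if_false, Pi.neg_apply]; ring

/-- The equality of the two Mehler integrals. -/
theorem integral_sin_mul_abelKer (r : ℝ) {t : ℝ} (ht : 0 < t) :
    ∫ u in Set.Ioi t, Real.sin (r * u) * abelKer t u =
      Real.tanh (π * r) * ∫ u in Set.Ioo 0 t, Real.cos (r * u) * abelKer t u := by
  have h1 := integral_cos_sub_integral_sin_abelKer r ht
  have h2 := integral_cos_sub_integral_sin_abelKer (-r) ht
  simp only [neg_mul, Real.cos_neg, Real.sin_neg, mul_neg, integral_neg, neg_neg] at h2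
  generalize (∫ u in Set.Ioo 0 t, Real.cos (r * u) * abelKer t u) = C at *
  generalize (∫ u in Set.Ioi t, Real.sin (r * u) * abelKer t u) = S at *
  generalize (∫ x, Real.cos (r * x) * (Real.cosh t + Real.cosh x) ^ (-(1 / 2) : ℝ)) = J at *
  have hexp : Real.exp (π * r) * Real.exp (-(π * r)) = 1 := by rw [← Real.exp_add]; simp
  have hc := Real.cosh_pos (π * r)
  rw [Real.tanh_eq_sinh_div_cosh, div_mul_eq_mul_div, eq_div_iff hc.ne', Real.cosh_eq, Real.sinh_eq]
  linear_combination (Real.exp (-(π * r)) / 4) * h2 - (Real.exp (π * r) / 4) * h1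

theorem sph_tanh_eq_integral_cos (r : ℝ) {t : ℝ} (ht : 0 < t) : sph r (Real.tanh (t / 2)) =
    ((√2 / π * ∫ u in Set.Ioo 0 t, Real.cos (r * u) * abelKer t u : ℝ) : ℂ) := by
  have hint : Integrable fun u : ℝ => (abelKer t u : ℂ) * Complex.exp (-(I * r * u)) := by
    have hmk : Measurable (abelKer t) := measurable_abelKer_right t
    refine (integrable_abelKer ht).mono' ((Complex.measurable_ofReal.comp hmk).mul
      (by fun_prop : Measurable fun u : ℝ => Complex.exp (-(I * r * u)))).aestronglyMeasurable (Filter.Eventually.of_forall fun u => ?_)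
    have h1 : -(I * r * u : ℂ) = (-(r * u) : ℝ) * I := by push_cast; ring
    rw [norm_mul, h1, Complex.norm_exp_ofReal_mul_I, Complex.norm_real,
      Real.norm_of_nonneg (abelKer_nonneg t u), mul_one]
  have hre : ∀ u : ℝ, ((abelKer t u : ℂ) * Complex.exp (-(I * r * u))).re =
      abelKer t u * Real.cos (r * u) := by
    intro u
    have h1 : -(I * r * u : ℂ) = (-(r * u) : ℝ) * I := by push_cast; ring
    rw [h1, Complex.exp_mul_I, ← Complex.ofReal_cos, ← Complex.ofReal_sin, Real.cos_neg]
    generalize Real.cos (r * u) = c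
    generalize Real.sin (-(r * u)) = d
    simp
  have h0 := Complex.conj_eq_iff_re.1 (conj_sph r (norm_tanh_half_lt_one t))
  rw [← h0]
  congr 1
  rw [sph_tanh_eq_integral_exp r ht, Complex.smul_re]
  have e1 := integral_re (hint.integrableOn (s := Set.Ioo (-t) t))
  simp only [RCLike.re_eq_complex_re, hre] at e1
  rw [← e1, ← integral_indicator measurableSet_Ioo]
  have h2 : (Set.Ioo (-t) t).indicator (fun u => abelKer t u * Real.cos (r * u)) =
      fun u => (Set.Iio t).indicator (fun u => Real.cos (r * u) * abelKer t u) |u| := by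
    ext u
    have hcos : Real.cos (r * |u|) = Real.cos (r * u) := by
      rcases abs_choice u with h | h <;> rw [h]
      rw [mul_neg, Real.cos_neg]
    simp only [Set.indicator_apply, Set.mem_Ioo, Set.mem_Iio, abs_lt, abelKer_abs_right, hcos,
      mul_comm]
  rw [h2, integral_comp_abs, setIntegral_indicator measurableSet_Iio, Set.Ioi_inter_Iio, smul_eq_mul,
    ← mul_assoc]
  congr 1
  have : √2 * √2 = 2 := Real.mul_self_sqrt (by norm_num)
  have h3 : 0 < √2 := by positivity
  have := Real.pi_pos
  field_simp
  nlinarith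

theorem hasDerivAt_arcsin_cosh {u v t : ℝ} (hv : 0 ≤ v) (hvt : v < t) (htu : t < u) :
    HasDerivAt (fun t => Real.arcsin ((2 * Real.cosh t - Real.cosh u - Real.cosh v) /
      (Real.cosh u - Real.cosh v))) (Real.sinh t * abelKer t u * abelKer t v) t := by
  have h1 : Real.cosh v < Real.cosh t := by
    rw [Real.cosh_lt_cosh, abs_of_nonneg hv, abs_of_pos (hv.trans_lt hvt)]; exact hvt
  have h2 : Real.cosh t < Real.cosh u := by
    rw [Real.cosh_lt_cosh, abs_of_pos (hv.trans_lt hvt), abs_of_pos (by linarith)]; exact htu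
  rw [abelKer, abelKer, abs_of_neg (by linarith : Real.cosh t - Real.cosh u < 0),
    abs_of_pos (by linarith : 0 < Real.cosh t - Real.cosh v), neg_sub]
  have hA : 0 < Real.cosh u - Real.cosh v := by linarith
  have hx1 : (2 * Real.cosh t - Real.cosh u - Real.cosh v) / (Real.cosh u - Real.cosh v) ≠ -1 := by
    rw [Ne, div_eq_iff hA.ne']; intro h; linarith
  have hx2 : (2 * Real.cosh t - Real.cosh u - Real.cosh v) / (Real.cosh u - Real.cosh v) ≠ 1 := by
    rw [Ne, div_eq_iff hA.ne']; intro h; linarith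
  have h := (Real.hasDerivAt_arcsin hx1 hx2).comp t
    (((((Real.hasDerivAt_cosh t).const_mul 2).sub_const (Real.cosh u)).sub_const
      (Real.cosh v)).div_const (Real.cosh u - Real.cosh v))
  refine h.congr_deriv ?_
  have h3 : 1 - ((2 * Real.cosh t - Real.cosh u - Real.cosh v) / (Real.cosh u - Real.cosh v)) ^ 2 =
      ((Real.cosh u - Real.cosh t) * (Real.cosh t - Real.cosh v)) *
        (2 / (Real.cosh u - Real.cosh v)) ^ 2 := by
    field_simp
    ring
  rw [h3, Real.sqrt_mul' _ (by positivity), Real.sqrt_sq (by positivity),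
    Real.sqrt_mul (by linarith)]
  have h4 : 0 < √(Real.cosh u - Real.cosh t) := Real.sqrt_pos.2 (by linarith)
  have h5 : 0 < √(Real.cosh t - Real.cosh v) := Real.sqrt_pos.2 (by linarith)
  field_simp

theorem continuous_arcsin_cosh (u v : ℝ) :
    Continuous (fun t => Real.arcsin ((2 * Real.cosh t - Real.cosh u - Real.cosh v) /
      (Real.cosh u - Real.cosh v))) :=
  Real.continuous_arcsin.comp (by fun_prop)

theorem intervalIntegrable_sinh_mul_abelKer {u v : ℝ} (hv : 0 ≤ v) (hvu : v < u) :
    IntervalIntegrable (fun t => Real.sinh t * abelKer t u * abelKer t v) volume v u := by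
  rw [intervalIntegrable_iff_integrableOn_Ioc_of_le hvu.le]
  refine intervalIntegral.integrableOn_deriv_of_nonneg
    (continuous_arcsin_cosh u v).continuousOn
    (fun t ht => hasDerivAt_arcsin_cosh hv ht.1 ht.2) fun t ht => ?_
  have := Real.sinh_pos_iff.2 (hv.trans_lt ht.1)
  exact mul_nonneg (mul_nonneg this.le (abelKer_nonneg _ _)) (abelKer_nonneg _ _)

theorem integral_sinh_mul_abelKer {u v : ℝ} (hv : 0 ≤ v) (hvu : v < u) :
    ∫ t in Set.Ioo v u, Real.sinh t * abelKer t u * abelKer t v = π := by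
  rw [← integral_Ioc_eq_integral_Ioo, ← intervalIntegral.integral_of_le hvu.le,
    intervalIntegral.integral_eq_sub_of_hasDerivAt_of_le hvu.le
    (continuous_arcsin_cosh u v).continuousOn
    (fun t ht => hasDerivAt_arcsin_cosh hv ht.1 ht.2) (intervalIntegrable_sinh_mul_abelKer hv hvu)]
  have h1 : Real.cosh v < Real.cosh u := by
    rw [Real.cosh_lt_cosh, abs_of_nonneg hv, abs_of_pos (hv.trans_lt hvu)]; exact hvu
  have hA : Real.cosh u - Real.cosh v ≠ 0 := by linarith
  rw [show (2 * Real.cosh u - Real.cosh u - Real.cosh v) = Real.cosh u - Real.cosh v by ring,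
    show (2 * Real.cosh v - Real.cosh u - Real.cosh v) = -(Real.cosh u - Real.cosh v) by ring,
    neg_div, div_self hA, Real.arcsin_neg, Real.arcsin_one]
  ring

theorem measurable_abelKer_comp {α : Type*} [MeasurableSpace α] {f g : α → ℝ} (hf : Measurable f)
    (hg : Measurable g) : Measurable fun x => abelKer (f x) (g x) := by
  unfold abelKer
  fun_prop

/-- The integrand of the iterated Abel transform. -/
def abelInt (S : ℝ → ℝ) (s : ℝ) (p : ℝ × ℝ × ℝ) : ℝ :=
  (Set.Ioo 0 p.1).indicator (fun v => Real.cos (s * v) * abelKer p.1 v) p.2.2 *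
    (Real.sinh p.1 * (Set.Ioi p.1).indicator (fun u => S u * abelKer p.1 u) p.2.1)

theorem abelInt_eq (S : ℝ → ℝ) (s t u v : ℝ) : abelInt S s (t, u, v) =
    if 0 < v ∧ v < u then (Set.Ioo v u).indicator
      (fun t => (Real.sinh t * abelKer t u * abelKer t v) * (S u * Real.cos (s * v))) t else 0 := by
  simp only [abelInt, Set.indicator_apply, Set.mem_Ioo, Set.mem_Ioi]
  split_ifs <;> first | (exfalso; grind) | grind

theorem measurable_abelInt {S : ℝ → ℝ} (hS : Measurable S) (s : ℝ) : Measurable (abelInt S s) := by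
  have h1 : Measurable fun p : ℝ × ℝ × ℝ => abelKer p.1 p.2.2 :=
    measurable_abelKer_comp (by fun_prop) (by fun_prop)
  have h2 : Measurable fun p : ℝ × ℝ × ℝ => abelKer p.1 p.2.1 :=
    measurable_abelKer_comp (by fun_prop) (by fun_prop)
  have h3 : Measurable fun p : ℝ × ℝ × ℝ => S p.2.1 := hS.comp measurable_snd.fst
  have e : abelInt S s = fun p => (if 0 < p.2.2 ∧ p.2.2 < p.1 then Real.cos (s * p.2.2) *
      abelKer p.1 p.2.2 else 0) * (Real.sinh p.1 * if p.1 < p.2.1 then S p.2.1 * abelKer p.1 p.2.1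
      else 0) := by
    ext p
    simp [abelInt, Set.indicator_apply]
  rw [e]
  have e1 : MeasurableSet {p : ℝ × ℝ × ℝ | 0 < p.2.2 ∧ p.2.2 < p.1} :=
    (measurableSet_lt measurable_const measurable_snd.snd).inter
      (measurableSet_lt measurable_snd.snd measurable_fst)
  have e2 : MeasurableSet {p : ℝ × ℝ × ℝ | p.1 < p.2.1} :=
    measurableSet_lt (by fun_prop) (by fun_prop)
  exact (Measurable.ite e1 (by fun_prop) measurable_const).mul
    (Measurable.mul (by fun_prop) (Measurable.ite e2 (by fun_prop) measurable_const))

theorem integral_norm_abelInt (S : ℝ → ℝ) (s u v : ℝ) :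
    ∫ t, ‖abelInt S s (t, u, v)‖ = if 0 < v ∧ v < u then π * ‖S u * Real.cos (s * v)‖ else 0 := by
  simp only [abelInt_eq]
  split_ifs with h
  · simp only [norm_indicator_eq_indicator_norm]
    rw [integral_indicator measurableSet_Ioo, ← integral_sinh_mul_abelKer h.1.le h.2,
      ← integral_mul_const]
    refine setIntegral_congr_fun measurableSet_Ioo fun t ht => ?_
    have := Real.sinh_pos_iff.2 (h.1.trans ht.1)
    rw [norm_mul, Real.norm_of_nonneg
      (mul_nonneg (mul_nonneg this.le (abelKer_nonneg _ _)) (abelKer_nonneg _ _))]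
  · simp

theorem integral_abelInt (S : ℝ → ℝ) (s u v : ℝ) :
    ∫ t, abelInt S s (t, u, v) = if 0 < v ∧ v < u then π * (S u * Real.cos (s * v)) else 0 := by
  simp only [abelInt_eq]
  split_ifs with h
  · rw [integral_indicator measurableSet_Ioo, ← integral_sinh_mul_abelKer h.1.le h.2,
      ← integral_mul_const]
  · simp

theorem integrable_abelInt_left (S : ℝ → ℝ) (s u v : ℝ) :
    Integrable fun t => abelInt S s (t, u, v) := by
  simp only [abelInt_eq]
  split_ifs with h
  · refine IntegrableOn.integrable_indicator ?_ measurableSet_Ioo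
    exact Integrable.mul_const (((intervalIntegrable_iff_integrableOn_Ioo_of_le h.2.le).1
      (intervalIntegrable_sinh_mul_abelKer h.1.le h.2))) _
  · exact integrable_zero _ _ _

theorem integrable_triangle {S : ℝ → ℝ} (hS : Measurable S)
    (hi : IntegrableOn (fun u => u * S u) (Set.Ioi 0)) {c : ℝ → ℝ} (hc : Measurable c)
    (hc' : ∀ v, |c v| ≤ 1) :
    Integrable fun p : ℝ × ℝ => if 0 < p.2 ∧ p.2 < p.1 then S p.1 * c p.2 else 0 := by
  have hm : Measurable fun p : ℝ × ℝ => if 0 < p.2 ∧ p.2 < p.1 then S p.1 * c p.2 else 0 :=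
    Measurable.ite ((measurableSet_lt measurable_const measurable_snd).inter
      (measurableSet_lt measurable_snd measurable_fst))
      ((hS.comp measurable_fst).mul (hc.comp measurable_snd)) measurable_const
  have hbd : ∀ u v : ℝ, ‖(if 0 < v ∧ v < u then S u * c v else 0)‖ ≤
      (Set.Ioo 0 u).indicator (fun _ => |S u|) v := by
    intro u v
    by_cases h : 0 < v ∧ v < u
    · rw [if_pos h, Set.indicator_of_mem (show v ∈ Set.Ioo 0 u from h), norm_mul]
      exact mul_le_of_le_one_right (abs_nonneg _) (hc' v)
    · rw [if_neg h, Set.indicator_of_notMem (show v ∉ Set.Ioo 0 u from h), norm_zero]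
  have hind : ∀ u, Integrable ((Set.Ioo 0 u).indicator (fun _ => |S u|)) := fun u =>
    IntegrableOn.integrable_indicator (integrableOn_const (by simp)) measurableSet_Ioo
  rw [Measure.volume_eq_prod, integrable_prod_iff hm.aestronglyMeasurable]
  have hint : ∀ u, Integrable fun v => if 0 < v ∧ v < u then S u * c v else 0 := fun u =>
    (hind u).mono' (hm.comp measurable_prodMk_left).aestronglyMeasurable
      (Filter.Eventually.of_forall (hbd u))
  refine ⟨Filter.Eventually.of_forall hint, ?_⟩
  refine (IntegrableOn.integrable_indicator (f := fun u => ‖u * S u‖) hi.norm measurableSet_Ioi).mono'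
    (hm.aestronglyMeasurable.norm.integral_prod_right') (Filter.Eventually.of_forall fun u => ?_)
  rw [Real.norm_of_nonneg (integral_nonneg fun _ => norm_nonneg _)]
  refine (integral_mono (hint u).norm (hind u) (hbd u)).trans ?_
  rw [integral_indicator measurableSet_Ioo, setIntegral_const, Set.indicator_apply, smul_eq_mul]
  split_ifs with h
  · rw [norm_mul, Real.norm_eq_abs, Real.norm_eq_abs, abs_of_pos (show 0 < u from h)]
    simp [(Set.mem_Ioi.1 h).le]
  · have : u ≤ 0 := not_lt.1 h
    simp [this]

theorem integrable_abelInt {S : ℝ → ℝ} (hS : Measurable S)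
    (hi : IntegrableOn (fun u => u * S u) (Set.Ioi 0)) (s : ℝ) :
    Integrable (abelInt S s) (volume.prod volume) := by
  rw [integrable_prod_iff' (measurable_abelInt hS s).aestronglyMeasurable]
  refine ⟨Filter.Eventually.of_forall fun p => integrable_abelInt_left S s p.1 p.2, ?_⟩
  have := ((integrable_triangle hS hi (c := fun v => Real.cos (s * v)) (by fun_prop)
    (fun v => Real.abs_cos_le_one _)).norm.const_mul π)
  refine this.congr (Filter.Eventually.of_forall fun p => ?_)
  simp only []
  rw [integral_norm_abelInt S s p.1 p.2]
  split_ifs <;> simp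

theorem integral_abelInt_right (S : ℝ → ℝ) (s t : ℝ) : ∫ p, abelInt S s (t, p) =
    (∫ v in Set.Ioo 0 t, Real.cos (s * v) * abelKer t v) *
      (Real.sinh t * ∫ u in Set.Ioi t, S u * abelKer t u) := by
  rw [← integral_indicator measurableSet_Ioo, ← integral_indicator measurableSet_Ioi,
    ← integral_const_mul, Measure.volume_eq_prod, mul_comm, ← integral_prod_mul]
  refine integral_congr_ae (Filter.Eventually.of_forall fun p => ?_)
  simp only [abelInt]
  ring

theorem integrable_abel {S : ℝ → ℝ} (hS : Measurable S)
    (hi : IntegrableOn (fun u => u * S u) (Set.Ioi 0)) (s : ℝ) :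
    Integrable fun t => (∫ v in Set.Ioo 0 t, Real.cos (s * v) * abelKer t v) *
      (Real.sinh t * ∫ u in Set.Ioi t, S u * abelKer t u) := by
  have := (integrable_abelInt hS hi s).integral_prod_left
  simpa only [integral_abelInt_right] using this

theorem integral_abel {S : ℝ → ℝ} (hS : Measurable S)
    (hi : IntegrableOn (fun u => u * S u) (Set.Ioi 0)) (s : ℝ) :
    ∫ t in Set.Ioi 0, (∫ v in Set.Ioo 0 t, Real.cos (s * v) * abelKer t v) *
      (Real.sinh t * ∫ u in Set.Ioi t, S u * abelKer t u) =
    π * ∫ u in Set.Ioi 0, S u * ∫ v in Set.Ioo 0 u, Real.cos (s * v) := by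
  have h0 : (Set.Ioi (0 : ℝ)).indicator (fun t => (∫ v in Set.Ioo 0 t, Real.cos (s * v) * abelKer t v) *
      (Real.sinh t * ∫ u in Set.Ioi t, S u * abelKer t u)) = fun t => ∫ p, abelInt S s (t, p) := by
    ext t
    rw [integral_abelInt_right, Set.indicator_apply]
    split_ifs with h
    · rfl
    · rw [Set.Ioo_eq_empty (by simpa using h)]; simp
  have hg := integrable_abelInt hS hi s
  have ht := integrable_triangle hS hi (c := fun v => Real.cos (s * v)) (by fun_prop)
    (fun v => Real.abs_cos_le_one _)
  rw [← integral_indicator measurableSet_Ioi, h0, ← integral_prod _ hg, integral_prod_symm _ hg]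
  have e : ∀ p : ℝ × ℝ, ∫ t, abelInt S s (t, p) =
      π * if 0 < p.2 ∧ p.2 < p.1 then S p.1 * Real.cos (s * p.2) else 0 := by
    intro p
    rw [show p = (p.1, p.2) from rfl, integral_abelInt]
    split_ifs <;> simp
  simp only [e]
  rw [integral_const_mul, Measure.volume_eq_prod, integral_prod _ (by rwa [← Measure.volume_eq_prod]),
    ← integral_indicator measurableSet_Ioi]
  congr 2
  ext u
  rw [Set.indicator_apply]
  split_ifs with h
  · rw [← integral_const_mul, ← integral_indicator measurableSet_Ioo]
    congr 1
    ext v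
    simp [Set.indicator_apply]
  · have : ∀ v, ¬ (0 < v ∧ v < u) := fun v hv => h (hv.1.trans hv.2)
    simp [this]

/-- The sine transform. -/
def sineT (q : ℝ → ℝ) (u : ℝ) : ℝ := ∫ r, q r * Real.sin (r * u)

open FourierTransform in
theorem fourier_odd {q : ℝ → ℝ} (hq : Integrable q) (ξ : ℝ) :
    𝓕 (fun r => ((q r - q (-r) : ℝ) : ℂ)) ξ = -2 * I * sineT q (2 * π * ξ) := by
  have hq' : Integrable fun r => (q r : ℂ) := hq.ofReal
  have h1 : Integrable fun r : ℝ => Complex.exp (↑(-2 * π * r * ξ) * I) * q r := by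
    refine hq'.bdd_mul (c := 1) (by fun_prop) (Filter.Eventually.of_forall fun r => ?_)
    rw [Complex.norm_exp_ofReal_mul_I]
  have h2 : Integrable fun r : ℝ => Complex.exp (↑(2 * π * r * ξ) * I) * q r := by
    refine hq'.bdd_mul (c := 1) (by fun_prop) (Filter.Eventually.of_forall fun r => ?_)
    rw [Complex.norm_exp_ofReal_mul_I]
  have h3 : ∀ r : ℝ, Complex.exp (↑(-2 * π * r * ξ) * I) * q (-r) =
      (fun r : ℝ => Complex.exp (↑(2 * π * r * ξ) * I) * q r) (-r) := fun r => by
    simp only []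
    congr 3
    push_cast; ring
  rw [Real.fourier_real_eq_integral_exp_smul]
  simp only [smul_eq_mul, Complex.ofReal_sub, mul_sub]
  rw [integral_sub h1 (by simp only [h3]; exact h2.comp_neg)]
  simp only [h3]
  rw [integral_neg_eq_self (fun r : ℝ => Complex.exp (↑(2 * π * r * ξ) * I) * q r), ← integral_sub h1 h2,
    sineT, ← integral_complex_ofReal, ← integral_const_mul]
  congr 1
  ext r
  have e1 : -2 * π * r * ξ = -(r * (2 * π * ξ)) := by ring
  have e2 : 2 * π * r * ξ = r * (2 * π * ξ) := by ring
  rw [e1, e2, Complex.exp_mul_I, Complex.exp_mul_I, ← Complex.ofReal_cos, ← Complex.ofReal_sin,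
    ← Complex.ofReal_cos, ← Complex.ofReal_sin, Real.cos_neg, Real.sin_neg]
  push_cast
  ring

theorem sineT_neg (q : ℝ → ℝ) (u : ℝ) : sineT q (-u) = - sineT q u := by
  simp [sineT, integral_neg]

theorem measurable_sineT {q : ℝ → ℝ} (hq : Measurable q) : Measurable (sineT q) := by
  have : Measurable fun p : ℝ × ℝ => q p.2 * Real.sin (p.2 * p.1) := by fun_prop
  exact this.stronglyMeasurable.integral_prod_right'.measurable

/-- The odd part of a test function, as a Schwartz function. -/
def oddSchwartz (q : ℝ → ℝ) (hq : ContDiff ℝ (⊤ : ℕ∞) q) (hc : HasCompactSupport q) :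
    SchwartzMap ℝ ℂ :=
  HasCompactSupport.toSchwartzMap (f := fun r => ((q r - q (-r) : ℝ) : ℂ))
    ((hc.sub (hc.comp_homeomorph (Homeomorph.neg ℝ))).comp_left (g := fun x : ℝ => (x : ℂ)) (by simp))
    (Complex.ofRealCLM.contDiff.comp (hq.sub (hq.comp contDiff_neg)))

open FourierTransform in
theorem fourier_oddSchwartz {q : ℝ → ℝ} (hq : ContDiff ℝ (⊤ : ℕ∞) q) (hc : HasCompactSupport q) (ξ : ℝ) :
    𝓕 (oddSchwartz q hq hc) ξ = -2 * I * sineT q (2 * π * ξ) := by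
  rw [← fourier_odd (hq.continuous.integrable_of_hasCompactSupport hc)]
  rfl

open FourierTransform in
theorem integrable_pow_mul_sineT {q : ℝ → ℝ} (hq : ContDiff ℝ (⊤ : ℕ∞) q) (hc : HasCompactSupport q)
    (k : ℕ) : Integrable fun u => u ^ k * sineT q u := by
  have h := (𝓕 (oddSchwartz q hq hc)).integrable_pow_mul volume k
  have hm : Measurable fun u => u ^ k * sineT q u :=
    (by fun_prop : Measurable fun u : ℝ => u ^ k).mul (measurable_sineT hq.continuous.measurable)
  have h2 : Integrable fun ξ => (fun u => u ^ k * sineT q u) ((2 * π) * ξ) := by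
    refine (h.const_mul ((2 * π) ^ k)).mono' (hm.comp (by fun_prop)).aestronglyMeasurable
      (Filter.Eventually.of_forall fun ξ => ?_)
    rw [fourier_oddSchwartz]
    have := Real.pi_pos
    simp only [norm_mul, norm_pow, Complex.norm_I, norm_neg, Complex.norm_real, mul_one]
    rw [Real.norm_of_nonneg this.le]
    simp only [Real.norm_eq_abs, abs_two, Complex.norm_ofNat, mul_pow]
    have h3 : 0 ≤ 2 ^ k * π ^ k * |ξ| ^ k * |sineT q (2 * π * ξ)| := by positivity
    linarith
  exact (integrable_comp_mul_left_iff _ (by positivity)).1 h2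

open FourierTransform in
theorem integral_sineT_mul_sin {q : ℝ → ℝ} (hq : ContDiff ℝ (⊤ : ℕ∞) q) (hc : HasCompactSupport q)
    (s : ℝ) : ∫ u in Set.Ioi 0, sineT q u * Real.sin (s * u) = π / 2 * (q s - q (-s)) := by
  have h0 : 𝓕⁻ (𝓕 (oddSchwartz q hq hc)) s = ((q s - q (-s) : ℝ) : ℂ) := by
    rw [FourierTransform.fourierInv_fourier_eq]
    rfl
  have hint := integrable_pow_mul_sineT hq hc 0
  simp only [pow_zero, one_mul] at hint
  have hS : Measurable (sineT q) := measurable_sineT hq.continuous.measurable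
  have h1 : Integrable fun v : ℝ => Complex.exp (↑(-2 * π * v * -s) * I) *
      (-2 * I * sineT q (2 * π * v)) := by
    refine Integrable.bdd_mul (c := 1) ?_ (by fun_prop) (Filter.Eventually.of_forall fun r => ?_)
    · exact ((hint.comp_mul_left' (by positivity)).ofReal).const_mul _
    · rw [Complex.norm_exp_ofReal_mul_I]
  rw [SchwartzMap.fourierInv_coe, Real.fourierInv_eq_fourier_neg,
    Real.fourier_real_eq_integral_exp_smul] at h0
  simp only [fourier_oddSchwartz, smul_eq_mul] at h0
  have h2 := congrArg Complex.re h0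
  have e1 := integral_re h1
  simp only [RCLike.re_eq_complex_re] at e1
  rw [← e1, Complex.ofReal_re] at h2
  have e2 : ∀ v : ℝ, (Complex.exp (↑(-2 * π * v * -s) * I) * (-2 * I * sineT q (2 * π * v))).re =
      (fun u => 2 * (sineT q |u| * Real.sin (s * |u|))) (2 * π * v) := by
    intro v
    have e3 : -2 * π * v * -s = s * (2 * π * v) := by ring
    have e4 : ∀ u, sineT q |u| * Real.sin (s * |u|) = sineT q u * Real.sin (s * u) := fun u => by
      rcases abs_choice u with h | h <;> rw [h]
      rw [sineT_neg, mul_neg, Real.sin_neg, neg_mul_neg]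
    simp only [e4]
    rw [e3, Complex.exp_mul_I, ← Complex.ofReal_cos, ← Complex.ofReal_sin]
    generalize Real.cos (s * (2 * π * v)) = c
    generalize Real.sin (s * (2 * π * v)) = d
    simp
    ring
  simp only [e2] at h2
  rw [Measure.integral_comp_mul_left (fun u => 2 * (sineT q |u| * Real.sin (s * |u|))),
    integral_comp_abs (f := fun u => 2 * (sineT q u * Real.sin (s * u))),
    integral_const_mul, abs_of_pos (by positivity), smul_eq_mul] at h2
  rw [← h2]
  field_simp

/-- The Plancherel density. -/
def plm (r : ℝ) : ℝ := (2 * π)⁻¹ * r * Real.tanh (π * r)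

/-- The inverse spherical transform. -/
def invSph (f : ℝ → ℝ) (v : ℂ) : ℂ := ∫ r, ((f r * plm r : ℝ) : ℂ) * sph r v

theorem measurable_plm : Measurable plm := by
  unfold plm
  have : Measurable fun r : ℝ => Real.tanh (π * r) := measurable_tanh.comp (by fun_prop)
  fun_prop

@[fun_prop]
theorem measurable_pwave_comp {α : Type*} [MeasurableSpace α] {r : α → ℝ} {z b : α → ℂ}
    (hr : Measurable r) (hz : Measurable z) (hb : Measurable b) :
    Measurable fun x => pwave (r x) (z x) (b x) := by
  unfold pwave Pk
  exact Measurable.pow (by fun_prop) (by fun_prop)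

@[fun_prop]
theorem measurable_sph_comp {α : Type*} [MeasurableSpace α] {r : α → ℝ} {z : α → ℂ}
    (hr : Measurable r) (hz : Measurable z) : Measurable fun x => sph (r x) (z x) := by
  have h : Measurable fun p : α × ℂ => pwave (r p.1) (z p.1) p.2 := by fun_prop
  exact h.stronglyMeasurable.integral_prod_right'.measurable

theorem measurable_invSph {f : ℝ → ℝ} (hf : Measurable f) : Measurable (invSph f) := by
  have h1 := measurable_plm
  have h : Measurable fun p : ℂ × ℝ => ((f p.2 * plm p.2 : ℝ) : ℂ) * sph p.2 p.1 := by
    fun_prop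
  exact h.stronglyMeasurable.integral_prod_right'.measurable

theorem integrable_of_smooth {f : ℝ → ℝ} (hf : ContDiff ℝ (⊤ : ℕ∞) f) (hc : HasCompactSupport f) :
    Integrable f := hf.continuous.integrable_of_hasCompactSupport hc

theorem invSph_tanh {f : ℝ → ℝ} (hf : ContDiff ℝ (⊤ : ℕ∞) f) (hc : HasCompactSupport f)
    {t : ℝ} (ht : 0 < t) : invSph f (Real.tanh (t / 2)) =
    ((√2 / (2 * π ^ 2) * ∫ u in Set.Ioi t, sineT (fun r => r * f r) u * abelKer t u : ℝ) : ℂ) := by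
  have h1 : ∀ r, ((f r * plm r : ℝ) : ℂ) * sph r (Real.tanh (t / 2)) =
      ((√2 / (2 * π ^ 2) * ∫ u in Set.Ioi t, r * f r * (Real.sin (r * u) * abelKer t u) : ℝ) : ℂ) := by
    intro r
    rw [sph_tanh_eq_integral_cos r ht, ← Complex.ofReal_mul, integral_const_mul,
      integral_sin_mul_abelKer r ht, plm]
    congr 1
    have := Real.pi_pos
    field_simp
  rw [invSph]
  simp only [h1]
  have hq : Integrable fun r => r * f r := integrable_of_smooth (contDiff_id.mul hf) hc.mul_left
  have hm : Measurable fun p : ℝ × ℝ => p.1 * f p.1 * (Real.sin (p.1 * p.2) * abelKer t p.2) := by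
    have h1 := measurable_abelKer_right t
    have h2 := hf.continuous.measurable
    fun_prop
  have hint : Integrable (fun p : ℝ × ℝ => p.1 * f p.1 * (Real.sin (p.1 * p.2) * abelKer t p.2))
      (volume.prod (volume.restrict (Set.Ioi t))) := by
    refine (hq.norm.mul_prod (integrableOn_abelKer_Ioi ht)).mono' hm.aestronglyMeasurable
      (Filter.Eventually.of_forall fun p => ?_)
    rw [norm_mul (p.1 * f p.1), norm_mul (Real.sin _), Real.norm_of_nonneg (abelKer_nonneg t p.2)]
    gcongr
    exact mul_le_of_le_one_left (abelKer_nonneg t _) (Real.abs_sin_le_one _)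
  rw [integral_complex_ofReal, integral_const_mul, integral_integral_swap hint]
  congr 3
  ext u
  rw [sineT, ← integral_mul_const]
  congr 1
  ext r
  ring

theorem integrable_sineT_mul_self {f : ℝ → ℝ} (hf : ContDiff ℝ (⊤ : ℕ∞) f) (hc : HasCompactSupport f) :
    IntegrableOn (fun u => u * sineT (fun r => r * f r) u) (Set.Ioi 0) := by
  have := (integrable_pow_mul_sineT (q := fun r => r * f r) (contDiff_id.mul hf) hc.mul_left 1).integrableOn
    (s := Set.Ioi 0)
  simpa using this

theorem invSph_mul_sph_tanh {f : ℝ → ℝ} (hf : ContDiff ℝ (⊤ : ℕ∞) f) (hc : HasCompactSupport f)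
    (s : ℝ) {t : ℝ} (ht : 0 < t) :
    (2 * π * Real.sinh t : ℝ) • (invSph f (Real.tanh (t / 2)) * sph s (Real.tanh (t / 2))) =
    ((2 / π ^ 2 * ((∫ v in Set.Ioo 0 t, Real.cos (s * v) * abelKer t v) *
      (Real.sinh t * ∫ u in Set.Ioi t, sineT (fun r => r * f r) u * abelKer t u)) : ℝ) : ℂ) := by
  rw [invSph_tanh hf hc ht, sph_tanh_eq_integral_cos s ht, Complex.real_smul, ← Complex.ofReal_mul,
    ← Complex.ofReal_mul]
  congr 1
  have h2 : √2 * √2 = 2 := Real.mul_self_sqrt (by norm_num)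
  have := Real.pi_pos
  generalize (∫ v in Set.Ioo 0 t, Real.cos (s * v) * abelKer t v) = C
  generalize (∫ u in Set.Ioi t, sineT (fun r => r * f r) u * abelKer t u) = S
  field_simp
  linear_combination (S * C) * h2

theorem integrable_invSph_mul_sph {f : ℝ → ℝ} (hf : ContDiff ℝ (⊤ : ℕ∞) f) (hc : HasCompactSupport f)
    (s : ℝ) : Integrable (fun t : ℝ => invSph f (Real.tanh (t / 2)) * sph s (Real.tanh (t / 2)))
      radialVol := by
  rw [radialVol, integrable_withDensity_iff_integrable_smul' (by fun_prop) (by simp)]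
  have hi := integrable_abel (measurable_sineT (contDiff_id.mul hf).continuous.measurable)
    (integrable_sineT_mul_self hf hc) s
  refine IntegrableOn.congr_fun (f := fun t => ((2 / π ^ 2 *
    ((∫ v in Set.Ioo 0 t, Real.cos (s * v) * abelKer t v) *
      (Real.sinh t * ∫ u in Set.Ioi t, sineT (fun r => r * f r) u * abelKer t u)) : ℝ) : ℂ))
    (hi.const_mul (2 / π ^ 2)).ofReal.integrableOn (fun t ht => ?_) measurableSet_Ioi
  have ht' : 0 < t := ht
  have := Real.sinh_pos_iff.2 ht'
  simp only []
  rw [← invSph_mul_sph_tanh hf hc s ht', ENNReal.toReal_ofReal (by positivity)]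

theorem integral_cos_Ioo {s : ℝ} (hs : 0 < s) {u : ℝ} (hu : 0 < u) :
    ∫ v in Set.Ioo 0 u, Real.cos (s * v) = Real.sin (s * u) / s := by
  rw [← integral_Ioc_eq_integral_Ioo, ← intervalIntegral.integral_of_le hu.le,
    intervalIntegral.integral_comp_mul_left _ hs.ne', integral_cos]
  simp [div_eq_inv_mul]

theorem integral_invSph_mul_sph {f : ℝ → ℝ} (hf : ContDiff ℝ (⊤ : ℕ∞) f) (hc : HasCompactSupport f)
    (h0 : ∀ r ≤ 0, f r = 0) {s : ℝ} (hs : 0 < s) :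
    ∫ t : ℝ, invSph f (Real.tanh (t / 2)) * sph s (Real.tanh (t / 2)) ∂radialVol = f s := by
  rw [radialVol, integral_withDensity_eq_integral_toReal_smul (by fun_prop) (by simp)]
  have hq := contDiff_id.mul hf
  have hi := integral_abel (measurable_sineT hq.continuous.measurable)
    (integrable_sineT_mul_self hf hc) s
  have h1 : ∀ t ∈ Set.Ioi (0 : ℝ), (ENNReal.ofReal (2 * π * Real.sinh t)).toReal •
      (invSph f (Real.tanh (t / 2)) * sph s (Real.tanh (t / 2))) = ((2 / π ^ 2 *
    ((∫ v in Set.Ioo 0 t, Real.cos (s * v) * abelKer t v) *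
      (Real.sinh t * ∫ u in Set.Ioi t, sineT (fun r => r * f r) u * abelKer t u)) : ℝ) : ℂ) := by
    intro t ht
    have ht' : 0 < t := ht
    have := Real.sinh_pos_iff.2 ht'
    rw [← invSph_mul_sph_tanh hf hc s ht', ENNReal.toReal_ofReal (by positivity)]
  rw [setIntegral_congr_fun measurableSet_Ioi h1, integral_complex_ofReal, integral_const_mul]
  have h2 : ∫ u in Set.Ioi 0, sineT (fun r => r * f r) u * ∫ v in Set.Ioo 0 u, Real.cos (s * v) =
      s⁻¹ * ∫ u in Set.Ioi 0, sineT (fun r => r * f r) u * Real.sin (s * u) := by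
    rw [← integral_const_mul]
    refine setIntegral_congr_fun measurableSet_Ioi fun u hu => ?_
    rw [integral_cos_Ioo hs hu]
    ring
  have h3 := integral_sineT_mul_sin (q := fun r => r * f r) hq hc.mul_left s
  simp only [h0 (-s) (by linarith), mul_zero, sub_zero] at h3
  congr 1
  have := Real.pi_pos
  refine (congrArg (2 / π ^ 2 * ·) (hi.trans (by rw [show (∫ u in Set.Ioi 0,
    sineT (fun x => id x * f x) u * ∫ v in Set.Ioo 0 u, Real.cos (s * v)) = _ from h2, h3]))).trans ?_
  field_simp

theorem invSph_mul (f : ℝ → ℝ) {v c : ℂ} (hv : ‖v‖ < 1) (hc : ‖c‖ = 1) :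
    invSph f (v * c) = invSph f v := by
  simp only [invSph, mul_comm v c, sph_mul _ hv hc]

theorem conj_invSph (f : ℝ → ℝ) {v : ℂ} (hv : ‖v‖ < 1) : conj (invSph f v) = invSph f v := by
  rw [invSph, ← integral_conj]
  simp only [map_mul, Complex.conj_ofReal, conj_sph _ hv]

theorem pwave_rotate (r : ℝ) (ρ : ℝ) {c b : ℂ} (hc : ‖c‖ = 1) :
    pwave r (ρ * c) b = pwave r ρ (conj b * c) := by
  have h : c * conj c = 1 := by rw [Complex.mul_conj, Complex.normSq_eq_norm_sq, hc]; simp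
  have hb : b = c * (conj c * b) := by rw [← mul_assoc, h, one_mul]
  conv_lhs => rw [hb, mul_comm (ρ : ℂ), pwave_mul_right r hc]
  rw [← pwave_conj]
  simp [mul_comm]

theorem norm_sph_zero {v : ℂ} (hv : ‖v‖ < 1) (r : ℝ) :
    ∫ b, ‖pwave r v b‖ ∂circleMeasure = ‖sph 0 v‖ := by
  have h0 : sph 0 v = ((∫ b, ‖pwave r v b‖ ∂circleMeasure : ℝ) : ℂ) := by
    rw [sph, ← integral_complex_ofReal]
    refine integral_congr_ae ?_
    filter_upwards [ae_norm_eq_one] with b hb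
    rw [norm_pwave r hv hb, pwave, Real.sqrt_eq_rpow, Complex.ofReal_cpow (Pk_pos hv hb).le]
    simp
  rw [h0, Complex.norm_real, Real.norm_of_nonneg (integral_nonneg fun _ => norm_nonneg _)]

theorem integrable_of_continuousOn {h : ℂ → ℂ} (hh : ContinuousOn h (Metric.sphere 0 1)) :
    Integrable h circleMeasure := by
  obtain ⟨C, hC⟩ := (isCompact_sphere (0 : ℂ) 1).exists_bound_of_continuousOn hh
  refine Integrable.of_bound hh.aestronglyMeasurable_circleMeasure C ?_
  filter_upwards [ae_norm_eq_one] with b hb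
  exact hC b (by simpa using hb)

theorem continuousOn_rotate {h : ℂ → ℂ} (hh : ContinuousOn h (Metric.sphere 0 1)) {c : ℂ}
    (hc : ‖c‖ = 1) : ContinuousOn (fun b => h (c * b)) (Metric.sphere 0 1) := by
  refine hh.comp (by fun_prop) fun b hb => ?_
  simpa [hc] using hb

theorem integral_norm_pwave_rotate (r : ℝ) {v c : ℂ} (hv : ‖v‖ < 1) (hc : ‖c‖ = 1) :
    ∫ b, ‖pwave r v (c * b)‖ ∂circleMeasure = ‖sph 0 v‖ := by
  have h := integral_circleMeasure_rotate (h := fun b => (‖pwave r v b‖ : ℂ))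
    (Complex.continuous_ofReal.comp_continuousOn (continuousOn_pwave r hv).norm) hc
  rw [integral_complex_ofReal, integral_complex_ofReal] at h
  rw [← norm_sph_zero hv r]
  exact Complex.ofReal_injective h

theorem integrable_invSph_polar {f : ℝ → ℝ} (hf : ContDiff ℝ (⊤ : ℕ∞) f) (hc : HasCompactSupport f)
    (r : ℝ) {b : ℂ} (hb : ‖b‖ = 1) : Integrable (fun p : ℝ × ℂ =>
      invSph f (Real.tanh (p.1 / 2)) * pwave r (Real.tanh (p.1 / 2)) (conj b * p.2))
      (radialVol.prod circleMeasure) := by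
  have hb' : ‖conj b‖ = 1 := by rwa [Complex.norm_conj]
  have ht : Measurable fun p : ℝ × ℂ => (Real.tanh (p.1 / 2) : ℂ) :=
    Complex.measurable_ofReal.comp (measurable_tanh.comp (by fun_prop))
  have hm : Measurable fun p : ℝ × ℂ =>
      invSph f (Real.tanh (p.1 / 2)) * pwave r (Real.tanh (p.1 / 2)) (conj b * p.2) :=
    ((measurable_invSph hf.continuous.measurable).comp ht).mul
      (measurable_pwave_comp measurable_const ht (by fun_prop))
  rw [integrable_prod_iff hm.aestronglyMeasurable]
  constructor
  · exact Filter.Eventually.of_forall fun t => (integrable_of_continuousOn (continuousOn_rotate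
      (continuousOn_pwave r (norm_tanh_half_lt_one t)) hb')).const_mul (invSph f (Real.tanh (t / 2)))
  · refine (integrable_invSph_mul_sph hf hc 0).norm.congr (Filter.Eventually.of_forall fun t => ?_)
    simp only [norm_mul]
    rw [integral_const_mul, integral_norm_pwave_rotate r (norm_tanh_half_lt_one t) hb']

theorem invSph_mul_pwave_polar (f : ℝ → ℝ) (r : ℝ) (b : ℂ) :
    (fun p : ℝ × ℂ => invSph f (Real.tanh (p.1 / 2) * p.2) * pwave r (Real.tanh (p.1 / 2) * p.2) b)
      =ᵐ[radialVol.prod circleMeasure] fun p =>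
      invSph f (Real.tanh (p.1 / 2)) * pwave r (Real.tanh (p.1 / 2)) (conj b * p.2) := by
  have h : ∀ᵐ p : ℝ × ℂ ∂(radialVol.prod circleMeasure), ‖p.2‖ = 1 :=
    Measure.quasiMeasurePreserving_snd.ae ae_norm_eq_one
  filter_upwards [h] with p hp
  rw [invSph_mul f (norm_tanh_half_lt_one _) hp, pwave_rotate r _ hp]

theorem aestronglyMeasurable_invSph_mul {f : ℝ → ℝ} (hf : ContDiff ℝ (⊤ : ℕ∞) f) (r : ℝ) (b : ℂ) :
    AEStronglyMeasurable (fun w => invSph f w * pwave r w b) hypVol :=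
  ((measurable_invSph hf.continuous.measurable).mul (by fun_prop)).aestronglyMeasurable

theorem integrable_invSph_mul_pwave {f : ℝ → ℝ} (hf : ContDiff ℝ (⊤ : ℕ∞) f)
    (hc : HasCompactSupport f) (r : ℝ) {b : ℂ} (hb : ‖b‖ = 1) :
    Integrable (fun w => invSph f w * pwave r w b) hypVol := by
  rw [← measurePreserving_polar.integrable_comp (aestronglyMeasurable_invSph_mul hf r b)]
  exact (integrable_invSph_polar hf hc r hb).congr (invSph_mul_pwave_polar f r b).symm

theorem integral_invSph_mul_pwave {f : ℝ → ℝ} (hf : ContDiff ℝ (⊤ : ℕ∞) f)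
    (hc : HasCompactSupport f) (h0 : ∀ r ≤ 0, f r = 0) {r : ℝ} (hr : 0 < r) {b : ℂ} (hb : ‖b‖ = 1) :
    ∫ w, invSph f w * pwave (-r) w b ∂hypVol = f r := by
  have hb' : ‖conj b‖ = 1 := by rwa [Complex.norm_conj]
  have hmp := measurePreserving_polar
  have hm := aestronglyMeasurable_invSph_mul hf (-r) b
  rw [← hmp.map_eq] at hm ⊢
  rw [integral_map hmp.aemeasurable hm, integral_congr_ae (invSph_mul_pwave_polar f (-r) b),
    integral_prod _ (integrable_invSph_polar hf hc (-r) hb), ← integral_invSph_mul_sph hf hc h0 hr]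
  congr 1
  ext t
  simp only []
  rw [integral_const_mul, integral_circleMeasure_rotate
    (continuousOn_pwave _ (norm_tanh_half_lt_one t)) hb', ← sph_neg r (norm_tanh_half_lt_one t), sph]

theorem integral_norm_invSph_mul_pwave {f : ℝ → ℝ} (hf : ContDiff ℝ (⊤ : ℕ∞) f)
    (hc : HasCompactSupport f) (r : ℝ) {b : ℂ} (hb : ‖b‖ = 1) :
    ∫ w, ‖invSph f w * pwave r w b‖ ∂hypVol =
      ∫ t : ℝ, ‖invSph f (Real.tanh (t / 2))‖ * ‖sph 0 (Real.tanh (t / 2))‖ ∂radialVol := by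
  have hb' : ‖conj b‖ = 1 := by rwa [Complex.norm_conj]
  have hmp := measurePreserving_polar
  have hm := (aestronglyMeasurable_invSph_mul hf r b).norm
  rw [← hmp.map_eq] at hm ⊢
  rw [integral_map hmp.aemeasurable hm]
  refine (integral_congr_ae ((invSph_mul_pwave_polar f r b).fun_comp norm)).trans ?_
  simp only [Function.comp_def]
  rw [integral_prod _ (integrable_invSph_polar hf hc r hb).norm]
  congr 1
  ext t
  simp only [norm_mul]
  rw [integral_const_mul, integral_norm_pwave_rotate r (norm_tanh_half_lt_one t) hb']

theorem ae_invSph_mob_mul (f : ℝ → ℝ) (r : ℝ) {z b : ℂ} (hz : ‖z‖ < 1) (hb : ‖b‖ = 1) :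
    (fun w => invSph f (mob z w) * pwave r w b) =ᵐ[hypVol] fun w => pwave r z b *
      ((fun v => invSph f v * pwave r v (mob z b)) (mob z w)) := by
  filter_upwards [ae_hypVol_norm_lt_one] with w hw
  rw [pwave_eq_mul r hz hw hb]
  ring

theorem integrable_invSph_mob_mul_pwave {f : ℝ → ℝ} (hf : ContDiff ℝ (⊤ : ℕ∞) f)
    (hc : HasCompactSupport f) (r : ℝ) {z b : ℂ} (hz : ‖z‖ < 1) (hb : ‖b‖ = 1) :
    Integrable (fun w => invSph f (mob z w) * pwave r w b) hypVol := by
  refine Integrable.congr ?_ (ae_invSph_mob_mul f r hz hb).symm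
  have h := (measurePreserving_mob hz).integrable_comp_of_integrable
    (integrable_invSph_mul_pwave hf hc r (norm_mob_eq_one hz hb))
  exact h.const_mul (pwave r z b)

theorem integral_invSph_mob_mul_pwave {f : ℝ → ℝ} (hf : ContDiff ℝ (⊤ : ℕ∞) f)
    (hc : HasCompactSupport f) (h0 : ∀ r ≤ 0, f r = 0) {r : ℝ} (hr : 0 < r) {z b : ℂ}
    (hz : ‖z‖ < 1) (hb : ‖b‖ = 1) :
    ∫ w, invSph f (mob z w) * pwave (-r) w b ∂hypVol = f r * pwave (-r) z b := by
  have hmp := measurePreserving_mob hz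
  have hm := aestronglyMeasurable_invSph_mul hf (-r) (mob z b)
  rw [integral_congr_ae (ae_invSph_mob_mul f (-r) hz hb), integral_const_mul,
    ← integral_invSph_mul_pwave hf hc h0 hr (norm_mob_eq_one hz hb), mul_comm]
  congr 1
  conv_rhs => rw [← hmp.map_eq]
  rw [integral_map hmp.aemeasurable (by rwa [hmp.map_eq])]

theorem integral_norm_invSph_mob_mul_pwave {f : ℝ → ℝ} (hf : ContDiff ℝ (⊤ : ℕ∞) f)
    (hc : HasCompactSupport f) (r : ℝ) {z b : ℂ} (hz : ‖z‖ < 1) (hb : ‖b‖ = 1) :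
    ∫ w, ‖invSph f (mob z w) * pwave r w b‖ ∂hypVol = √(Pk z b) *
      ∫ t : ℝ, ‖invSph f (Real.tanh (t / 2))‖ * ‖sph 0 (Real.tanh (t / 2))‖ ∂radialVol := by
  have hmp := measurePreserving_mob hz
  have hm := (aestronglyMeasurable_invSph_mul hf r (mob z b)).norm
  have h1 : (fun w => ‖invSph f (mob z w) * pwave r w b‖) =ᵐ[hypVol] fun w => √(Pk z b) *
      ((fun v => ‖invSph f v * pwave r v (mob z b)‖) (mob z w)) := by
    filter_upwards [ae_invSph_mob_mul f r hz hb] with w hw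
    rw [hw, norm_mul, norm_pwave r hz hb]
  rw [integral_congr_ae h1, integral_const_mul,
    ← integral_norm_invSph_mul_pwave hf hc r (norm_mob_eq_one hz hb)]
  congr 1
  conv_rhs => rw [← hmp.map_eq]
  rw [integral_map hmp.aemeasurable (by rwa [hmp.map_eq])]

theorem continuousOn_zpow_sphere (m : ℤ) :
    ContinuousOn (fun b : ℂ => b ^ m) (Metric.sphere 0 1) :=
  continuousOn_id.zpow₀ m fun b hb => Or.inl (by
    rintro h
    simp only [id] at h
    simp [h] at hb)

theorem integral_zpow_circleMeasure {m : ℤ} (hm : m ≠ 0) : ∫ b, b ^ m ∂circleMeasure = 0 := by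
  have hc : ‖Complex.exp ((π / m : ℝ) * I)‖ = 1 := Complex.norm_exp_ofReal_mul_I _
  have h := integral_circleMeasure_rotate (continuousOn_zpow_sphere m) hc
  have h1 : Complex.exp ((π / m : ℝ) * I) ^ m = -1 := by
    rw [← Complex.exp_int_mul, ← Complex.exp_pi_mul_I]
    congr 1
    push_cast
    field_simp
  simp only [mul_zpow, h1] at h
  rw [integral_const_mul] at h
  linear_combination (-1 / 2 : ℂ) * h

theorem choose_neg_ne_zero {s : ℂ} (hs : 0 < s.re) (n : ℕ) : Ring.choose (-s) n ≠ 0 := by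
  have h : (descPochhammer ℤ n).smeval (-s) ≠ 0 := by
    induction n with
    | zero => simp
    | succ n ih =>
      rw [descPochhammer_succ_right, Polynomial.smeval_mul]
      refine mul_ne_zero ih ?_
      rw [Polynomial.smeval_sub, Polynomial.smeval_X, Polynomial.smeval_natCast]
      intro h
      have := congrArg Complex.re h
      simp at this
      have : (0 : ℝ) ≤ n := Nat.cast_nonneg n
      linarith
  rw [Ring.descPochhammer_eq_factorial_smul_choose] at h
  exact fun h0 => h (by rw [h0, smul_zero])

/-- The Taylor polynomial of degree `n` of `x ↦ (1 + x) ^ (-s)`. -/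
def binomPoly (s : ℂ) (n : ℕ) (x : ℂ) : ℂ := ∑ j ∈ Finset.range (n + 1), Ring.choose (-s) j * x ^ j

theorem exists_norm_cpow_sub_binomPoly_le (s : ℂ) (n : ℕ) : ∃ C δ : ℝ, 0 < δ ∧ δ < 1 ∧
    ∀ x : ℂ, ‖x‖ ≤ δ → ‖(1 + x) ^ (-s) - binomPoly s n x‖ ≤ C * ‖x‖ ^ (n + 1) := by
  have h := (Complex.one_add_cpow_hasFPowerSeriesAt_zero (a := -s)).isBigO_sub_partialSum_pow (n + 1)
  obtain ⟨C, hC⟩ := h.bound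
  obtain ⟨ε, hε, h2⟩ := Metric.eventually_nhds_iff.1 hC
  refine ⟨C, min (ε / 2) (1 / 2), by positivity, (min_le_right _ _).trans_lt (by norm_num), ?_⟩
  intro x hx
  have h3 := h2 (y := x) (by
    rw [dist_zero_right]; exact hx.trans_lt ((min_le_left _ _).trans_lt (by linarith)))
  simpa [FormalMultilinearSeries.partialSum, binomPoly, binomialSeries, FormalMultilinearSeries.coeff_ofScalars, mul_comm] using h3

theorem pwave_ofReal_eq (r : ℝ) {ρ : ℝ} (h0 : 0 ≤ ρ) (h1 : ρ < 1) {b : ℂ} (hb : ‖b‖ = 1) :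
    pwave r ρ b = ((1 - ρ ^ 2 : ℝ) : ℂ) ^ ((1 : ℂ) / 2 + I * r) *
      ((1 + (-ρ * b)) ^ (-((1 : ℂ) / 2 + I * r)) * (1 + (-ρ * conj b)) ^ (-((1 : ℂ) / 2 + I * r))) := by
  have hx : ∀ b : ℂ, ‖b‖ = 1 → 1 + (-ρ * b) ∈ slitPlane := fun b hb => by
    refine Complex.mem_slitPlane_of_norm_lt_one ?_
    rw [norm_mul, hb, norm_neg, Complex.norm_real, Real.norm_of_nonneg h0, mul_one]
    exact h1
  have hx1 := hx b hb
  have hx0 := slitPlane_ne_zero hx1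
  have hconj : 1 + (-ρ * conj b) = conj (1 + (-ρ * b)) := by simp
  have hn : ‖(ρ : ℂ) - b‖ = ‖1 + (-ρ * b)‖ := by
    rw [← norm_one_sub_conj_mul hb, Complex.conj_ofReal, neg_mul, sub_eq_add_neg]
  have hy := norm_pos_iff.2 hx0
  have hlog : Complex.log (conj (1 + (-ρ * b))) = conj (Complex.log (1 + (-ρ * b))) :=
    Complex.log_conj _ (mem_slitPlane_iff_arg.1 hx1).1
  have hre : Complex.log (1 + (-ρ * b)) + conj (Complex.log (1 + (-ρ * b))) =
      ((2 * Real.log ‖1 + (-ρ * b)‖ : ℝ) : ℂ) := by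
    rw [Complex.add_conj, Complex.log_re]
  have hP : Pk ρ b = (1 - ρ ^ 2) * (‖1 + (-ρ * b)‖ ^ 2)⁻¹ := by
    rw [Pk, hn, Complex.norm_real, Real.norm_of_nonneg h0, div_eq_mul_inv]
  have h4 : (((‖1 + (-ρ * b)‖ ^ 2)⁻¹ : ℝ) : ℂ) ≠ 0 :=
    Complex.ofReal_ne_zero.2 (inv_ne_zero (pow_ne_zero _ hy.ne'))
  rw [hconj, pwave, hP, Complex.ofReal_mul, Complex.mul_cpow_ofReal_nonneg (by nlinarith)
    (by positivity)]
  congr 1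
  rw [Complex.cpow_def_of_ne_zero h4, Complex.cpow_def_of_ne_zero hx0,
    Complex.cpow_def_of_ne_zero (by rwa [ne_eq, map_eq_zero]), ← Complex.exp_add, hlog,
    ← add_mul, hre, ← Complex.ofReal_log (by positivity), Real.log_inv, Real.log_pow]
  push_cast
  ring_nf

theorem integral_zpow_mul_binomPoly_mul (s : ℂ) (n : ℤ) (ρ : ℝ) :
    ∫ b, b ^ n * (binomPoly s n.natAbs (-ρ * b) * binomPoly s n.natAbs (-ρ * conj b)) ∂circleMeasure =
      Ring.choose (-s) n.natAbs * (-ρ) ^ n.natAbs := by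
  have h1 : ∀ b : ℂ, ‖b‖ = 1 →
      b ^ n * (binomPoly s n.natAbs (-ρ * b) * binomPoly s n.natAbs (-ρ * conj b)) =
      ∑ j ∈ Finset.range (n.natAbs + 1), ∑ k ∈ Finset.range (n.natAbs + 1),
        (Ring.choose (-s) j * Ring.choose (-s) k * (-ρ : ℂ) ^ (j + k)) * b ^ (n + j - k) := by
    intro b hb
    have hb0 : b ≠ 0 := fun h => by simp [h] at hb
    have hcb : conj b = b⁻¹ := by
      rw [Complex.inv_def, Complex.normSq_eq_norm_sq, hb]; simp
    rw [binomPoly, binomPoly, Finset.sum_mul_sum, Finset.mul_sum]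
    refine Finset.sum_congr rfl fun j _ => ?_
    rw [Finset.mul_sum]
    refine Finset.sum_congr rfl fun k _ => ?_
    rw [hcb, zpow_sub₀ hb0, zpow_add₀ hb0, mul_pow, mul_pow, pow_add, zpow_natCast, zpow_natCast,
      inv_pow]
    ring
  rw [integral_congr_ae (ae_norm_eq_one.mono h1), integral_finsetSum]
  swap
  · exact fun j _ => integrable_finsetSum _ fun k _ =>
      (integrable_of_continuousOn (continuousOn_zpow_sphere _)).const_mul _
  have h2 : ∀ j k : ℕ, ∫ b, (Ring.choose (-s) j * Ring.choose (-s) k * (-ρ : ℂ) ^ (j + k)) *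
      b ^ (n + j - k) ∂circleMeasure =
      if n + j - k = 0 then Ring.choose (-s) j * Ring.choose (-s) k * (-ρ : ℂ) ^ (j + k) else 0 := by
    intro j k
    rw [integral_const_mul]
    split_ifs with h
    · simp [h]
    · rw [integral_zpow_circleMeasure h, mul_zero]
  have h3 : ∀ j ∈ Finset.range (n.natAbs + 1), ∫ b, ∑ k ∈ Finset.range (n.natAbs + 1),
      (Ring.choose (-s) j * Ring.choose (-s) k * (-ρ : ℂ) ^ (j + k)) * b ^ (n + j - k) ∂circleMeasure =
      ∑ k ∈ Finset.range (n.natAbs + 1),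
      if n + j - k = 0 then Ring.choose (-s) j * Ring.choose (-s) k * (-ρ : ℂ) ^ (j + k) else 0 := by
    intro j _
    rw [integral_finsetSum]
    · simp only [h2]
    · exact fun k _ => (integrable_of_continuousOn (continuousOn_zpow_sphere _)).const_mul _
  rw [Finset.sum_congr rfl h3]
  rcases le_total 0 n with hn | hn
  · rw [Finset.sum_eq_single 0, Finset.sum_eq_single n.natAbs]
    · rw [if_pos (by lia)]; simp
    · intro k _ hk; rw [if_neg (by lia)]
    · intro h; simp at h
    · intro j _ hj
      refine Finset.sum_eq_zero fun k hk => if_neg ?_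
      rw [Finset.mem_range] at hk; lia
    · intro h; simp at h
  · rw [Finset.sum_eq_single n.natAbs, Finset.sum_eq_single 0]
    · rw [if_pos (by lia)]; simp
    · intro k _ hk; rw [if_neg (by lia)]
    · intro h; simp at h
    · intro j hj' hj
      refine Finset.sum_eq_zero fun k hk => if_neg ?_
      rw [Finset.mem_range] at hk hj'; lia
    · intro h; simp at h

theorem exists_integral_zpow_mul_pwave_ne_zero (r : ℝ) (n : ℤ) :
    ∃ ρ : ℝ, 0 ≤ ρ ∧ ρ < 1 ∧ ∫ b, b ^ n * pwave r ρ b ∂circleMeasure ≠ 0 := by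
  by_contra! h
  set s : ℂ := (1 : ℂ) / 2 + I * r with hs
  set N := n.natAbs with hN
  have hsre : 0 < s.re := by simp [hs]
  obtain ⟨C, δ, hδ, hδ1, hC⟩ := exists_norm_cpow_sub_binomPoly_le s N
  have hcont : Continuous (binomPoly s N) := by unfold binomPoly; fun_prop
  obtain ⟨M, hM⟩ := (isCompact_closedBall (0 : ℂ) 1).exists_bound_of_continuousOn hcont.continuousOn
  have hM0 : 0 ≤ M := (norm_nonneg _).trans (hM 0 (by simp))
  have hC0 : 0 ≤ C := by
    have := (norm_nonneg _).trans (hC δ (by simp [abs_of_pos hδ]))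
    simp only [Complex.norm_real, Real.norm_of_nonneg hδ.le] at this
    exact nonneg_of_mul_nonneg_left this (by positivity)
  have key : ∀ ρ : ℝ, 0 < ρ → ρ ≤ δ → ‖Ring.choose (-s) N‖ ≤ (C * (M + C) + M * C) * ρ := by
    intro ρ hρ hρδ
    have hρ1 : ρ < 1 := hρδ.trans_lt hδ1
    have h0 := h ρ hρ.le hρ1
    have e2 : ((1 - ρ ^ 2 : ℝ) : ℂ) ^ s ≠ 0 := by
      rw [Ne, Complex.cpow_eq_zero_iff, Complex.ofReal_eq_zero]
      intro h; nlinarith [h.1]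
    have e3 : ∀ b : ℂ, ‖b‖ = 1 → (((1 - ρ ^ 2 : ℝ) : ℂ) ^ s)⁻¹ * (b ^ n * pwave r ρ b) =
        b ^ n * ((1 + (-ρ * b)) ^ (-s) * (1 + (-ρ * conj b)) ^ (-s)) := by
      intro b hb
      rw [pwave_ofReal_eq r hρ.le hρ1 hb, ← hs, mul_left_comm (b ^ n), inv_mul_cancel_left₀ e2]
    have hpw : ContinuousOn (pwave r ρ) (Metric.sphere 0 1) :=
      continuousOn_pwave r (by rwa [Complex.norm_real, Real.norm_of_nonneg hρ.le])
    have i1 : Integrable (fun b : ℂ => b ^ n * ((1 + (-ρ * b)) ^ (-s) * (1 + (-ρ * conj b)) ^ (-s)))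
        circleMeasure :=
      ((integrable_of_continuousOn ((continuousOn_zpow_sphere n).mul hpw)).const_mul
        ((((1 - ρ ^ 2 : ℝ) : ℂ) ^ s)⁻¹)).congr (ae_norm_eq_one.mono e3)
    have e1 : ∫ b, b ^ n * ((1 + (-ρ * b)) ^ (-s) * (1 + (-ρ * conj b)) ^ (-s)) ∂circleMeasure = 0 := by
      rw [← integral_congr_ae (ae_norm_eq_one.mono e3), integral_const_mul, h0, mul_zero]
    have i2 : Integrable (fun b : ℂ => b ^ n * (binomPoly s N (-ρ * b) * binomPoly s N (-ρ * conj b)))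
        circleMeasure := by
      refine integrable_of_continuousOn ((continuousOn_zpow_sphere n).mul (Continuous.continuousOn ?_))
      have := Complex.continuous_conj
      fun_prop
    have e4 := integral_zpow_mul_binomPoly_mul s n ρ
    rw [← sub_zero (∫ b, _ ∂circleMeasure), ← e1, ← integral_sub i2 i1] at e4
    have e5 : ∀ᵐ b ∂circleMeasure,
        ‖b ^ n * (binomPoly s N (-ρ * b) * binomPoly s N (-ρ * conj b)) -
          b ^ n * ((1 + (-ρ * b)) ^ (-s) * (1 + (-ρ * conj b)) ^ (-s))‖ ≤
        (C * (M + C) + M * C) * ρ ^ (N + 1) := by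
      refine ae_norm_eq_one.mono fun b hb => ?_
      have hn : ∀ b : ℂ, ‖b‖ = 1 → ‖-ρ * b‖ = ρ := fun b hb => by
        rw [norm_mul, hb, norm_neg, Complex.norm_real, Real.norm_of_nonneg hρ.le, mul_one]
      have hb' : ‖conj b‖ = 1 := by rwa [Complex.norm_conj]
      have c1 := hC (-ρ * b) ((hn b hb).trans_le hρδ)
      have c2 := hC (-ρ * conj b) ((hn _ hb').trans_le hρδ)
      have m1 := hM (-ρ * b) (by rw [mem_closedBall_zero_iff, hn b hb]; exact hρ1.le)
      have m2 := hM (-ρ * conj b) (by rw [mem_closedBall_zero_iff, hn _ hb']; exact hρ1.le)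
      rw [hn _ hb] at c1
      rw [hn _ hb'] at c2
      rw [← mul_sub, norm_mul, norm_zpow, hb, one_zpow, one_mul]
      generalize binomPoly s N (-ρ * b) = T at *
      generalize binomPoly s N (-ρ * conj b) = T' at *
      generalize (1 + (-ρ * b)) ^ (-s) = f at *
      generalize (1 + (-ρ * conj b)) ^ (-s) = f' at *
      have hp1 : ρ ^ (N + 1) ≤ 1 := pow_le_one₀ hρ.le hρ1.le
      have hf' : ‖f'‖ ≤ M + C := by
        have := norm_le_norm_add_norm_sub T' f'
        have : C * ρ ^ (N + 1) ≤ C * 1 := mul_le_mul_of_nonneg_left hp1 hC0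
        rw [norm_sub_rev] at c2
        linarith
      rw [norm_sub_rev] at c1 c2
      have e : T * T' - f * f' = T * (T' - f') + (T - f) * f' := by ring
      rw [e]
      calc _ ≤ ‖T‖ * ‖T' - f'‖ + ‖T - f‖ * ‖f'‖ := (norm_add_le _ _).trans_eq (by rw [norm_mul, norm_mul])
        _ ≤ M * (C * ρ ^ (N + 1)) + C * ρ ^ (N + 1) * (M + C) := by gcongr
        _ = _ := by ring
    have e6 := norm_integral_le_of_norm_le_const e5
    rw [e4, norm_mul, norm_pow, norm_neg, Complex.norm_real, Real.norm_of_nonneg hρ.le,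
      probReal_univ, mul_one, pow_succ', ← mul_assoc] at e6
    exact le_of_mul_le_mul_right e6 (by positivity)
  have hA : 0 < ‖Ring.choose (-s) N‖ := norm_pos_iff.2 (choose_neg_ne_zero hsre N)
  have hlim : Filter.Tendsto (fun ρ : ℝ => (C * (M + C) + M * C) * ρ) (nhdsWithin 0 (Set.Ioi 0))
      (nhds 0) := by
    have : Continuous fun ρ : ℝ => (C * (M + C) + M * C) * ρ := by fun_prop
    exact (this.tendsto' 0 0 (by simp)).mono_left nhdsWithin_le_nhds
  refine absurd (ge_of_tendsto hlim ?_) (not_le.2 hA)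
  filter_upwards [Ioc_mem_nhdsGT hδ] with ρ hρ
  exact key ρ hρ.1 hρ.2

/-- Injectivity of the Poisson transform on `L²` of the circle. -/
theorem ae_eq_zero_of_forall_integral_pwave_mul (r : ℝ) {h : ℂ → ℂ} (hh : MemLp h 2 circleMeasure)
    (h0 : ∀ z : ℂ, ‖z‖ < 1 → ∫ b, pwave r z b * h b ∂circleMeasure = 0) :
    h =ᵐ[circleMeasure] 0 := by
  refine ae_eq_zero_of_forall_integral_zpow_mul hh fun n => ?_
  obtain ⟨ρ, hρ0, hρ1, hρ⟩ := exists_integral_zpow_mul_pwave_ne_zero r n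
  refine (mul_eq_zero.1 ?_).resolve_left hρ
  have hρn : ‖(ρ : ℂ)‖ < 1 := by rwa [Complex.norm_real, Real.norm_of_nonneg hρ0]
  have hcont := continuousOn_pwave r hρn
  obtain ⟨C, hC⟩ := (isCompact_sphere (0 : ℂ) 1).exists_bound_of_continuousOn hcont
  have hint : Integrable h circleMeasure := hh.integrable (by norm_num)
  have hI : Integrable (fun p : ℂ × ℂ => p.1 ^ n * pwave r ρ (conj p.2 * p.1) * h p.2)
      (circleMeasure.prod circleMeasure) := by
    have h1 : Integrable (fun p : ℂ × ℂ => h p.2) (circleMeasure.prod circleMeasure) :=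
      hint.comp_snd circleMeasure
    refine h1.bdd_mul (c := C) ?_ ?_
    · have hm : Measurable fun p : ℂ × ℂ => p.1 ^ n := by fun_prop
      have hm2 : Measurable fun p : ℂ × ℂ => pwave r ρ (conj p.2 * p.1) := by
        have : Measurable fun p : ℂ × ℂ => conj p.2 :=
          Complex.continuous_conj.measurable.comp measurable_snd
        exact measurable_pwave_comp measurable_const measurable_const (by fun_prop)
      exact (hm.mul hm2).aestronglyMeasurable
    · have a1 : ∀ᵐ p : ℂ × ℂ ∂circleMeasure.prod circleMeasure, ‖p.1‖ = 1 :=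
        Measure.quasiMeasurePreserving_fst.ae ae_norm_eq_one
      have a2 : ∀ᵐ p : ℂ × ℂ ∂circleMeasure.prod circleMeasure, ‖p.2‖ = 1 :=
        Measure.quasiMeasurePreserving_snd.ae ae_norm_eq_one
      filter_upwards [a1, a2] with p h1 h2
      rw [norm_mul, norm_zpow, h1, one_zpow, one_mul]
      exact hC _ (by simp [h1, h2])
  have e1 := integral_integral_swap
    (f := fun c b => c ^ n * pwave r ρ (conj b * c) * h b) hI
  have e2 : ∀ᵐ c ∂circleMeasure, ∫ b, c ^ n * pwave r ρ (conj b * c) * h b ∂circleMeasure = 0 := by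
    refine ae_norm_eq_one.mono fun c hc => ?_
    have h1 := h0 (ρ * c) (by rwa [norm_mul, hc, mul_one])
    have h2 : ∀ b, c ^ n * pwave r ρ (conj b * c) * h b = c ^ n * (pwave r (ρ * c) b * h b) := by
      intro b; rw [pwave_rotate r ρ hc, mul_assoc]
    simp only [h2]
    rw [integral_const_mul, h1, mul_zero]
  have e3 : ∀ᵐ b ∂circleMeasure, ∫ c, c ^ n * pwave r ρ (conj b * c) * h b ∂circleMeasure =
      (∫ c, c ^ n * pwave r ρ c ∂circleMeasure) * (b ^ n * h b) := by
    refine ae_norm_eq_one.mono fun b hb => ?_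
    have hb' : ‖conj b‖ = 1 := by rwa [Complex.norm_conj]
    have hbb : b * conj b = 1 := by rw [Complex.mul_conj, Complex.normSq_eq_norm_sq, hb]; simp
    have e4 := integral_circleMeasure_rotate (h := fun c => c ^ n * pwave r ρ c)
      ((continuousOn_zpow_sphere n).mul hcont) hb'
    rw [integral_mul_const, ← e4, mul_comm (b ^ n), mul_comm _ (h b * b ^ n),
      mul_assoc, ← integral_const_mul, mul_comm]
    congr 2
    ext c
    rw [mul_zpow, ← mul_assoc, ← mul_assoc, ← mul_zpow, hbb, one_zpow, one_mul]
  rw [integral_congr_ae e2, integral_congr_ae e3, integral_const_mul, integral_zero] at e1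
  exact e1.symm

theorem norm_le_of_gram_eq {ι H : Type*} [NormedAddCommGroup H] [InnerProductSpace ℂ H]
    {e e' : ι → H} (hd : Dense (Submodule.span ℂ (Set.range e) : Set H))
    (hg : ∀ i j, inner ℂ (e i) (e j) = inner ℂ (e' i) (e' j)) {x x' : H}
    (hx : ∀ i, inner ℂ (e i) x = inner ℂ (e' i) x') : ‖x‖ ≤ ‖x'‖ := by
  have h1 : ∀ y ∈ (Submodule.span ℂ (Set.range e) : Set H), ‖(inner ℂ y x : ℂ)‖ ≤ ‖y‖ * ‖x'‖ := by
    intro y hy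
    obtain ⟨c, rfl⟩ := (Finsupp.mem_span_range_iff_exists_finsupp).1 hy
    have h2 : (inner ℂ (c.sum fun i a => a • e i) x : ℂ) = inner ℂ (c.sum fun i a => a • e' i) x' := by
      simp only [Finsupp.sum, sum_inner, inner_smul_left, hx]
    have h3 : ‖c.sum fun i a => a • e i‖ = ‖c.sum fun i a => a • e' i‖ := by
      have h4 : (inner ℂ (c.sum fun i a => a • e i) (c.sum fun i a => a • e i) : ℂ) =
          inner ℂ (c.sum fun i a => a • e' i) (c.sum fun i a => a • e' i) := by
        simp only [Finsupp.sum, sum_inner, inner_sum, inner_smul_left, inner_smul_right, hg]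
      rw [@norm_eq_sqrt_re_inner ℂ, h4, ← @norm_eq_sqrt_re_inner ℂ]
    rw [h2, h3]
    exact norm_inner_le_norm _ _
  have h2 : ‖(inner ℂ x x : ℂ)‖ ≤ ‖x‖ * ‖x'‖ := by
    have hc : IsClosed {y : H | ‖(inner ℂ y x : ℂ)‖ ≤ ‖y‖ * ‖x'‖} :=
      isClosed_le (by fun_prop) (by fun_prop)
    exact hc.closure_subset_iff.2 h1 (hd x)
  rw [inner_self_eq_norm_sq_to_K] at h2
  simp only [coe_algebraMap, sq, norm_mul, Complex.norm_real, norm_norm] at h2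
  rcases (norm_nonneg x).eq_or_lt with h | h
  · rw [← h]; exact norm_nonneg _
  · exact le_of_mul_le_mul_left h2 h

theorem norm_eq_of_gram_eq {ι H : Type*} [NormedAddCommGroup H] [InnerProductSpace ℂ H]
    {e e' : ι → H} (hd : Dense (Submodule.span ℂ (Set.range e) : Set H))
    (hd' : Dense (Submodule.span ℂ (Set.range e') : Set H))
    (hg : ∀ i j, inner ℂ (e i) (e j) = inner ℂ (e' i) (e' j)) {x x' : H}
    (hx : ∀ i, inner ℂ (e i) x = inner ℂ (e' i) x') : ‖x‖ = ‖x'‖ :=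
  (norm_le_of_gram_eq hd hg hx).antisymm
    (norm_le_of_gram_eq hd' (fun i j => (hg i j).symm) fun i => (hx i).symm)

section Frame

variable {X ι H : Type*} [MeasurableSpace X] {ν : Measure X} [NormedAddCommGroup H]
  [InnerProductSpace ℂ H] {k : X → H} {e : ι → H}

theorem aestronglyMeasurable_inner_of_mem_span
    (hm : ∀ i, AEStronglyMeasurable (fun w => (inner ℂ (k w) (e i) : ℂ)) ν) {y : H}
    (hy : y ∈ Submodule.span ℂ (Set.range e)) :
    AEStronglyMeasurable (fun w => (inner ℂ (k w) y : ℂ)) ν := by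
  induction hy using Submodule.span_induction with
  | mem x hx => obtain ⟨i, rfl⟩ := hx; exact hm i
  | zero => simpa using aestronglyMeasurable_const
  | add x y _ _ hx hy => simp only [inner_add_right]; exact hx.add hy
  | smul a x _ hx => simpa only [inner_smul_right] using hx.const_mul a

theorem integral_conj_inner_mul_inner_of_mem_span
    (hint : ∀ i j, Integrable (fun w => conj (inner ℂ (k w) (e i) : ℂ) * inner ℂ (k w) (e j)) ν)
    (hg : ∀ i j, ∫ w, conj (inner ℂ (k w) (e i) : ℂ) * inner ℂ (k w) (e j) ∂ν = inner ℂ (e i) (e j))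
    {y y' : H} (hy : y ∈ Submodule.span ℂ (Set.range e))
    (hy' : y' ∈ Submodule.span ℂ (Set.range e)) :
    Integrable (fun w => conj (inner ℂ (k w) y : ℂ) * inner ℂ (k w) y') ν ∧
      ∫ w, conj (inner ℂ (k w) y : ℂ) * inner ℂ (k w) y' ∂ν = inner ℂ y y' := by
  induction hy, hy' using Submodule.span_induction₂ with
  | mem_mem x y hx hy =>
    obtain ⟨i, rfl⟩ := hx
    obtain ⟨j, rfl⟩ := hy
    exact ⟨hint i j, hg i j⟩
  | zero_left y hy => simp
  | zero_right y hy => simp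
  | add_left x y z _ _ _ h1 h2 =>
    simp only [inner_add_right, inner_add_left, map_add, add_mul]
    exact ⟨h1.1.add h2.1, by rw [integral_add h1.1 h2.1, h1.2, h2.2]⟩
  | add_right x y z _ _ _ h1 h2 =>
    simp only [inner_add_right, mul_add]
    exact ⟨h1.1.add h2.1, by rw [integral_add h1.1 h2.1, h1.2, h2.2]⟩
  | smul_left r x y _ _ h =>
    simp only [inner_smul_right, inner_smul_left, map_mul, mul_assoc]
    exact ⟨h.1.const_mul _, by rw [integral_const_mul, h.2]⟩
  | smul_right r x y _ _ h =>
    simp only [inner_smul_right, mul_left_comm _ r]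
    exact ⟨h.1.const_mul _, by rw [integral_const_mul, h.2]⟩

theorem eLpNorm_inner_of_dense_span
    (hm : ∀ i, AEStronglyMeasurable (fun w => (inner ℂ (k w) (e i) : ℂ)) ν)
    (hint : ∀ i j, Integrable (fun w => conj (inner ℂ (k w) (e i) : ℂ) * inner ℂ (k w) (e j)) ν)
    (hg : ∀ i j, ∫ w, conj (inner ℂ (k w) (e i) : ℂ) * inner ℂ (k w) (e j) ∂ν = inner ℂ (e i) (e j))
    (hd : Dense (Submodule.span ℂ (Set.range e) : Set H)) (x : H) :
    AEStronglyMeasurable (fun w => (inner ℂ (k w) x : ℂ)) ν ∧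
    eLpNorm (fun w => (inner ℂ (k w) x : ℂ)) 2 ν = ‖x‖ₑ := by
  have h1 : ∀ y ∈ Submodule.span ℂ (Set.range e),
      eLpNorm (fun w => (inner ℂ (k w) y : ℂ)) 2 ν = ‖y‖ₑ := by
    intro y hy
    obtain ⟨h2, h3⟩ := integral_conj_inner_mul_inner_of_mem_span hint hg hy hy
    have h4 : ∀ w, conj (inner ℂ (k w) y : ℂ) * inner ℂ (k w) y =
        ((‖(inner ℂ (k w) y : ℂ)‖ ^ 2 : ℝ) : ℂ) := fun w => by
      rw [← Complex.normSq_eq_conj_mul_self, Complex.normSq_eq_norm_sq]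
    simp only [h4] at h2 h3
    rw [integral_complex_ofReal, inner_self_eq_norm_sq_to_K] at h3
    have h5 : ∫ w, ‖(inner ℂ (k w) y : ℂ)‖ ^ 2 ∂ν = ‖y‖ ^ 2 := by
      have := h3
      simp only [coe_algebraMap] at this
      exact_mod_cast this
    have h6 : MemLp (fun w => (inner ℂ (k w) y : ℂ)) 2 ν :=
      (memLp_two_iff_integrable_sq_norm (aestronglyMeasurable_inner_of_mem_span hm hy)).2 (by
        simpa only [RCLike.re_to_complex, Complex.ofReal_re] using h2.re)
    rw [h6.eLpNorm_eq_integral_rpow_norm (by norm_num) (by norm_num)]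
    simp only [ENNReal.toReal_ofNat, Real.rpow_two, h5]
    rw [← one_div, ← Real.sqrt_eq_rpow, Real.sqrt_sq (norm_nonneg _), ofReal_norm]
  have hseq : ∀ x : H, ∃ y : ℕ → H, (∀ n, y n ∈ Submodule.span ℂ (Set.range e)) ∧
      Filter.Tendsto y Filter.atTop (nhds x) := fun x => mem_closure_iff_seq_limit.1 (hd x)
  have hlim : ∀ (x : H) (y : ℕ → H), Filter.Tendsto y Filter.atTop (nhds x) → ∀ w,
      Filter.Tendsto (fun n => (inner ℂ (k w) (y n) : ℂ)) Filter.atTop (nhds (inner ℂ (k w) x)) :=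
    fun x y hy w => tendsto_const_nhds.inner hy
  have hmeas : ∀ x : H, AEStronglyMeasurable (fun w => (inner ℂ (k w) x : ℂ)) ν := by
    intro x
    obtain ⟨y, hy, hyx⟩ := hseq x
    exact aestronglyMeasurable_of_tendsto_ae Filter.atTop
      (fun n => aestronglyMeasurable_inner_of_mem_span hm (hy n))
      (Filter.Eventually.of_forall (hlim x y hyx))
  have hle : ∀ x : H, eLpNorm (fun w => (inner ℂ (k w) x : ℂ)) 2 ν ≤ ‖x‖ₑ := by
    intro x
    obtain ⟨y, hy, hyx⟩ := hseq x
    refine (Lp.eLpNorm_lim_le_liminf_eLpNorm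
      (fun n => aestronglyMeasurable_inner_of_mem_span hm (hy n)) _
      (Filter.Eventually.of_forall (hlim x y hyx))).trans_eq ?_
    simp only [h1 _ (hy _)]
    exact (hyx.enorm).liminf_eq
  refine ⟨hmeas x, (hle x).antisymm ?_⟩
  obtain ⟨y, hy, hyx⟩ := hseq x
  have h2 : ∀ n, ‖y n‖ₑ ≤ eLpNorm (fun w => (inner ℂ (k w) x : ℂ)) 2 ν + ‖y n - x‖ₑ := by
    intro n
    rw [← h1 _ (hy n)]
    have h3 : (fun w => (inner ℂ (k w) (y n) : ℂ)) =
        (fun w => (inner ℂ (k w) x : ℂ)) + fun w => (inner ℂ (k w) (y n - x) : ℂ) := by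
      ext w; simp
    rw [h3]
    refine (eLpNorm_add_le (hmeas x) (hmeas _) (by norm_num)).trans ?_
    gcongr
    exact hle _
  have h3 : Filter.Tendsto (fun n => eLpNorm (fun w => (inner ℂ (k w) x : ℂ)) 2 ν + ‖y n - x‖ₑ)
      Filter.atTop (nhds (eLpNorm (fun w => (inner ℂ (k w) x : ℂ)) 2 ν + ‖x - x‖ₑ)) :=
    tendsto_const_nhds.add (hyx.sub_const x).enorm
  simpa using le_of_tendsto_of_tendsto' hyx.enorm h3 h2

/-- A family that is isometric on a total set defines an isometry on the whole space. -/
theorem integral_norm_inner_sq_of_dense_span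
    (hm : ∀ i, AEStronglyMeasurable (fun w => (inner ℂ (k w) (e i) : ℂ)) ν)
    (hint : ∀ i j, Integrable (fun w => conj (inner ℂ (k w) (e i) : ℂ) * inner ℂ (k w) (e j)) ν)
    (hg : ∀ i j, ∫ w, conj (inner ℂ (k w) (e i) : ℂ) * inner ℂ (k w) (e j) ∂ν = inner ℂ (e i) (e j))
    (hd : Dense (Submodule.span ℂ (Set.range e) : Set H)) (x : H) :
    ∫ w, ‖(inner ℂ (k w) x : ℂ)‖ ^ 2 ∂ν = ‖x‖ ^ 2 := by
  obtain ⟨h1, h2⟩ := eLpNorm_inner_of_dense_span hm hint hg hd x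
  have h3 : MemLp (fun w => (inner ℂ (k w) x : ℂ)) 2 ν := ⟨h1, by rw [h2]; exact enorm_lt_top⟩
  rw [h3.eLpNorm_eq_integral_rpow_norm (by norm_num) (by norm_num), ← ofReal_norm,
    ENNReal.ofReal_eq_ofReal_iff (by positivity) (norm_nonneg _)] at h2
  simp only [ENNReal.toReal_ofNat, Real.rpow_two] at h2
  rw [← one_div, ← Real.sqrt_eq_rpow] at h2
  rw [← h2, Real.sq_sqrt (integral_nonneg fun _ => by positivity)]

end Frame

section L2

variable {α : Type*} [MeasurableSpace α] {μ : Measure α}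

theorem inner_toLp {f g : α → ℂ} (hf : MemLp f 2 μ) (hg : MemLp g 2 μ) :
    inner ℂ hf.toLp hg.toLp = ∫ x, conj (f x) * g x ∂μ := by
  rw [L2.inner_def]
  refine integral_congr_ae ?_
  filter_upwards [hf.coeFn_toLp, hg.coeFn_toLp] with x h1 h2
  rw [h1, h2, RCLike.inner_apply, mul_comm]

theorem norm_toLp_sq {f : α → ℂ} (hf : MemLp f 2 μ) : ‖hf.toLp‖ ^ 2 = ∫ x, ‖f x‖ ^ 2 ∂μ := by
  have h := inner_self_eq_norm_sq_to_K (𝕜 := ℂ) hf.toLp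
  rw [inner_toLp] at h
  simp only [← Complex.normSq_eq_conj_mul_self, Complex.normSq_eq_norm_sq] at h
  rw [integral_complex_ofReal] at h
  simp only [coe_algebraMap] at h
  exact_mod_cast h.symm

theorem dense_span_toLp {ι : Type*} {e : ι → α → ℂ} (he : ∀ i, MemLp (e i) 2 μ)
    (h : ∀ g, MemLp g 2 μ → (∀ i, ∫ x, conj (e i x) * g x ∂μ = 0) → g =ᵐ[μ] 0) :
    Dense (Submodule.span ℂ (Set.range fun i => (he i).toLp) : Set (Lp ℂ 2 μ)) := by
  rw [Submodule.dense_iff_topologicalClosure_eq_top, Submodule.topologicalClosure_eq_top_iff,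
    Submodule.eq_bot_iff]
  intro g hg
  have h1 := h g (Lp.memLp g) fun i => by
    rw [← inner_toLp (he i) (Lp.memLp g), Lp.toLp_coeFn]
    exact hg _ (Submodule.subset_span ⟨i, rfl⟩)
  rw [Lp.eq_zero_iff_ae_eq_zero]
  exact h1

end L2

theorem memLp_of_continuousOn_sphere {h : ℂ → ℂ} (hh : ContinuousOn h (Metric.sphere 0 1)) :
    MemLp h 2 circleMeasure := by
  obtain ⟨C, hC⟩ := (isCompact_sphere (0 : ℂ) 1).exists_bound_of_continuousOn hh
  refine MemLp.of_bound hh.aestronglyMeasurable_circleMeasure C ?_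
  filter_upwards [ae_norm_eq_one] with b hb
  exact hC b (by simpa using hb)

theorem dense_span_pwave (r : ℝ) : Dense (Submodule.span ℂ (Set.range
    fun w : Metric.ball (0 : ℂ) 1 => (memLp_of_continuousOn_sphere
      (continuousOn_pwave r (mem_ball_zero_iff.1 w.2))).toLp) : Set (Lp ℂ 2 circleMeasure)) := by
  refine dense_span_toLp _ fun g hg h0 => ?_
  refine ae_eq_zero_of_forall_integral_pwave_mul (-r) hg fun w hw => ?_
  rw [← h0 ⟨w, by simpa using hw⟩]
  refine integral_congr_ae (ae_norm_eq_one.mono fun b hb => ?_)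
  simp only [conj_pwave r hw hb]

theorem sph_mob_comm (r : ℝ) {z w : ℂ} (hz : ‖z‖ < 1) (hw : ‖w‖ < 1) :
    sph r (mob z w) = sph r (mob w z) := by
  rw [← sph_norm r (norm_mob_lt_one hz hw), norm_mob_comm, sph_norm r (norm_mob_lt_one hw hz)]

/-- The Weyl symmetry of a symbol forces its weighted `L²` norms at `r` and `-r` to agree. -/
theorem integral_norm_sq_eq_of_weyl {r : ℝ} {z : ℂ} {f g : ℂ → ℂ} (hz : ‖z‖ < 1)
    (hf : ContinuousOn f (Metric.sphere 0 1)) (hg : ContinuousOn g (Metric.sphere 0 1))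
    (h : ∀ w : ℂ, ‖w‖ < 1 → ∫ b, f b * pwave r z b * pwave (-r) w b ∂circleMeasure =
      ∫ b, g b * pwave (-r) z b * pwave r w b ∂circleMeasure) :
    ∫ b, ‖f b‖ ^ 2 * Pk z b ∂circleMeasure = ∫ b, ‖g b‖ ^ 2 * Pk z b ∂circleMeasure := by
  have hF := memLp_of_continuousOn_sphere (hf.mul (continuousOn_pwave r hz))
  have hG := memLp_of_continuousOn_sphere (hg.mul (continuousOn_pwave (-r) hz))
  have h1 := norm_eq_of_gram_eq (dense_span_pwave r) (dense_span_pwave (-r))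
    (x := hF.toLp) (x' := hG.toLp) ?_ ?_
  · have h2 : ∀ (s : ℝ) (u : ℂ → ℂ) (hu : MemLp (u * pwave s z) 2 circleMeasure),
        ‖hu.toLp‖ ^ 2 = ∫ b, ‖u b‖ ^ 2 * Pk z b ∂circleMeasure := by
      intro s u hu
      rw [norm_toLp_sq]
      refine integral_congr_ae (ae_norm_eq_one.mono fun b hb => ?_)
      simp only [Pi.mul_apply]
      rw [norm_mul, mul_pow, norm_pwave s hz hb, Real.sq_sqrt (Pk_pos hz hb).le]
    rw [← h2 r f hF, ← h2 (-r) g hG, h1]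
  · rintro ⟨v, hv⟩ ⟨w, hw⟩
    rw [mem_ball_zero_iff] at hv hw
    have h2 : ∀ s : ℝ, ∫ b, conj (pwave s v b) * pwave s w b ∂circleMeasure = sph s (mob v w) := by
      intro s
      rw [← integral_pwave_mul_pwave s hw hv]
      refine integral_congr_ae (ae_norm_eq_one.mono fun b hb => ?_)
      simp only [conj_pwave s hv hb, mul_comm]
    simp only [inner_toLp, h2]
    rw [sph_neg r (norm_mob_lt_one hv hw)]
  · rintro ⟨w, hw⟩
    rw [mem_ball_zero_iff] at hw
    have h3 := h w hw
    simp only [inner_toLp]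
    convert h3 using 1
    · refine integral_congr_ae (ae_norm_eq_one.mono fun b hb => ?_)
      simp only [conj_pwave _ hw hb, Pi.mul_apply]
      ring
    · refine integral_congr_ae (ae_norm_eq_one.mono fun b hb => ?_)
      simp only [conj_pwave _ hw hb, Pi.mul_apply, neg_neg]
      ring

/-- The product of Lebesgue measure on an interval with the circle measure. -/
def strip (c d : ℝ) : Measure (ℝ × ℂ) := (volume.restrict (Set.Ioo c d)).prod circleMeasure

instance (c d : ℝ) : IsFiniteMeasure (strip c d) := by unfold strip; infer_instance

theorem ae_strip (c d : ℝ) : ∀ᵐ p ∂strip c d, p.1 ∈ Set.Ioo c d ∧ ‖p.2‖ = 1 := by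
  have h1 : ∀ᵐ p ∂strip c d, p.1 ∈ Set.Ioo c d :=
    Measure.quasiMeasurePreserving_fst.ae (ae_restrict_mem measurableSet_Ioo)
  have h2 : ∀ᵐ p ∂strip c d, ‖p.2‖ = 1 := Measure.quasiMeasurePreserving_snd.ae ae_norm_eq_one
  exact h1.and h2

theorem ContinuousOn.aestronglyMeasurable_strip {g : ℝ × ℂ → ℂ}
    (hg : ContinuousOn g (Set.univ ×ˢ Metric.sphere 0 1)) (c d : ℝ) :
    AEStronglyMeasurable g (strip c d) := by
  have h : (strip c d).restrict (Set.univ ×ˢ Metric.sphere 0 1) = strip c d :=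
    Measure.restrict_eq_self_of_ae_mem ((ae_strip c d).mono fun p hp => ⟨trivial, by simpa using hp.2⟩)
  rw [← h]
  exact hg.aestronglyMeasurable (MeasurableSet.univ.prod Metric.isClosed_sphere.measurableSet)

theorem exists_ae_strip_norm_le {g : ℝ × ℂ → ℂ}
    (hg : ContinuousOn g (Set.univ ×ˢ Metric.sphere 0 1)) (c d : ℝ) :
    ∃ C, ∀ᵐ p ∂strip c d, ‖g p‖ ≤ C := by
  obtain ⟨C, hC⟩ := ((isCompact_Icc (a := c) (b := d)).prod
    (isCompact_sphere (0 : ℂ) 1)).exists_bound_of_continuousOn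
    (hg.mono (Set.prod_mono (Set.subset_univ _) subset_rfl))
  exact ⟨C, (ae_strip c d).mono fun p hp => hC p ⟨Set.Ioo_subset_Icc_self hp.1, by simpa using hp.2⟩⟩

theorem memLp_strip {g : ℝ × ℂ → ℂ} (hg : ContinuousOn g (Set.univ ×ˢ Metric.sphere 0 1))
    (c d : ℝ) (q : ENNReal) : MemLp g q (strip c d) := by
  obtain ⟨C, hC⟩ := exists_ae_strip_norm_le hg c d
  exact MemLp.of_bound (hg.aestronglyMeasurable_strip c d) C hC

theorem integrable_strip {g : ℝ × ℂ → ℂ} (hg : ContinuousOn g (Set.univ ×ˢ Metric.sphere 0 1))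
    (c d : ℝ) : Integrable g (strip c d) :=
  memLp_one_iff_integrable.1 (memLp_strip hg c d 1)

theorem continuousOn_pwave_rb {z : ℂ} (hz : ‖z‖ < 1) :
    ContinuousOn (fun p : ℝ × ℂ => pwave p.1 z p.2) (Set.univ ×ˢ Metric.sphere 0 1) := by
  refine continuousOn_pwave_rzb.comp (f := fun p : ℝ × ℂ => (p.1, z, p.2)) (by fun_prop) ?_
  rintro p ⟨_, hp⟩
  exact ⟨trivial, by simpa using hz, hp⟩

theorem continuousOn_pwave_neg_rb {z : ℂ} (hz : ‖z‖ < 1) :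
    ContinuousOn (fun p : ℝ × ℂ => pwave (-p.1) z p.2) (Set.univ ×ˢ Metric.sphere 0 1) :=
  (continuousOn_pwave_rb hz).comp (f := fun p : ℝ × ℂ => (-p.1, p.2)) (by fun_prop)
    fun _ hp => ⟨trivial, hp.2⟩

theorem continuous_plm : Continuous plm := by
  unfold plm
  have : Continuous fun r : ℝ => Real.tanh (π * r) := by
    simp only [Real.tanh_eq_sinh_div_cosh]
    exact Continuous.div (by fun_prop) (by fun_prop) fun _ => (Real.cosh_pos _).ne'
  fun_prop

theorem plm_neg (r : ℝ) : plm (-r) = plm r := by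
  simp [plm]

theorem plm_nonneg {r : ℝ} (hr : 0 ≤ r) : 0 ≤ plm r := by
  have : 0 ≤ Real.tanh (π * r) := by
    rw [Real.tanh_eq_sinh_div_cosh]
    exact div_nonneg (Real.sinh_nonneg_iff.2 (by positivity)) (Real.cosh_pos _).le
  unfold plm; positivity

theorem plm_pos {r : ℝ} (hr : 0 < r) : 0 < plm r := by
  have : 0 < Real.tanh (π * r) := by
    rw [Real.tanh_eq_sinh_div_cosh]
    exact div_pos (Real.sinh_pos_iff.2 (by positivity)) (Real.cosh_pos _)
  unfold plm; positivity

/-- A superposition of the plane waves with amplitude `u`, normalized by the Plancherel density. -/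
def wavePacket (u : ℝ × ℂ → ℂ) (z : ℂ) (p : ℝ × ℂ) : ℂ :=
  (√(plm p.1) : ℂ) * (u p * pwave p.1 z p.2)

theorem continuousOn_wavePacket {u : ℝ × ℂ → ℂ}
    (hu : ContinuousOn u (Set.univ ×ˢ Metric.sphere 0 1)) {z : ℂ} (hz : ‖z‖ < 1) :
    ContinuousOn (wavePacket u z) (Set.univ ×ˢ Metric.sphere 0 1) := by
  have := continuous_plm
  exact ContinuousOn.mul (by fun_prop) (hu.mul (continuousOn_pwave_rb hz))

theorem memLp_wavePacket {u : ℝ × ℂ → ℂ}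
    (hu : ContinuousOn u (Set.univ ×ˢ Metric.sphere 0 1)) {z : ℂ} (hz : ‖z‖ < 1) (c d : ℝ) :
    MemLp (wavePacket u z) 2 (strip c d) :=
  memLp_strip (continuousOn_wavePacket hu hz) c d 2

theorem conj_wavePacket_mul (u v : ℝ × ℂ → ℂ) {z w : ℂ} (hz : ‖z‖ < 1) {p : ℝ × ℂ} (hr : 0 ≤ p.1)
    (hb : ‖p.2‖ = 1) : conj (wavePacket u z p) * wavePacket v w p =
      (plm p.1 : ℂ) * (conj (u p) * v p) * (pwave p.1 w p.2 * pwave (-p.1) z p.2) := by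
  have h : (√(plm p.1) : ℂ) * (√(plm p.1) : ℂ) = plm p.1 := by
    rw [← Complex.ofReal_mul, Real.mul_self_sqrt (plm_nonneg hr)]
  simp only [wavePacket, map_mul, Complex.conj_ofReal, conj_pwave _ hz hb]
  rw [← h]
  ring

theorem integral_conj_wavePacket_mul (u v : ℝ × ℂ → ℂ) {z w : ℂ} (hz : ‖z‖ < 1) (R : ℝ) :
    ∫ p, conj (wavePacket u z p) * wavePacket v w p ∂strip 0 R =
      ∫ p, (plm p.1 : ℂ) * (conj (u p) * v p) * (pwave p.1 w p.2 * pwave (-p.1) z p.2) ∂strip 0 R :=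
  integral_congr_ae ((ae_strip 0 R).mono fun _ hp => conj_wavePacket_mul u v hz hp.1.1.le hp.2)

/-- Test functions on the interval `(0, R)`. -/
structure TestFun (R : ℝ) where
  toFun : ℝ → ℝ
  contDiff : ContDiff ℝ (⊤ : ℕ∞) toFun
  hasCompactSupport : HasCompactSupport toFun
  tsupport_subset : tsupport toFun ⊆ Set.Ioo 0 R

theorem TestFun.eq_zero {R : ℝ} (f : TestFun R) {r : ℝ} (hr : r ∉ Set.Ioo 0 R) : f.toFun r = 0 :=
  image_eq_zero_of_notMem_tsupport fun h => hr (f.tsupport_subset h)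

theorem TestFun.eq_zero_of_nonpos {R : ℝ} (f : TestFun R) (r : ℝ) (hr : r ≤ 0) : f.toFun r = 0 :=
  f.eq_zero fun h => hr.not_gt h.1

theorem TestFun.continuousOn {R : ℝ} (f : TestFun R) (s : Set (ℝ × ℂ)) :
    ContinuousOn (fun p : ℝ × ℂ => (f.toFun p.1 : ℂ)) s := by
  have := f.contDiff.continuous
  fun_prop

theorem memLp_testFun {R : ℝ} (f : TestFun R) (z : Metric.ball (0 : ℂ) 1) :
    MemLp (wavePacket (fun p => (f.toFun p.1 : ℂ)) z) 2 (strip 0 R) :=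
  memLp_wavePacket (f.continuousOn _) (mem_ball_zero_iff.1 z.2) 0 R

theorem integral_conj_wavePacket_one_mul {R : ℝ} (f : TestFun R) {z w : ℂ} (hz : ‖z‖ < 1)
    (hw : ‖w‖ < 1) :
    ∫ p, conj (wavePacket 1 w p) * wavePacket (fun p => (f.toFun p.1 : ℂ)) z p ∂strip 0 R =
      invSph f.toFun (mob z w) := by
  have hf := f.contDiff.continuous
  have hm := continuous_plm
  rw [integral_conj_wavePacket_mul _ _ hw, strip, integral_prod]
  · have h1 : ∀ r, ∫ b, (plm r : ℂ) * (conj ((1 : ℝ × ℂ → ℂ) (r, b)) * (f.toFun r : ℂ)) *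
        (pwave r z b * pwave (-r) w b) ∂circleMeasure =
        ((f.toFun r * plm r : ℝ) : ℂ) * sph r (mob z w) := by
      intro r
      rw [sph_mob_comm r hz hw, ← integral_pwave_mul_pwave r hz hw, ← integral_const_mul]
      congr 1
      ext b
      simp only [Pi.one_apply, map_one, one_mul]
      push_cast
      ring
    simp only [h1]
    rw [invSph]
    refine setIntegral_eq_integral_of_forall_compl_eq_zero fun r hr => ?_
    rw [f.eq_zero hr]
    simp
  · refine integrable_strip (ContinuousOn.mul ?_ ((continuousOn_pwave_rb hz).mul
      (continuousOn_pwave_neg_rb hw))) 0 R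
    simp only [Pi.one_apply, map_one, one_mul]
    fun_prop

instance : SFinite hypVol := by unfold hypVol; infer_instance

theorem integrable_invSph_mob_mul_pwave_strip {R : ℝ} (f : TestFun R) {z : ℂ} (hz : ‖z‖ < 1)
    {u : ℝ × ℂ → ℂ} (hu : ContinuousOn u (Set.univ ×ˢ Metric.sphere 0 1)) :
    Integrable (fun q : ℂ × (ℝ × ℂ) =>
      invSph f.toFun (mob z q.1) * pwave (-q.2.1) q.1 q.2.2 * u q.2) (hypVol.prod (strip 0 R)) := by
  have hf := f.contDiff
  have hc := f.hasCompactSupport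
  have hmf := measurable_invSph hf.continuous.measurable
  have hmz := measurable_mob z
  have hm : Measurable fun q : ℂ × (ℝ × ℂ) =>
      invSph f.toFun (mob z q.1) * pwave (-q.2.1) q.1 q.2.2 := by
    have h1 : Measurable fun q : ℂ × (ℝ × ℂ) => invSph f.toFun (mob z q.1) :=
      hmf.comp (hmz.comp measurable_fst)
    have h2 : Measurable fun q : ℂ × (ℝ × ℂ) => pwave (-q.2.1) q.1 q.2.2 := by fun_prop
    exact h1.mul h2
  rw [integrable_prod_iff' (f := fun q : ℂ × (ℝ × ℂ) =>
    invSph f.toFun (mob z q.1) * pwave (-q.2.1) q.1 q.2.2 * u q.2)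
    (hm.aestronglyMeasurable.mul (hu.aestronglyMeasurable_strip 0 R).comp_snd)]
  constructor
  · filter_upwards [ae_strip 0 R] with p hp
    exact (integrable_invSph_mob_mul_pwave hf hc (-p.1) hz hp.2).mul_const (u p)
  · set C := ∫ t : ℝ, ‖invSph f.toFun (Real.tanh (t / 2))‖ * ‖sph 0 (Real.tanh (t / 2))‖ ∂radialVol
    have h : Integrable (fun p : ℝ × ℂ => (C : ℂ) * (pwave p.1 z p.2 * u p)) (strip 0 R) :=
      integrable_strip (continuousOn_const.mul ((continuousOn_pwave_rb hz).mul hu)) 0 R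
    refine h.norm.congr ?_
    filter_upwards [ae_strip 0 R] with p hp
    have hC : 0 ≤ C := integral_nonneg fun _ => by positivity
    simp only [norm_mul (_ * _) (u p)]
    rw [integral_mul_const, integral_norm_invSph_mob_mul_pwave hf hc _ hz hp.2, norm_mul, norm_mul,
      norm_pwave _ hz hp.2, Complex.norm_real, Real.norm_of_nonneg hC]
    ring

theorem integral_invSph_mul_invSph {R : ℝ} (f g : TestFun R) {z w : ℂ} (hz : ‖z‖ < 1)
    (hw : ‖w‖ < 1) :
    Integrable (fun v => invSph f.toFun (mob z v) * invSph g.toFun (mob w v)) hypVol ∧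
    ∫ v, invSph f.toFun (mob z v) * invSph g.toFun (mob w v) ∂hypVol =
      ∫ p, conj (wavePacket (fun p => (f.toFun p.1 : ℂ)) z p) *
        wavePacket (fun p => (g.toFun p.1 : ℂ)) w p ∂strip 0 R := by
  have hcg := g.contDiff.continuous
  have hcm := continuous_plm
  have hu : ContinuousOn (fun p : ℝ × ℂ => (plm p.1 : ℂ) * (g.toFun p.1 : ℂ) * pwave p.1 w p.2)
      (Set.univ ×ˢ Metric.sphere 0 1) := ContinuousOn.mul (by fun_prop) (continuousOn_pwave_rb hw)
  have hG := integrable_invSph_mob_mul_pwave_strip f hz hu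
  have h1 : (fun v => invSph f.toFun (mob z v) * invSph g.toFun (mob w v)) =ᵐ[hypVol]
      fun v => ∫ p, invSph f.toFun (mob z v) * pwave (-p.1) v p.2 *
        ((plm p.1 : ℂ) * (g.toFun p.1 : ℂ) * pwave p.1 w p.2) ∂strip 0 R := by
    filter_upwards [ae_hypVol_norm_lt_one] with v hv
    rw [← integral_conj_wavePacket_one_mul g hw hv, integral_conj_wavePacket_mul _ _ hv,
      ← integral_const_mul]
    congr 1
    ext p
    simp only [Pi.one_apply, map_one, one_mul]
    ring
  have h2 := hG.integral_prod_left
  have h3 := integral_prod _ hG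
  rw [integral_prod_symm _ hG] at h3
  refine ⟨h2.congr h1.symm, ?_⟩
  rw [integral_congr_ae h1, integral_conj_wavePacket_mul _ _ hz, ← h3]
  refine integral_congr_ae ?_
  filter_upwards [ae_strip 0 R] with p hp
  rw [integral_mul_const, integral_invSph_mob_mul_pwave f.contDiff f.hasCompactSupport
    f.eq_zero_of_nonpos hp.1.1 hz hp.2, Complex.conj_ofReal]
  ring

/-- The vector representing evaluation at `w` of superpositions of plane waves. -/
def waveVec (R : ℝ) (w : ℂ) : Lp ℂ 2 (strip 0 R) :=
  if h : ‖w‖ < 1 then (memLp_wavePacket (u := 1) continuousOn_const h 0 R).toLp else 0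

theorem inner_waveVec {R : ℝ} {w : ℂ} (hw : ‖w‖ < 1) {g : ℝ × ℂ → ℂ} (hg : MemLp g 2 (strip 0 R)) :
    inner ℂ (waveVec R w) hg.toLp = ∫ p, conj (wavePacket 1 w p) * g p ∂strip 0 R := by
  rw [waveVec, dif_pos hw, inner_toLp]

theorem ae_inner_waveVec {R : ℝ} (i : TestFun R × Metric.ball (0 : ℂ) 1) :
    (fun w => inner ℂ (waveVec R w) (memLp_testFun i.1 i.2).toLp) =ᵐ[hypVol]
      fun w => invSph i.1.toFun (mob i.2 w) := by
  filter_upwards [ae_hypVol_norm_lt_one] with w hw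
  rw [inner_waveVec hw, integral_conj_wavePacket_one_mul _ (mem_ball_zero_iff.1 i.2.2) hw]

theorem ae_conj_inner_waveVec_mul {R : ℝ} (i j : TestFun R × Metric.ball (0 : ℂ) 1) :
    (fun w => conj (inner ℂ (waveVec R w) (memLp_testFun i.1 i.2).toLp) *
      inner ℂ (waveVec R w) (memLp_testFun j.1 j.2).toLp) =ᵐ[hypVol]
      fun w => invSph i.1.toFun (mob i.2 w) * invSph j.1.toFun (mob j.2 w) := by
  filter_upwards [ae_hypVol_norm_lt_one, ae_inner_waveVec i, ae_inner_waveVec j] with w hw h1 h2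
  rw [h1, h2, conj_invSph _ (norm_mob_lt_one (mem_ball_zero_iff.1 i.2.2) hw)]

theorem continuous_integral_pwave_mul (r : ℝ) {h : ℂ → ℂ} (hh : Integrable h circleMeasure) :
    Continuous fun z : Metric.ball (0 : ℂ) 1 => ∫ b, pwave r z b * h b ∂circleMeasure := by
  refine continuous_iff_continuousAt.2 fun z₀ => ?_
  obtain ⟨ρ, hρ, hρ1⟩ := exists_between (mem_ball_zero_iff.1 z₀.2)
  have hs : Set.univ ×ˢ Metric.closedBall 0 ρ ×ˢ Metric.sphere 0 1 ⊆
      (Set.univ ×ˢ Metric.ball 0 1 ×ˢ Metric.sphere 0 1 : Set (ℝ × ℂ × ℂ)) :=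
    Set.prod_mono subset_rfl (Set.prod_mono (Metric.closedBall_subset_ball hρ1) subset_rfl)
  obtain ⟨C, hC⟩ := (isCompact_singleton (x := r)).prod ((isCompact_closedBall (0 : ℂ) ρ).prod
    (isCompact_sphere (0 : ℂ) 1)) |>.exists_bound_of_continuousOn
    (continuousOn_pwave_rzb.mono ((Set.prod_mono (Set.subset_univ _) subset_rfl).trans hs))
  refine continuousAt_of_dominated (bound := fun b => C * ‖h b‖) ?_ ?_ (hh.norm.const_mul C) ?_
  · refine Filter.Eventually.of_forall fun z => ?_
    have hz := mem_ball_zero_iff.1 z.2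
    exact (continuousOn_pwave r hz).aestronglyMeasurable_circleMeasure.mul hh.aestronglyMeasurable
  · have hev : ∀ᶠ z : Metric.ball (0 : ℂ) 1 in nhds z₀, ‖(z : ℂ)‖ < ρ :=
      (continuous_norm.comp continuous_subtype_val).continuousAt.eventually (gt_mem_nhds hρ)
    filter_upwards [hev] with z hz
    filter_upwards [ae_norm_eq_one] with b hb
    rw [norm_mul]
    gcongr
    exact hC (r, z, b) ⟨rfl, by simpa using hz.le, by simpa using hb⟩
  · filter_upwards [ae_norm_eq_one] with b hb
    refine ContinuousAt.mul ?_ continuousAt_const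
    have h1 : ContinuousOn (fun z : ℂ => pwave r z b) (Metric.ball 0 1) :=
      continuousOn_pwave_rzb.comp (f := fun z : ℂ => (r, z, b)) (by fun_prop)
        fun z hz => ⟨trivial, hz, by simpa using hb⟩
    exact (h1.continuousAt (Metric.isOpen_ball.mem_nhds z₀.2)).comp
      (f := fun z : Metric.ball (0 : ℂ) 1 => (z : ℂ)) continuous_subtype_val.continuousAt

theorem ae_integral_pwave_mul_eq_zero {R : ℝ} {g : ℝ × ℂ → ℂ} (hg : Integrable g (strip 0 R))
    (z : Metric.ball (0 : ℂ) 1) (h : ∀ f : TestFun R,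
      ∫ p, conj (wavePacket (fun p => (f.toFun p.1 : ℂ)) z p) * g p ∂strip 0 R = 0) :
    ∀ᵐ r ∂volume.restrict (Set.Ioo 0 R), ∫ b, pwave (-r) z b * g (r, b) ∂circleMeasure = 0 := by
  have hz := mem_ball_zero_iff.1 z.2
  have hcm := continuous_plm
  have hψ : ContinuousOn (fun p : ℝ × ℂ => (√(plm p.1) : ℂ) * pwave (-p.1) z p.2)
      (Set.univ ×ˢ Metric.sphere 0 1) :=
    ContinuousOn.mul (by fun_prop) (continuousOn_pwave_neg_rb hz)
  have hmul : ∀ {ψ : ℝ × ℂ → ℂ}, ContinuousOn ψ (Set.univ ×ˢ Metric.sphere 0 1) →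
      Integrable (fun p => ψ p * g p) (strip 0 R) := by
    intro ψ hψ
    obtain ⟨C, hC⟩ := exists_ae_strip_norm_le hψ 0 R
    exact hg.bdd_mul (hψ.aestronglyMeasurable_strip 0 R) hC
  have hi := hmul hψ
  rw [strip] at hi
  have h1 := IsOpen.ae_eq_zero_of_integral_contDiff_smul_eq_zero (isOpen_Ioo (a := 0) (b := R))
    (hi.integral_prod_left.locallyIntegrable.locallyIntegrableOn _) fun f hf hc hs => by
      have h2 := h ⟨f, hf, hc, hs⟩
      have h3 : ∀ᵐ p ∂strip 0 R, conj (wavePacket (fun p => (f p.1 : ℂ)) z p) * g p =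
          ((f p.1 : ℂ) * ((√(plm p.1) : ℂ) * pwave (-p.1) z p.2)) * g p := by
        filter_upwards [ae_strip 0 R] with p hp
        simp only [wavePacket, map_mul, Complex.conj_ofReal, conj_pwave _ hz hp.2]
        ring
      have hcf := hf.continuous
      have h4 := hmul (ψ := fun p => (f p.1 : ℂ) * ((√(plm p.1) : ℂ) * pwave (-p.1) z p.2))
        (ContinuousOn.mul (by fun_prop) hψ)
      rw [integral_congr_ae h3, strip, integral_prod _ h4] at h2
      refine Eq.trans ?_ h2
      congr 1
      ext r
      rw [Complex.real_smul, ← integral_const_mul]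
      simp only [mul_assoc]
  filter_upwards [h1, ae_restrict_mem measurableSet_Ioo] with r hr hrR
  have h5 := hr hrR
  simp only [mul_assoc] at h5
  rw [integral_const_mul] at h5
  refine (mul_eq_zero.1 h5).resolve_left ?_
  exact_mod_cast (Real.sqrt_pos.2 (plm_pos hrR.1)).ne'

theorem ae_eq_zero_of_forall_testFun {R : ℝ} {g : ℝ × ℂ → ℂ} (hg : MemLp g 2 (strip 0 R))
    (h : ∀ i : TestFun R × Metric.ball (0 : ℂ) 1,
      ∫ p, conj (wavePacket (fun p => (i.1.toFun p.1 : ℂ)) i.2 p) * g p ∂strip 0 R = 0) :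
    g =ᵐ[strip 0 R] 0 := by
  have : Nonempty (Metric.ball (0 : ℂ) 1) := ⟨0, by simp⟩
  have hg1 : Integrable g (strip 0 R) := hg.integrable one_le_two
  have hg2 : Integrable (fun p => ‖g p‖ ^ 2) (strip 0 R) :=
    (memLp_two_iff_integrable_sq_norm hg.1).1 hg
  have h1 : ∀ᵐ r ∂volume.restrict (Set.Ioo 0 R), ∀ n, ∫ b, pwave (-r)
      (TopologicalSpace.denseSeq (Metric.ball (0 : ℂ) 1) n) b * g (r, b) ∂circleMeasure = 0 :=
    ae_all_iff.2 fun n => ae_integral_pwave_mul_eq_zero hg1 _ fun f => h (f, _)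
  have hg1' := hg1
  have hg2' := hg2
  rw [strip] at hg1' hg2'
  have h2 : ∀ᵐ r ∂volume.restrict (Set.Ioo 0 R),
      ∫ b, ‖g (r, b)‖ ^ 2 ∂circleMeasure = 0 := by
    filter_upwards [h1, hg1'.prod_right_ae, hg2'.prod_right_ae] with r hr hi hi2
    have h3 := (continuous_integral_pwave_mul (-r) hi).ext_on
      (TopologicalSpace.denseRange_denseSeq _) continuous_const (g := fun _ => 0)
      (by rintro _ ⟨n, rfl⟩; exact hr n)
    have h4 := ae_eq_zero_of_forall_integral_pwave_mul (-r)
      ((memLp_two_iff_integrable_sq_norm hi.1).2 hi2)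
      fun z hz => congr_fun h3 ⟨z, mem_ball_zero_iff.2 hz⟩
    rw [integral_eq_zero_of_ae]
    filter_upwards [h4] with b hb
    simp only [Pi.zero_apply] at hb ⊢
    simp [hb]
  have h5 : ∫ p, ‖g p‖ ^ 2 ∂strip 0 R = 0 := by
    rw [strip, integral_prod _ hg2', integral_eq_zero_of_ae h2]
  rw [integral_eq_zero_iff_of_nonneg (fun p => by positivity) hg2] at h5
  filter_upwards [h5] with p hp
  simpa using hp

theorem integral_norm_inner_waveVec_sq {R : ℝ} {u : ℝ × ℂ → ℂ} (hu : MemLp u 2 (strip 0 R)) :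
    ∫ w, ‖∫ p, conj (wavePacket 1 w p) * u p ∂strip 0 R‖ ^ 2 ∂hypVol =
      ∫ p, ‖u p‖ ^ 2 ∂strip 0 R := by
  have hz : ∀ i : TestFun R × Metric.ball (0 : ℂ) 1, ‖(i.2 : ℂ)‖ < 1 :=
    fun i => mem_ball_zero_iff.1 i.2.2
  have h1 := integral_norm_inner_sq_of_dense_span (ν := hypVol) (k := waveVec R)
    (e := fun i : TestFun R × Metric.ball (0 : ℂ) 1 => (memLp_testFun i.1 i.2).toLp)
    (fun i => AEStronglyMeasurable.congr
      ((measurable_invSph i.1.contDiff.continuous.measurable).comp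
        (measurable_mob i.2)).aestronglyMeasurable (ae_inner_waveVec i).symm)
    (fun i j => (integral_invSph_mul_invSph i.1 j.1 (hz i) (hz j)).1.congr
      (ae_conj_inner_waveVec_mul i j).symm)
    (fun i j => by
      rw [integral_congr_ae (ae_conj_inner_waveVec_mul i j),
        (integral_invSph_mul_invSph i.1 j.1 (hz i) (hz j)).2, inner_toLp])
    (dense_span_toLp _ fun g hg h => ae_eq_zero_of_forall_testFun hg h) hu.toLp
  rw [norm_toLp_sq] at h1
  rw [← h1]
  refine integral_congr_ae ?_
  filter_upwards [ae_hypVol_norm_lt_one] with w hw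
  rw [inner_waveVec hw]

theorem setIntegral_Ioi_eq_Ioo {E : Type*} [NormedAddCommGroup E] [NormedSpace ℝ E] {R : ℝ}
    {f : ℝ → E} (h0 : ∀ r, R ≤ |r| → f r = 0) :
    ∫ r in Set.Ioi (0 : ℝ), f r = ∫ r in Set.Ioo 0 R, f r :=
  setIntegral_eq_of_subset_of_forall_sdiff_eq_zero measurableSet_Ioi Set.Ioo_subset_Ioi_self
    fun r hr => h0 r (not_lt.1 fun h => hr.2 ⟨hr.1, (le_abs_self r).trans_lt h⟩)

theorem integral_kernel_eq {R : ℝ} {u : ℝ × ℂ → ℂ} (hu : Continuous u)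
    (h0 : ∀ p : ℝ × ℂ, R ≤ |p.1| → u p = 0) {z w : ℂ} (hz : ‖z‖ < 1) (hw : ‖w‖ < 1) :
    ∫ b, (∫ r in Set.Ioi (0 : ℝ), u (r, b) * pwave r z b * pwave (-r) w b * (plm r : ℂ))
      ∂circleMeasure =
      ∫ p, conj (wavePacket 1 w p) * wavePacket u z p ∂strip 0 R := by
  have hm := continuous_plm
  have hi : Integrable (fun p : ℝ × ℂ => (plm p.1 : ℂ) * (conj ((1 : ℝ × ℂ → ℂ) p) * u p) *
      (pwave p.1 z p.2 * pwave (-p.1) w p.2)) (strip 0 R) := by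
    refine integrable_strip (ContinuousOn.mul ?_ ((continuousOn_pwave_rb hz).mul
      (continuousOn_pwave_neg_rb hw))) 0 R
    simp only [Pi.one_apply, map_one, one_mul]
    fun_prop
  rw [integral_conj_wavePacket_mul _ _ hw, strip, integral_prod_symm _ hi]
  congr 1
  ext b
  rw [setIntegral_Ioi_eq_Ioo (R := R)]
  · congr 1
    ext r
    simp only [Pi.one_apply, map_one, one_mul]
    ring
  · intro r hr
    rw [h0 (r, b) hr]
    ring

theorem continuousOn_norm_sq_mul_Pk {u : ℝ × ℂ → ℂ} (hu : Continuous u) {z : ℂ} (hz : ‖z‖ < 1) :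
    ContinuousOn (fun p : ℝ × ℂ => ((‖u p‖ ^ 2 * Pk z p.2 * plm p.1 : ℝ) : ℂ))
      (Set.univ ×ˢ Metric.sphere 0 1) := by
  have hm := continuous_plm
  have hP : ContinuousOn (fun p : ℝ × ℂ => Pk z p.2) (Set.univ ×ˢ Metric.sphere 0 1) :=
    (continuousOn_Pk hz).comp (f := fun p : ℝ × ℂ => p.2) (by fun_prop) fun _ hp => hp.2
  exact Complex.continuous_ofReal.comp_continuousOn (by fun_prop)

theorem integrable_norm_sq_mul_Pk {u : ℝ × ℂ → ℂ} (hu : Continuous u) {z : ℂ} (hz : ‖z‖ < 1)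
    (c d : ℝ) : Integrable (fun p : ℝ × ℂ => ‖u p‖ ^ 2 * Pk z p.2 * plm p.1) (strip c d) := by
  have h := (integrable_strip (continuousOn_norm_sq_mul_Pk hu hz) c d).re
  exact h.congr (Filter.Eventually.of_forall fun p => by simp only [RCLike.re_to_complex, Complex.ofReal_re])

theorem integral_norm_wavePacket_sq {u : ℝ × ℂ → ℂ} {z : ℂ} (hz : ‖z‖ < 1) (R : ℝ) :
    ∫ p, ‖wavePacket u z p‖ ^ 2 ∂strip 0 R =
      ∫ p, ‖u p‖ ^ 2 * Pk z p.2 * plm p.1 ∂strip 0 R := by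
  refine integral_congr_ae ?_
  filter_upwards [ae_strip 0 R] with p hp
  rw [wavePacket, norm_mul, norm_mul, norm_pwave _ hz hp.2, Complex.norm_real,
    Real.norm_of_nonneg (Real.sqrt_nonneg _), mul_pow, mul_pow, Real.sq_sqrt (plm_nonneg hp.1.1.le),
    Real.sq_sqrt (Pk_pos hz hp.2).le]
  ring

theorem integral_norm_sq_mul_Pk {R : ℝ} {u : ℝ × ℂ → ℂ} (hu : Continuous u)
    (h0 : ∀ p : ℝ × ℂ, R ≤ |p.1| → u p = 0) {z : ℂ} (hz : ‖z‖ < 1)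
    (heven : ∀ r, ∫ b, ‖u (-r, b)‖ ^ 2 * Pk z b ∂circleMeasure =
      ∫ b, ‖u (r, b)‖ ^ 2 * Pk z b ∂circleMeasure) :
    ∫ b, (∫ r : ℝ, ‖u (r, b)‖ ^ 2 * Pk z b * plm r) ∂circleMeasure =
      2 * ∫ p, ‖u p‖ ^ 2 * Pk z p.2 * plm p.1 ∂strip 0 R := by
  set A : ℝ → ℝ := fun r => (∫ b, ‖u (r, b)‖ ^ 2 * Pk z b ∂circleMeasure) * plm r with hA
  have hA0 : ∀ r, R ≤ |r| → A r = 0 := by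
    intro r hr
    simp [hA, h0 (r, _) hr]
  have habs : ∀ r, A |r| = A r := by
    intro r
    rcases abs_choice r with h | h
    · rw [h]
    · rw [h]
      simp only [hA, heven, plm_neg]
  have hprod : ∀ c d, ∫ p, ‖u p‖ ^ 2 * Pk z p.2 * plm p.1 ∂strip c d =
      ∫ r in Set.Ioo c d, A r := by
    intro c d
    rw [strip, integral_prod _ (integrable_norm_sq_mul_Pk hu hz c d)]
    simp only [integral_mul_const, hA]
  have hI : ∫ r, A r = 2 * ∫ r in Set.Ioi (0 : ℝ), A r := by
    rw [← integral_comp_abs]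
    simp only [habs]
  rw [hprod, ← setIntegral_Ioi_eq_Ioo hA0, ← hI]
  have h1 : ∀ b, ∫ r : ℝ, ‖u (r, b)‖ ^ 2 * Pk z b * plm r =
      ∫ r in Set.Ioo (-R) R, ‖u (r, b)‖ ^ 2 * Pk z b * plm r := by
    intro b
    refine (setIntegral_eq_integral_of_forall_compl_eq_zero fun r hr => ?_).symm
    rw [h0 (r, b) (not_lt.1 fun h => hr (abs_lt.1 h))]
    simp
  simp only [h1]
  have h2 := hprod (-R) R
  have h3 := integrable_norm_sq_mul_Pk hu hz (-R) R
  rw [strip] at h2 h3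
  rw [integral_prod_symm _ h3] at h2
  rw [h2]
  exact setIntegral_eq_integral_of_forall_compl_eq_zero fun r hr =>
    hA0 r (not_lt.1 fun h => hr (abs_lt.1 h))

/-- Hilbert–Schmidt norm of a hyperbolic pseudodifferential operator on the disc:
the quantization `a ↦ Op(a)` is unitary from `L²_W(G × ℝ, dg × dp)` onto the
Hilbert–Schmidt operators on 𝔻. -/
theorem hilbert_schmidt_norm_of_kernel
    (a : ℂ → ℂ → ℝ → ℂ)
    (hsm : ContDiff ℝ (⊤ : ℕ∞) fun p : ℂ × ℂ × ℝ => a p.1 p.2.1 p.2.2)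
    (hcs : HasCompactSupport fun p : ℂ × ℂ × ℝ => a p.1 p.2.1 p.2.2)
    (hsupp : ∀ p ∈ tsupport (fun p : ℂ × ℂ × ℝ => a p.1 p.2.1 p.2.2), ‖p.1‖ < 1)
    (hWeyl : ∀ z w : ℂ, ‖z‖ < 1 → ‖w‖ < 1 → ∀ r : ℝ,
      (∫ b, a z b r * (Pk z b : ℂ) ^ ((1 : ℂ) / 2 + Complex.I * (r : ℂ)) *
          (Pk w b : ℂ) ^ ((1 : ℂ) / 2 - Complex.I * (r : ℂ)) ∂circleMeasure) =
      ∫ b, a z b (-r) * (Pk z b : ℂ) ^ ((1 : ℂ) / 2 - Complex.I * (r : ℂ)) *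
          (Pk w b : ℂ) ^ ((1 : ℂ) / 2 + Complex.I * (r : ℂ)) ∂circleMeasure)
    (K : ℂ → ℂ → ℂ)
    (hK : ∀ z w : ℂ, K z w =
      ∫ b, (∫ r in Set.Ioi (0 : ℝ),
          a z b r * (Pk z b : ℂ) ^ ((1 : ℂ) / 2 + Complex.I * (r : ℂ)) *
            (Pk w b : ℂ) ^ ((1 : ℂ) / 2 - Complex.I * (r : ℂ)) *
            (((2 * Real.pi)⁻¹ * r * Real.tanh (Real.pi * r) : ℝ) : ℂ))
        ∂circleMeasure) :
    (∫ z, (∫ w, ‖K z w‖ ^ 2 ∂hypVol) ∂hypVol) =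
    (1 / 2) * ∫ z, (∫ b, (∫ r : ℝ,
        ‖a z b r‖ ^ 2 * Pk z b * ((2 * Real.pi)⁻¹ * r * Real.tanh (Real.pi * r)))
      ∂circleMeasure) ∂hypVol := by
  obtain ⟨R, -, hR⟩ := hcs.isCompact.isBounded.subset_ball_lt 0 0
  have h0 : ∀ z b r, R ≤ |r| → a z b r = 0 := by
    intro z b r hr
    refine image_eq_zero_of_notMem_tsupport (f := fun p : ℂ × ℂ × ℝ => a p.1 p.2.1 p.2.2)
      (x := (z, b, r)) fun h => hr.not_gt ?_
    have h1 := mem_ball_zero_iff.1 (hR h)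
    exact (norm_snd_le (b, r)).trans_lt ((norm_snd_le (z, b, r)).trans_lt h1)
  rw [← integral_const_mul]
  refine integral_congr_ae ?_
  filter_upwards [ae_hypVol_norm_lt_one] with z hz
  have hu : Continuous fun p : ℝ × ℂ => a z p.2 p.1 :=
    hsm.continuous.comp (by fun_prop : Continuous fun p : ℝ × ℂ => (z, p.2, p.1))
  have hu0 : ∀ p : ℝ × ℂ, R ≤ |p.1| → a z p.2 p.1 = 0 := fun p => h0 z p.2 p.1
  have hK' : ∀ w, ‖w‖ < 1 → K z w =
      ∫ p, conj (wavePacket 1 w p) * wavePacket (fun p => a z p.2 p.1) z p ∂strip 0 R := by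
    intro w hw
    rw [← integral_kernel_eq hu hu0 hz hw, hK]
    simp only [pwave_neg]
    rfl
  have hcont : ∀ r, ContinuousOn (fun b => a z b r) (Metric.sphere 0 1) := fun r =>
    (hu.comp (by fun_prop : Continuous fun b : ℂ => (r, b))).continuousOn
  have heven : ∀ r, ∫ b, ‖a z b (-r)‖ ^ 2 * Pk z b ∂circleMeasure =
      ∫ b, ‖a z b r‖ ^ 2 * Pk z b ∂circleMeasure := by
    intro r
    refine (integral_norm_sq_eq_of_weyl (r := r) hz (hcont r) (hcont (-r)) fun w hw => ?_).symm
    simp only [pwave_neg]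
    exact hWeyl z w hz hw r
  have h2 := integral_norm_sq_mul_Pk hu hu0 hz heven
  have h3 : ∫ w, ‖K z w‖ ^ 2 ∂hypVol = ∫ p, ‖a z p.2 p.1‖ ^ 2 * Pk z p.2 * plm p.1 ∂strip 0 R := by
    rw [← integral_norm_wavePacket_sq hz R,
      ← integral_norm_inner_waveVec_sq (memLp_wavePacket hu.continuousOn hz 0 R)]
    refine integral_congr_ae ?_
    filter_upwards [ae_hypVol_norm_lt_one] with w hw
    rw [hK' w hw]
  rw [h3]
  have h4 : ∀ x : ℝ, x = 1 / 2 * (2 * x) := fun x => by ring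
  rw [h4 (∫ p, _ ∂strip 0 R), ← h2]
  rfl
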